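/- Let G be a Smirnov domain and fix ζ ∈ G. Then for every n ∈ ℕ, the polynomials J_{2n+1} satisfy ‖φ − J_{2n+1}‖_∞ ≤ 8π · ‖K(·,ζ) − Σ_{k=0}^n conj(p_k(ζ))·p_k(·)‖₂, and the right-hand side tends to 0 as n → ∞; in particular J_{2n+1} → φ uniformly on the closure of G. -/

import Mathlib

open Complex MeasureTheory Set Filter Metric

noncomputable section

/-- A bounded Jordan domain `G ⊆ ℂ` whose boundary is a rectifiable Jordan curve
of length `l`, given together with a unit-speed (arclength) parametrization `γ`
of the boundary curve `L = frontier G`. -/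
structure JordanDomain where
  /-- the domain -/
  G : Set ℂ
  isOpen : IsOpen G
  nonempty : G.Nonempty
  bounded : Bornology.IsBounded G
  connected : IsConnected G
  simplyConnected : SimplyConnectedSpace ↥G
  /-- the length of the boundary curve -/
  l : ℝ
  l_pos : 0 < l
  /-- arclength parametrization of the boundary curve -/
  γ : ℝ → ℂ
  γ_cont : Continuous γ
  γ_periodic : Function.Periodic γ l
  γ_injOn : InjOn γ (Ico 0 l)
  γ_boundary : γ '' Ico 0 l = frontier G
  /-- `γ` is a unit-speed (arclength) parametrization; in particular the boundary
  is rectifiable with length `l`. -/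
  γ_unitSpeed : ∀ s t : ℝ, s ≤ t → t ≤ s + l →
    eVariationOn γ (Icc s t) = ENNReal.ofReal (t - s)

/-- The `E₂(G)`-norm of (the boundary trace of) a function, computed through the
arclength parametrization of the boundary: `‖g‖₂ = ((1/l) ∫₀^l ‖g(s)‖² ds)^{1/2}`. -/
def JordanDomain.bnorm (D : JordanDomain) (g : ℝ → ℂ) : ℝ :=
  Real.sqrt ((1 / D.l) * ∫ s in (0:ℝ)..D.l, ‖g s‖ ^ 2)

/-- `p` is the sequence of orthonormal polynomials of `E₂(G)` obtained by Gram–Schmidt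
orthonormalization of the monomials `1, z, z², …`: `deg p k = k`, the leading
coefficients are positive reals, and the polynomials are orthonormal with respect to
the arclength inner product `(f,g) = (1/l) ∫_L f conj(g) |dz|`. -/
def JordanDomain.IsONPolys (D : JordanDomain) (p : ℕ → Polynomial ℂ) : Prop :=
  (∀ k, (p k).natDegree = k) ∧
  (∀ k, ∃ c : ℝ, 0 < c ∧ (p k).leadingCoeff = (c : ℂ)) ∧
  (∀ j k, (1 / (D.l : ℂ)) * (∫ s in (0:ℝ)..D.l,
      (p j).eval (D.γ s) * (starRingEnd ℂ) ((p k).eval (D.γ s))) =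
    if j = k then 1 else 0)

/-- The `n`-th partial sum `Σ_{k=0}^n conj(p_k(ζ))·p_k(z)` of the Szegő kernel expansion. -/
def partialSum (p : ℕ → Polynomial ℂ) (ζ : ℂ) (n : ℕ) : ℂ → ℂ := fun z =>
  ∑ k ∈ Finset.range (n + 1), (starRingEnd ℂ) ((p k).eval ζ) * (p k).eval z

/-- The Szegő kernel `K(z,ζ) = Σ_{k=0}^∞ conj(p_k(ζ))·p_k(z)`. -/
def szegoKernel (p : ℕ → Polynomial ℂ) (ζ z : ℂ) : ℂ :=
  ∑' k : ℕ, (starRingEnd ℂ) ((p k).eval ζ) * (p k).eval z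

/-- The approximating polynomials
`J_{2n+1}(z) = (2π/l)·(∫_ζ^z (Σ_{k=0}^n conj(p_k(ζ))p_k(t))² dt) / (Σ_{k=0}^n |p_k(ζ)|²)`;
the (path-independent) integral of the polynomial integrand is written out explicitly,
using `∫_ζ^z t^i dt = (z^{i+1} - ζ^{i+1})/(i+1)`. -/
def Jfun (D : JordanDomain) (p : ℕ → Polynomial ℂ) (ζ : ℂ) (n : ℕ) : ℂ → ℂ := fun z =>
  let S : Polynomial ℂ :=
    (∑ k ∈ Finset.range (n + 1), Polynomial.C ((starRingEnd ℂ) ((p k).eval ζ)) * p k) ^ 2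
  (((2 * Real.pi / D.l : ℝ) : ℂ) / (∑ k ∈ Finset.range (n + 1), ((‖(p k).eval ζ‖ : ℂ)) ^ 2)) *
    ∑ i ∈ Finset.range (S.natDegree + 1),
      S.coeff i * ((z ^ (i + 1) - ζ ^ (i + 1)) / ((i : ℂ) + 1))

/-- `Q_n(z) = ((l/2π)·Σ_{k=0}^n |p_k(ζ)|²)^{-1/2} · Σ_{k=0}^n conj(p_k(ζ))·p_k(z)`,
so that `J'_{2n+1} = Q_n²`. -/
def Qfun (D : JordanDomain) (p : ℕ → Polynomial ℂ) (ζ : ℂ) (n : ℕ) : ℂ → ℂ := fun z =>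
  ((Real.sqrt ((D.l / (2 * Real.pi)) *
      ∑ k ∈ Finset.range (n + 1), ‖(p k).eval ζ‖ ^ 2) : ℝ) : ℂ)⁻¹ * partialSum p ζ n z

/-- The sup norm `⨆_{z ∈ K} ‖f(z)‖` on a set `K ⊆ ℂ`. -/
def supNormOn (K : Set ℂ) (f : ℂ → ℂ) : ℝ := ⨆ z : K, ‖f (z : ℂ)‖

/-- `g` has nontangential limit `v` at the boundary point `w` of `G`:
`g(z) → v` as `z → w` inside every cone `{z ∈ G : ‖z - w‖ ≤ M·dist(z, ∂G)}`. -/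
def NTLim (G : Set ℂ) (g : ℂ → ℂ) (w v : ℂ) : Prop :=
  ∀ M : ℝ, 1 < M →
    Tendsto g (nhdsWithin w {z | z ∈ G ∧ ‖z - w‖ ≤ M * infDist z (frontier G)}) (nhds v)

/-- `φ` is the conformal map of `G` onto the unit disk `D` normalized by
`φ(ζ) = 0` and `φ'(ζ) > 0`. -/
structure ConformalOnto (G : Set ℂ) (φ : ℂ → ℂ) (ζ : ℂ) : Prop where
  differentiable : ∀ z ∈ G, DifferentiableAt ℂ φ z
  bijOn : BijOn φ G (ball (0 : ℂ) 1)
  map_center : φ ζ = 0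
  deriv_center_pos : ∃ c : ℝ, 0 < c ∧ deriv φ ζ = (c : ℂ)

/-- `G` is a Smirnov domain: for any conformal map `ψ` of the unit disk onto `G`,
`log|ψ'|` is represented by the Poisson integral of its (radial) boundary values.
(By the Keldysh–Lavrentiev theorem this is equivalent to polynomials being dense
in the Smirnov classes `E_p(G)`.) -/
def IsSmirnovDomain (G : Set ℂ) : Prop :=
  ∀ ψ : ℂ → ℂ,
    (∀ w ∈ ball (0 : ℂ) 1, DifferentiableAt ℂ ψ w) →
    BijOn ψ (ball (0 : ℂ) 1) G →
    ∃ h : ℝ → ℝ,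
      IntervalIntegrable h volume 0 (2 * Real.pi) ∧
      (∀ᵐ (θ : ℝ) ∂(volume.restrict (Ioc (0 : ℝ) (2 * Real.pi))),
        Tendsto (fun r : ℝ => Real.log ‖deriv ψ ((r : ℂ) * Complex.exp ((θ : ℂ) * Complex.I))‖)
          (nhdsWithin 1 (Iio 1)) (nhds (h θ))) ∧
      (∀ w ∈ ball (0 : ℂ) 1,
        Real.log ‖deriv ψ w‖ =
          (1 / (2 * Real.pi)) * ∫ θ in (0 : ℝ)..(2 * Real.pi),
            ((1 - ‖w‖ ^ 2) / ‖Complex.exp ((θ : ℂ) * Complex.I) - w‖ ^ 2) * h θ)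

/-- The (interior) opening angle of `G` at the boundary point `z₀` equals `a`:
the angular measure of the set of directions in which `G` is seen from `z₀`
at distance `r` tends to `a` as `r → 0⁺`. -/
def HasCornerAngle (G : Set ℂ) (z₀ : ℂ) (a : ℝ) : Prop :=
  Tendsto (fun r : ℝ =>
      (volume {θ : ℝ | θ ∈ Ico 0 (2 * Real.pi) ∧
        z₀ + (r : ℂ) * Complex.exp ((θ : ℂ) * Complex.I) ∈ G}).toReal)
    (nhdsWithin 0 (Ioi 0)) (nhds a)

/-- The boundary of the Jordan domain `D` is piecewise analytic: it is a union of
finitely many analytic arcs `τ i '' [0,1]` (each `τ i` is conformal, i.e. injective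
and holomorphic, on an open neighborhood `U i` of the segment `[0,1]`), consecutive
arcs are joined at the junction points `τ i 1 = τ (i+1) 0`, and at the junction
point `τ i 1` the exterior angle of `G` is `extAngle i · π` (so the interior
opening angle there is `(2 - extAngle i) · π`). -/
structure PiecewiseAnalyticBoundary (D : JordanDomain) where
  /-- number of analytic arcs -/
  m : ℕ
  m_pos : 0 < m
  /-- conformal parametrizations of the arcs -/
  τ : Fin m → ℂ → ℂ
  /-- neighborhoods of the segment `[0,1]` on which the `τ i` are conformal -/
  U : Fin m → Set ℂ
  U_open : ∀ i, IsOpen (U i)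
  seg_sub : ∀ i, (Complex.ofReal '' Icc (0 : ℝ) 1) ⊆ U i
  analytic : ∀ i, DifferentiableOn ℂ (τ i) (U i)
  inj : ∀ i, InjOn (τ i) (U i)
  cover : (⋃ i, τ i '' (Complex.ofReal '' Icc (0 : ℝ) 1)) = frontier D.G
  junction : ∀ i : Fin m,
    τ i 1 = τ (Fin.mk ((i.val + 1) % m) (Nat.mod_lt _ m_pos)) 0
  /-- `extAngle i · π` is the exterior angle at the junction point `τ i 1` -/
  extAngle : Fin m → ℝ
  extAngle_mem : ∀ i, extAngle i ∈ Ioo (0 : ℝ) 2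
  extAngle_spec : ∀ i, HasCornerAngle D.G (τ i 1) ((2 - extAngle i) * Real.pi)

end


theorem exists_log_univ {X : Type*} [TopologicalSpace X] [LocallyPathConnectedSpace X]
    [SimplyConnectedSpace X] (F : X → ℂ) (hF : Continuous F) (h0 : ∀ z, F z ≠ 0) :
    ∃ g : X → ℂ, Continuous g ∧ ∀ z, Complex.exp (g z) = F z := by
  have hU : IsSimplyConnected (univ : Set X) :=
    ((Homeomorph.Set.univ X).symm.toHomotopyEquiv.simplyConnectedSpace_iff).mp inferInstance
  obtain ⟨f, hf, he⟩ := Complex.exists_continuousOn_eqOn_exp_comp hU isOpen_univ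
    (g := F) hF.continuousOn (by rintro ⟨z, -, hz⟩; exact h0 z hz)
  exact ⟨f, continuousOn_univ.mp hf, fun z => he (mem_univ z)⟩

theorem no_log_ext (v : ℂ) (F : ℂ → ℂ) (hF : Continuous F) (h0 : ∀ z, F z ≠ 0) (R : ℝ)
    (h : ∀ z, R ≤ ‖z - v‖ → F z = z - v) : False := by
  obtain ⟨g, hg, he⟩ := exists_log_univ F hF h0
  set R' : ℝ := max R 1 with hR'
  have hR1 : 0 < R' := lt_of_lt_of_le one_pos (le_max_right _ _)
  let c : ℝ → ℂ := fun t => v + (R' : ℂ) * Complex.exp (t * I)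
  have hc : Continuous c := by fun_prop
  let u : ℝ → ℂ := fun t => g (c t) - t * I - (Real.log R' : ℝ)
  have hu : Continuous u := by fun_prop
  have hu1 : ∀ t, Complex.exp (u t) = 1 := by
    intro t
    have hn : ‖c t - v‖ = R' := by
      simp [c, Complex.norm_exp, abs_of_pos hR1]
    have h1 : F (c t) = (R' : ℂ) * Complex.exp (t * I) := by
      rw [h _ (by rw [hn]; exact le_max_left _ _)]; simp [c]
    simp only [u, Complex.exp_sub, he, h1]
    rw [← Complex.ofReal_exp, Real.exp_log hR1]
    have : (R' : ℂ) ≠ 0 := by exact_mod_cast hR1.ne'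
    have := Complex.exp_ne_zero (t * I)
    field_simp
  have hcos : ∀ t, Real.cos ((u t).im) = 1 := by
    intro t
    obtain ⟨n, hn⟩ := Complex.exp_eq_one_iff.mp (hu1 t)
    have : (u t).im = n * (2 * Real.pi) := by rw [hn]; simp
    rw [this]; exact Real.cos_int_mul_two_pi n
  have hper : (u (2 * Real.pi)).im = (u 0).im - 2 * Real.pi := by
    have : c (2 * Real.pi) = c 0 := by simp [c]
    simp [u, this]
  have hi : Continuous fun t => (u t).im := Complex.continuous_im.comp hu
  have := intermediate_value_Icc' (Real.two_pi_pos.le) hi.continuousOn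
  have hm : (u 0).im - Real.pi ∈ Icc ((u (2 * Real.pi)).im) ((u 0).im) := by
    rw [hper]; constructor <;> linarith [Real.pi_pos]
  obtain ⟨t, -, ht⟩ := this hm
  have h2 := hcos t
  simp only at ht
  rw [ht, Real.cos_sub_pi, hcos 0] at h2
  norm_num at h2

theorem JordanDomain.γ_mem (D : JordanDomain) (t : ℝ) : D.γ t ∈ frontier D.G := by
  rw [← D.γ_boundary]
  obtain ⟨v, hv, hv2⟩ := D.γ_periodic.exists_mem_Ico₀ D.l_pos t
  exact ⟨v, hv, hv2.symm⟩

theorem JordanDomain.inj_of_lt (D : JordanDomain) {t t' : ℝ} (h : |t - t'| < D.l)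
    (h' : D.γ t = D.γ t') : t = t' := by
  have hl := D.l_pos
  have key : ∀ u, ∃ v ∈ Ico 0 D.l, ∃ n : ℤ, u = v + n * D.l ∧ D.γ u = D.γ v := by
    intro u
    have h1 : u = toIcoMod hl 0 u + (toIcoDiv hl 0 u) * D.l := by
      have := toIcoMod_add_toIcoDiv_zsmul hl 0 u
      simpa using this.symm
    refine ⟨toIcoMod hl 0 u, by simpa using toIcoMod_mem_Ico hl 0 u, toIcoDiv hl 0 u, h1, ?_⟩
    conv_lhs => rw [h1]
    exact D.γ_periodic.int_mul _ _
  obtain ⟨v, hv, n, hn, hn'⟩ := key t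
  obtain ⟨v', hv', n', hm', hm''⟩ := key t'
  have hvv : v = v' := D.γ_injOn hv hv' (by rw [← hn', ← hm'', h'])
  subst hvv
  have : |((n - n' : ℤ) : ℝ)| * D.l < 1 * D.l := by
    rw [abs_lt] at h
    rw [← abs_of_pos hl, ← abs_mul, abs_of_pos hl, abs_lt]
    push_cast
    constructor <;> linarith
  have h3 : |((n - n' : ℤ) : ℝ)| < 1 := lt_of_mul_lt_mul_right this hl.le
  have h4 : |n - n'| < 1 := by exact_mod_cast h3
  have h5 : n = n' := by have := Int.abs_lt_one_iff.mp h4; omega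
  rw [hn, hm', h5]

theorem frontier_compl_closure_subset (G : Set ℂ) : frontier (closure G)ᶜ ⊆ frontier G := by
  rw [frontier_compl]; exact frontier_closure_subset

/-- frontier points are not interior to the closure -/
theorem JordanDomain.mem_closure_ext (D : JordanDomain) {x : ℂ} (hx : x ∈ frontier D.G) :
    x ∈ closure (closure D.G)ᶜ := by
  classical
  by_contra hcon
  obtain ⟨ζ, hζ⟩ := D.nonempty
  rw [← D.γ_boundary] at hx
  obtain ⟨s, hs, rfl⟩ := hx
  -- small interval about s mapped outside closure of the exterior
  have hop : IsOpen (D.γ ⁻¹' (closure (closure D.G)ᶜ)ᶜ) :=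
    isClosed_closure.isOpen_compl.preimage D.γ_cont
  obtain ⟨e, he, hb⟩ := Metric.isOpen_iff.mp hop s hcon
  set a := s + min (e/2) (D.l/4) with ha
  have hm : 0 < min (e/2) (D.l/4) := lt_min (by linarith) (by linarith [D.l_pos])
  have hme : min (e/2) (D.l/4) < e := lt_of_le_of_lt (min_le_left _ _) (by linarith)
  have hml : min (e/2) (D.l/4) < D.l := lt_of_le_of_lt (min_le_right _ _) (by linarith [D.l_pos])
  have hl := D.l_pos
  -- the arc
  have hinj : Function.Injective (fun t : Icc a (s + D.l) => D.γ t) := by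
    rintro ⟨t, ht1, ht2⟩ ⟨t', ht1', ht2'⟩ h
    have h' : D.γ t = D.γ t' := h
    ext
    exact D.inj_of_lt (by rw [abs_lt]; constructor <;> linarith) h'
  have hce : Topology.IsClosedEmbedding (fun t : Icc a (s + D.l) => D.γ t) :=
    Continuous.isClosedEmbedding (D.γ_cont.comp continuous_subtype_val) hinj
  have hζ1 : ζ ∉ closure (closure D.G)ᶜ := by
    rw [_root_.mem_closure_iff]; push Not
    exact ⟨D.G, D.isOpen, hζ, by
      rw [eq_empty_iff_forall_notMem]; rintro z ⟨h1, h2⟩; exact h2 (subset_closure h1)⟩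
  have hζ2 : ∀ t, D.γ t ≠ ζ := by
    intro t ht
    have hfr := D.γ_mem t
    rw [ht, D.isOpen.frontier_eq] at hfr
    exact hfr.2 hζ
  obtain ⟨u, hu, hue⟩ := exists_log_univ (fun t : ℝ => D.γ t - ζ) (D.γ_cont.sub continuous_const)
    (fun t => sub_ne_zero.mpr (hζ2 t))
  obtain ⟨g, hg⟩ := ContinuousMap.exists_extension hce
    ⟨fun t : Icc a (s + D.l) => u t, hu.comp continuous_subtype_val⟩
  have hg' : ∀ t ∈ Icc a (s + D.l), Complex.exp (g (D.γ t)) = D.γ t - ζ := by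
    intro t ht
    have := congrArg (fun f : C(Icc a (s + D.l), ℂ) => f ⟨t, ht⟩) hg
    simp only [ContinuousMap.comp_apply, ContinuousMap.coe_mk] at this
    rw [this, hue]
  set C := closure (closure D.G)ᶜ with hC
  have hfr : ∀ z ∈ frontier C, z - ζ = Complex.exp (g z) := by
    intro z hz
    have hz1 : z ∈ frontier D.G :=
      frontier_compl_closure_subset _ (frontier_closure_subset hz)
    have hz2 : z ∈ C := isClosed_closure.frontier_subset hz
    rw [← D.γ_boundary] at hz1
    obtain ⟨t, ht, rfl⟩ := hz1
    have hnot : t ∉ ball s e := fun h => hb h hz2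
    rw [mem_ball, Real.dist_eq, not_lt] at hnot
    by_cases hts : s ≤ t
    · rw [abs_of_nonneg (by linarith)] at hnot
      exact (hg' t ⟨by linarith, by linarith [ht.2, hs.1]⟩).symm
    · push Not at hts
      rw [abs_of_neg (by linarith)] at hnot
      have hta : a ≤ t + D.l := by
        by_contra hlt
        push Not at hlt
        have hbb : t + D.l ∈ ball s e := by
          rw [mem_ball, Real.dist_eq, abs_lt]; constructor <;> linarith [ht.1, hs.2]
        have := hb hbb
        rw [mem_preimage, D.γ_periodic t] at this
        exact this hz2
      have := hg' (t + D.l) ⟨hta, by linarith⟩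
      rw [D.γ_periodic t] at this
      exact this.symm
  obtain ⟨R, hR⟩ := D.bounded.subset_closedBall ζ
  refine no_log_ext ζ (C.piecewise (fun z => z - ζ) (fun z => Complex.exp (g z)))
    (Continuous.piecewise hfr (by fun_prop) (by fun_prop)) ?_ (R + 1) ?_
  · intro z
    by_cases hz : z ∈ C
    · rw [piecewise_eq_of_mem _ _ _ hz]
      exact sub_ne_zero.mpr (fun h => hζ1 (h ▸ hz))
    · rw [piecewise_eq_of_notMem _ _ _ hz]; exact Complex.exp_ne_zero _
  · intro z hz
    refine piecewise_eq_of_mem _ _ _ (subset_closure ?_)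
    intro hz2
    have := closure_minimal hR isClosed_closedBall hz2
    rw [mem_closedBall, dist_eq_norm] at this
    linarith

theorem not_eventually_eq_self (z : ℂ) (h : ∀ᶠ w in nhds z, w = z) : False := by
  obtain ⟨w, h1, h2⟩ := ((h.filter_mono (nhdsWithin_le_nhds (s := {z}ᶜ))).and
    self_mem_nhdsWithin).exists
  exact h2 h1

theorem nhds_le_map_of_injOn {G : Set ℂ} (hG : IsOpen G) {φ : ℂ → ℂ}
    (hd : DifferentiableOn ℂ φ G) (hi : InjOn φ G) {z : ℂ} (hz : z ∈ G) :
    nhds (φ z) ≤ map φ (nhds z) := by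
  have han : AnalyticAt ℂ φ z := hd.analyticAt (hG.mem_nhds hz)
  rcases han.eventually_constant_or_nhds_le_map_nhds with h | h
  · have h2 : ∀ᶠ w in nhds z, w = z := by
      filter_upwards [h, hG.mem_nhds hz] with w hw hwG
      exact hi hwG hz hw
    exact (not_eventually_eq_self z h2).elim
  · exact h

theorem continuousOn_inv_open {G B : Set ℂ} (hG : IsOpen G) {φ ψ : ℂ → ℂ}
    (hd : DifferentiableOn ℂ φ G) (hb : BijOn φ G B) (hinv : InvOn ψ φ G B) :
    ContinuousOn ψ B := by
  intro w hw
  obtain ⟨z, hz, rfl⟩ := hb.surjOn hw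
  rw [ContinuousWithinAt, hinv.1 hz]
  intro U hU
  have h := nhds_le_map_of_injOn hG hd hb.injOn hz
    (image_mem_map (inter_mem hU (hG.mem_nhds hz)))
  apply nhdsWithin_le_nhds
  filter_upwards [h] with w hw
  obtain ⟨u, hu, rfl⟩ := hw
  rw [mem_preimage, hinv.1 hu.2]; exact hu.1

theorem ConformalOnto.norm_eq_one {G : Set ℂ} (hG : IsOpen G) {φ : ℂ → ℂ} {ζ : ℂ}
    (hφ : ConformalOnto G φ ζ) (hφc : ContinuousOn φ (closure G)) {x : ℂ} (hx : x ∈ frontier G) :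
    ‖φ x‖ = 1 := by
  have hxc : x ∈ closure G := frontier_subset_closure hx
  have hxG : x ∉ G := by rw [hG.frontier_eq] at hx; exact hx.2
  have hle : φ x ∈ closedBall (0 : ℂ) 1 := by
    have h1 : MapsTo φ (closure G) (closure (ball 0 1)) := hφ.bijOn.mapsTo.closure_of_continuousOn hφc
    exact closure_ball_subset_closedBall (h1 hxc)
  rw [mem_closedBall_zero_iff] at hle
  by_contra hne
  have hlt : ‖φ x‖ < 1 := lt_of_le_of_ne hle hne
  obtain ⟨z, hz, hzx⟩ := hφ.bijOn.surjOn (mem_ball_zero_iff.mpr hlt)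
  have hd : DifferentiableOn ℂ φ G := fun w hw => (hφ.differentiable w hw).differentiableWithinAt
  -- separate z and x
  have hzx' : z ≠ x := fun h => hxG (h ▸ hz)
  obtain ⟨U, V, hU, hV, hzU, hxV, hUV⟩ := t2_separation hzx'
  have h := nhds_le_map_of_injOn hG hd hφ.bijOn.injOn hz
  · have hm : φ '' (U ∩ G) ∈ nhds (φ x) := by
      rw [← hzx]
      exact h (image_mem_map (inter_mem (hU.mem_nhds hzU) (hG.mem_nhds hz)))
    have hc := (hφc x hxc).tendsto hm
    have hc2 : ∀ᶠ w in nhdsWithin x G, φ w ∈ φ '' (U ∩ G) :=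
      nhdsWithin_mono x subset_closure hc
    have hne : (nhdsWithin x G).NeBot := mem_closure_iff_nhdsWithin_neBot.mp hxc
    have hVn : ∀ᶠ w in nhdsWithin x G, w ∈ V := nhdsWithin_le_nhds (hV.mem_nhds hxV)
    obtain ⟨w, ⟨⟨u, hu, huw⟩, hwV⟩, hwG⟩ := ((hc2.and hVn).and self_mem_nhdsWithin).exists
    have : u = w := hφ.bijOn.injOn hu.2 hwG huw
    subst this
    exact hUV.le_bot ⟨hu.1, hwV⟩

theorem ConformalOnto.no_arc (D : JordanDomain) {φ : ℂ → ℂ} {ζ : ℂ}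
    (hφ : ConformalOnto D.G φ ζ) (hφc : ContinuousOn φ (closure D.G)) {a b : ℝ} (hab : a < b)
    (hb : b < a + D.l) (p : ℂ) (hp : ∀ t ∈ Ioo a b, φ (D.γ t) = p) : False := by
  set t0 := (a + b) / 2 with ht0
  have ht : t0 ∈ Ioo a b := ⟨by linarith, by linarith⟩
  have hx := D.γ_mem t0
  set x := D.γ t0 with hxd
  have hpn : ‖p‖ = 1 := by rw [← hp t0 ht]; exact hφ.norm_eq_one D.isOpen hφc hx
  have hcl : IsClosed (D.γ '' Icc b (a + D.l)) :=
    (isCompact_Icc.image D.γ_cont).isClosed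
  have hxn : x ∈ (D.γ '' Icc b (a + D.l))ᶜ := by
    rintro ⟨u, hu, hux⟩
    have := D.inj_of_lt (by rw [abs_lt]; constructor <;> linarith [hu.1, hu.2, ht.1, ht.2]) hux
    linarith [hu.1, ht.2]
  obtain ⟨r0, hr0, hball⟩ := Metric.isOpen_iff.mp hcl.isOpen_compl x hxn
  set r := r0 / 2 with hr
  have hrpos : 0 < r := by linarith
  have harc : ∀ z ∈ frontier D.G, z ∈ closedBall x r → φ z = p := by
    intro z hz hzb
    obtain ⟨t, ht, rfl⟩ : ∃ t ∈ Ico a (a + D.l), D.γ t = z := by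
      rw [← D.γ_boundary] at hz
      obtain ⟨u, hu, rfl⟩ := hz
      obtain ⟨v, hv, hv2⟩ := D.γ_periodic.exists_mem_Ico D.l_pos u a
      exact ⟨v, hv, hv2.symm⟩
    have hn := hball (closedBall_subset_ball (by linarith) hzb)
    have htb : t < b := by
      by_contra h
      push Not at h
      exact hn ⟨t, ⟨h, ht.2.le⟩, rfl⟩
    rcases eq_or_lt_of_le ht.1 with h | h
    · exfalso
      exact hn ⟨a + D.l, ⟨hb.le, le_rfl⟩, by rw [D.γ_periodic, h]⟩
    · exact hp t ⟨h, htb⟩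
  -- choose points
  obtain ⟨z, hzG, hzx⟩ : ∃ z ∈ D.G, dist x z < r / 8 :=
    Metric.mem_closure_iff.mp (frontier_subset_closure hx) _ (by linarith)
  obtain ⟨w, hwG, hwx⟩ : ∃ w ∈ (closure D.G)ᶜ, dist x w < r / 8 :=
    Metric.mem_closure_iff.mp (D.mem_closure_ext hx) _ (by linarith)
  have hbound : ∀ m : ℕ, ‖(φ z - p) / (z - w) ^ m‖ ≤ 2 / (7 * r / 8) ^ m := by
    intro m
    have hne : ∀ u ∈ closure D.G, u - w ≠ 0 := fun u hu h => hwG (by rwa [← sub_eq_zero.mp h])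
    have hsub : closure (D.G ∩ ball x r) ⊆ closure D.G := closure_mono inter_subset_left
    have hdc : DiffContOnCl ℂ (fun u => (φ u - p) / (u - w) ^ m) (D.G ∩ ball x r) := by
      constructor
      · intro u hu
        have := hφ.differentiable u hu.1
        have h2 := hne u (subset_closure hu.1)
        apply DifferentiableAt.differentiableWithinAt
        exact (this.sub_const p).div (by fun_prop) (pow_ne_zero _ h2)
      · refine ((hφc.mono hsub).sub continuousOn_const).div (by fun_prop) ?_
        intro u hu; exact pow_ne_zero _ (hne u (hsub hu))
    refine Complex.norm_le_of_forall_mem_frontier_norm_le (D.bounded.subset inter_subset_left)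
      hdc ?_ (subset_closure ⟨hzG, by rw [mem_ball, dist_comm]; linarith⟩)
    intro u hu
    have huc : u ∈ closure D.G := hsub hu.1
    have hub : u ∈ closedBall x r :=
      closure_ball_subset_closedBall (closure_mono inter_subset_right hu.1)
    have hpos : 0 < 7 * r / 8 := by linarith
    by_cases huG : u ∈ D.G
    · have hur : r ≤ dist u x := by
        by_contra h
        push Not at h
        apply hu.2
        rw [(D.isOpen.inter isOpen_ball).interior_eq]
        exact ⟨huG, h⟩
      have h1 : 7 * r / 8 ≤ ‖u - w‖ := by
        rw [← dist_eq_norm]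
        have := dist_triangle u w x
        rw [dist_comm w x] at this
        linarith
      rw [norm_div, norm_pow]
      have h2 : ‖φ u - p‖ ≤ 2 := by
        have h3 : ‖φ u‖ < 1 := mem_ball_zero_iff.mp (hφ.bijOn.mapsTo huG)
        have := norm_sub_le (φ u) p
        linarith
      gcongr
    · have : u ∈ frontier D.G := by rw [D.isOpen.frontier_eq]; exact ⟨huc, huG⟩
      rw [harc u this hub]; simp; positivity
  have hzw : ‖z - w‖ ≤ r / 4 := by
    rw [← dist_eq_norm]
    have := dist_triangle_left z w x
    linarith
  have hzw0 : 0 < ‖z - w‖ := by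
    rw [norm_pos_iff, sub_ne_zero]; rintro rfl; exact hwG (subset_closure hzG)
  have hb2 : ∀ m : ℕ, ‖φ z - p‖ ≤ 2 * (1/2 : ℝ) ^ m := by
    intro m
    have h := hbound m
    rw [norm_div, norm_pow, div_le_iff₀ (by positivity)] at h
    calc ‖φ z - p‖ ≤ _ := h
      _ = 2 * (‖z - w‖ / (7 * r / 8)) ^ m := by rw [div_pow (‖z - w‖)]; ring
      _ ≤ _ := by
        have : ‖z - w‖ / (7 * r / 8) ≤ 1 / 2 := by
          rw [div_le_iff₀ (by positivity)]; linarith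
        gcongr
  have hlim : Tendsto (fun m : ℕ => 2 * (1/2 : ℝ) ^ m) atTop (nhds (2 * 0)) :=
    (tendsto_pow_atTop_nhds_zero_of_lt_one (by norm_num) (by norm_num)).const_mul 2
  have h0 : ‖φ z - p‖ ≤ 2 * 0 := ge_of_tendsto' hlim hb2
  have h3 : ‖φ z‖ < 1 := mem_ball_zero_iff.mp (hφ.bijOn.mapsTo hzG)
  have h4 : φ z = p := by
    rw [← sub_eq_zero, ← norm_eq_zero]; linarith [norm_nonneg (φ z - p)]
  rw [h4] at h3; linarith

theorem inv_continuousOn_of_compact {φ ψ : ℂ → ℂ} {K B : Set ℂ} (hK : IsCompact K)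
    (hφ : ContinuousOn φ K) (hb : BijOn φ K B) (hinv : InvOn ψ φ K B) : ContinuousOn ψ B := by
  rw [continuousOn_iff_isClosed]
  intro t ht
  refine ⟨φ '' (t ∩ K), ?_, ?_⟩
  · exact ((hK.inter_left ht).image_of_continuousOn (hφ.mono inter_subset_right)).isClosed
  · ext w
    constructor
    · rintro ⟨h1, h2⟩
      obtain ⟨k, hk, rfl⟩ := hb.surjOn h2
      refine ⟨⟨k, ⟨?_, hk⟩, rfl⟩, h2⟩
      have := hinv.1 hk
      rw [mem_preimage, this] at h1; exact h1
    · rintro ⟨⟨k, ⟨hk1, hk2⟩, rfl⟩, h2⟩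
      exact ⟨by rw [mem_preimage, hinv.1 hk2]; exact hk1, h2⟩

theorem deriv_ne_zero_of_inverse {G B : Set ℂ} (hG : IsOpen G) (hB : IsOpen B) {φ ψ : ℂ → ℂ}
    (hφ : DifferentiableOn ℂ φ G) (hb : BijOn φ G B) (hinv : InvOn ψ φ G B)
    (hψ : ContinuousOn ψ B) : DifferentiableOn ℂ ψ B := by
  have hψm : MapsTo ψ B G := by
    intro w hw
    obtain ⟨z, hz, rfl⟩ := hb.surjOn hw
    rw [hinv.1 hz]; exact hz
  have hgood : ∀ w ∈ B, deriv φ (ψ w) ≠ 0 → DifferentiableAt ℂ ψ w := by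
    intro w hw hd
    have h1 : HasDerivAt φ (deriv φ (ψ w)) (ψ w) :=
      ((hφ (ψ w) (hψm hw)).differentiableAt (hG.mem_nhds (hψm hw))).hasDerivAt
    refine (HasDerivAt.of_local_left_inverse (hψ.continuousAt (hB.mem_nhds hw)) h1 hd ?_).differentiableAt
    filter_upwards [hB.mem_nhds hw] with u hu
    exact hinv.2 hu
  intro w hw
  apply DifferentiableAt.differentiableWithinAt
  have han : AnalyticAt ℂ φ (ψ w) := hφ.analyticAt (hG.mem_nhds (hψm hw))
  rcases han.deriv.eventually_eq_zero_or_eventually_ne_zero with h | h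
  · exfalso
    obtain ⟨r, hr, hrb⟩ := Metric.mem_nhds_iff.mp (h.and (hG.mem_nhds (hψm hw)))
    apply not_eventually_eq_self (ψ w)
    filter_upwards [ball_mem_nhds (ψ w) hr] with u hu
    refine hb.injOn (hrb hu).2 (hψm hw) ?_
    refine (convex_ball (ψ w) r).is_const_of_fderivWithin_eq_zero (𝕜 := ℂ) (f := φ)
      (hφ.mono fun v hv => (hrb hv).2) ?_ hu (mem_ball_self hr)
    intro v hv
    rw [fderivWithin_of_isOpen isOpen_ball hv]
    ext
    simpa using (hrb hv).1
  · have hev : ∀ᶠ u in nhdsWithin w {w}ᶜ, DifferentiableAt ℂ ψ u := by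
      have hc : Tendsto ψ (nhdsWithin w {w}ᶜ) (nhdsWithin (ψ w) {ψ w}ᶜ) := by
        apply tendsto_nhdsWithin_of_tendsto_nhds_of_eventually_within
        · exact ((hψ.continuousAt (hB.mem_nhds hw)).tendsto).mono_left nhdsWithin_le_nhds
        · filter_upwards [self_mem_nhdsWithin, nhdsWithin_le_nhds (hB.mem_nhds hw)] with u hu huB
          intro h
          exact hu (by rw [mem_singleton_iff, ← hinv.2 huB, ← hinv.2 hw, h])
      filter_upwards [hc.eventually h, nhdsWithin_le_nhds (hB.mem_nhds hw)] with u hu huB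
      exact hgood u huB hu
    exact (Complex.analyticAt_of_differentiable_on_punctured_nhds_of_continuousAt hev
      (hψ.continuousAt (hB.mem_nhds hw))).differentiableAt

theorem ConformalOnto.arc_alt (D : JordanDomain) {φ : ℂ → ℂ} {ζ : ℂ}
    (hφ : ConformalOnto D.G φ ζ) (hφc : ContinuousOn φ (closure D.G)) {a b : ℝ} (hab : a < b)
    (hb : b < a + D.l) (p : ℂ) (hpa : φ (D.γ a) = p) (hpb : φ (D.γ b) = p) {t1 t2 : ℝ}
    (h1 : t1 ∈ Ioo a b) (h2 : t2 ∈ Ioo b (a + D.l)) (hp1 : φ (D.γ t1) ≠ p)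
    (hp2 : φ (D.γ t2) ≠ p) : False := by
  have hK : IsCompact (closure D.G) := D.bounded.isCompact_closure
  have hγc : ∀ t, D.γ t ∈ closure D.G := fun t => frontier_subset_closure (D.γ_mem t)
  have hφγ : Continuous fun t => φ (D.γ t) := hφc.comp_continuous D.γ_cont hγc
  have hE : ∀ u v, IsCompact (D.γ '' {t ∈ Icc u v | φ (D.γ t) = p}) := by
    intro u v
    refine IsCompact.image ?_ D.γ_cont
    exact isCompact_Icc.inter_right (isClosed_singleton.preimage hφγ)
  have hdis : Disjoint (D.γ '' {t ∈ Icc t1 t2 | φ (D.γ t) = p})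
      (D.γ '' {t ∈ Icc t2 (t1 + D.l) | φ (D.γ t) = p}) := by
    rw [Set.disjoint_left]
    rintro z ⟨u, ⟨hu, hup⟩, rfl⟩ ⟨v, ⟨hv, hvp⟩, huv⟩
    rcases eq_or_lt_of_le hv.2 with h | h
    · rw [h, D.γ_periodic] at hvp; exact hp1 hvp
    · have := D.inj_of_lt (by
        rw [abs_lt]; constructor <;> linarith [hu.1, hu.2, hv.1, D.l_pos]) huv
      have h3 : u = t2 := by linarith [hu.2, hv.1]
      rw [h3] at hup; exact hp2 hup
  obtain ⟨U1, U2, hU1, hU2, hE1, hE2, hU⟩ := SeparatedNhds.of_isCompact_isCompact (hE _ _) (hE _ _) hdis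
  have hpn : ‖p‖ = 1 := by rw [← hpa]; exact hφ.norm_eq_one D.isOpen hφc (D.γ_mem a)
  obtain ⟨r, hr, hrZ⟩ : ∃ r > 0, ∀ z ∈ closure D.G, z ∉ U1 ∪ U2 → r ≤ ‖φ z - p‖ := by
    have hZ : IsCompact (closure D.G \ (U1 ∪ U2)) := hK.diff (hU1.union hU2)
    rcases (closure D.G \ (U1 ∪ U2)).eq_empty_or_nonempty with he | hne
    · refine ⟨1, one_pos, fun z hz hz2 => ?_⟩
      have : z ∈ closure D.G \ (U1 ∪ U2) := ⟨hz, hz2⟩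
      rw [he] at this; exact this.elim
    · obtain ⟨z0, hz0, hmin⟩ := hZ.exists_isMinOn hne
        (f := fun z => ‖φ z - p‖) ((hφc.mono sdiff_subset).sub continuousOn_const).norm
      refine ⟨‖φ z0 - p‖, ?_, fun z hz hz2 => hmin ⟨hz, hz2⟩⟩
      rw [gt_iff_lt, norm_pos_iff, sub_ne_zero]
      intro hz0p
      have hfr : z0 ∈ frontier D.G := by
        rw [D.isOpen.frontier_eq]
        refine ⟨hz0.1, fun h => ?_⟩
        have h3 : ‖φ z0‖ < 1 := mem_ball_zero_iff.mp (hφ.bijOn.mapsTo h)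
        rw [hz0p] at h3; linarith
      obtain ⟨t, ht, rfl⟩ : ∃ t ∈ Ico t1 (t1 + D.l), D.γ t = z0 := by
        rw [← D.γ_boundary] at hfr
        obtain ⟨u, hu, rfl⟩ := hfr
        obtain ⟨v, hv, hv2⟩ := D.γ_periodic.exists_mem_Ico D.l_pos u t1
        exact ⟨v, hv, hv2.symm⟩
      apply hz0.2
      rcases le_total t t2 with h | h
      · exact Or.inl (hE1 ⟨t, ⟨⟨ht.1, h⟩, hz0p⟩, rfl⟩)
      · exact Or.inr (hE2 ⟨t, ⟨⟨h, ht.2.le⟩, hz0p⟩, rfl⟩)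
  have hW : IsPreconnected {z ∈ D.G | ‖φ z - p‖ < r} := by
    have hinv := hφ.bijOn.invOn_invFunOn
    have heq : {z ∈ D.G | ‖φ z - p‖ < r} =
        Function.invFunOn φ D.G '' (ball 0 1 ∩ ball p r) := by
      ext z
      constructor
      · rintro ⟨hz, hzr⟩
        exact ⟨φ z, ⟨hφ.bijOn.mapsTo hz, by rwa [mem_ball, dist_eq_norm]⟩, hinv.1 hz⟩
      · rintro ⟨w, ⟨hw1, hw2⟩, rfl⟩
        obtain ⟨z, hz, rfl⟩ := hφ.bijOn.surjOn hw1
        rw [hinv.1 hz]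
        exact ⟨hz, by rwa [mem_ball, dist_eq_norm] at hw2⟩
    rw [heq]
    refine (((convex_ball (0 : ℂ) 1).inter (convex_ball p r)).isPreconnected).image _ ?_
    refine ContinuousOn.mono ?_ inter_subset_left
    exact continuousOn_inv_open D.isOpen
      (fun w hw => (hφ.differentiable w hw).differentiableWithinAt) hφ.bijOn hinv
  have hmeet : ∀ t, φ (D.γ t) = p → ∀ U, IsOpen U → D.γ t ∈ U →
      ({z ∈ D.G | ‖φ z - p‖ < r} ∩ U).Nonempty := by
    intro t htp U hU htU
    have hc : ContinuousWithinAt φ D.G (D.γ t) := (hφc _ (hγc t)).mono subset_closure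
    have hne : (nhdsWithin (D.γ t) D.G).NeBot := mem_closure_iff_nhdsWithin_neBot.mp (hγc t)
    have h3 : ∀ᶠ z in nhdsWithin (D.γ t) D.G, φ z ∈ ball p r := by
      apply hc.tendsto; rw [htp]; exact ball_mem_nhds _ hr
    obtain ⟨z, ⟨hz1, hz2⟩, hz3⟩ :=
      ((h3.and (nhdsWithin_le_nhds (hU.mem_nhds htU))).and self_mem_nhdsWithin).exists
    exact ⟨z, ⟨hz3, by rwa [mem_ball, dist_eq_norm] at hz1⟩, hz2⟩
  obtain ⟨z, hz, hz1, hz2⟩ := hW U1 U2 hU1 hU2 (by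
      rintro z ⟨hz, hzr⟩
      by_contra hcon
      linarith [hrZ z (subset_closure hz) hcon])
    (hmeet b hpb U1 hU1 (hE1 ⟨b, ⟨⟨h1.2.le, h2.1.le⟩, hpb⟩, rfl⟩))
    (hmeet (a + D.l) (by rw [D.γ_periodic]; exact hpa) U2 hU2
      (hE2 ⟨a + D.l, ⟨⟨h2.2.le, by linarith [h1.1]⟩, by rw [D.γ_periodic]; exact hpa⟩, rfl⟩))
  exact hU.le_bot ⟨hz1, hz2⟩

theorem ConformalOnto.injOn_closure (D : JordanDomain) {φ : ℂ → ℂ} {ζ : ℂ}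
    (hφ : ConformalOnto D.G φ ζ) (hφc : ContinuousOn φ (closure D.G)) :
    InjOn φ (closure D.G) := by
  have hfr : ∀ z ∈ closure D.G, z ∉ D.G → z ∈ frontier D.G := fun z hz hz2 => by
    rw [D.isOpen.frontier_eq]; exact ⟨hz, hz2⟩
  have hlt : ∀ z ∈ D.G, ‖φ z‖ < 1 := fun z hz => mem_ball_zero_iff.mp (hφ.bijOn.mapsTo hz)
  have hfin : ∀ a b, a < b → b < a + D.l → φ (D.γ a) = φ (D.γ b) → False := by
    intro a b hab hb he
    by_cases h1 : ∀ t ∈ Ioo a b, φ (D.γ t) = φ (D.γ b)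
    · exact hφ.no_arc D hφc hab hb _ h1
    by_cases h2 : ∀ t ∈ Ioo b (a + D.l), φ (D.γ t) = φ (D.γ b)
    · exact hφ.no_arc D hφc hb (by linarith) _ h2
    push Not at h1 h2
    obtain ⟨t1, ht1, h1⟩ := h1
    obtain ⟨t2, ht2, h2⟩ := h2
    exact hφ.arc_alt D hφc hab hb _ he rfl ht1 ht2 h1 h2
  intro x hx y hy hxy
  by_cases hxG : x ∈ D.G
  · by_cases hyG : y ∈ D.G
    · exact hφ.bijOn.injOn hxG hyG hxy
    · have h1 := hφ.norm_eq_one D.isOpen hφc (hfr y hy hyG)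
      have h2 := hlt x hxG
      rw [hxy] at h2; linarith
  · by_cases hyG : y ∈ D.G
    · have h1 := hφ.norm_eq_one D.isOpen hφc (hfr x hx hxG)
      have h2 := hlt y hyG
      rw [← hxy] at h2; linarith
    · have h1 := hfr x hx hxG
      have h2 := hfr y hy hyG
      rw [← D.γ_boundary] at h1 h2
      obtain ⟨a, ha, rfl⟩ := h1
      obtain ⟨b, hb, rfl⟩ := h2
      rcases lt_trichotomy a b with h | h | h
      · exact (hfin a b h (by linarith [ha.1, hb.2]) hxy).elim
      · rw [h]
      · exact (hfin b a h (by linarith [hb.1, ha.2]) hxy.symm).elim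

theorem ConformalOnto.exists_inverse (D : JordanDomain) {φ : ℂ → ℂ} {ζ : ℂ}
    (hφ : ConformalOnto D.G φ ζ) (hφc : ContinuousOn φ (closure D.G)) :
    ∃ ψ : ℂ → ℂ, ContinuousOn ψ (closedBall 0 1) ∧ DifferentiableOn ℂ ψ (ball 0 1) ∧
      BijOn ψ (ball 0 1) D.G ∧ BijOn ψ (sphere 0 1) (frontier D.G) ∧
      BijOn ψ (closedBall 0 1) (closure D.G) ∧ InvOn ψ φ (closure D.G) (closedBall 0 1) := by
  have hK : IsCompact (closure D.G) := D.bounded.isCompact_closure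
  have hbij : BijOn φ (closure D.G) (closedBall 0 1) := by
    refine ⟨?_, hφ.injOn_closure D hφc, ?_⟩
    · have h1 := hφ.bijOn.mapsTo.closure_of_continuousOn hφc
      exact fun z hz => closure_ball_subset_closedBall (h1 hz)
    · have h2 : closure (ball (0:ℂ) 1) ⊆ φ '' closure D.G :=
        closure_minimal (hφ.bijOn.image_eq ▸ image_mono subset_closure)
          (hK.image_of_continuousOn hφc).isClosed
      rwa [closure_ball _ one_ne_zero] at h2
  have hinv := hbij.invOn_invFunOn
  set ψ := Function.invFunOn φ (closure D.G) with hψ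
  have hcont := inv_continuousOn_of_compact hK hφc hbij hinv
  have hinv' : InvOn ψ φ D.G (ball 0 1) :=
    ⟨fun z hz => hinv.1 (subset_closure hz), fun w hw => hinv.2 (ball_subset_closedBall hw)⟩
  have hd : DifferentiableOn ℂ φ D.G := fun w hw => (hφ.differentiable w hw).differentiableWithinAt
  have hb1 : BijOn ψ (closedBall 0 1) (closure D.G) := hbij.symm hinv.symm
  have hb2 : BijOn ψ (ball 0 1) D.G := hφ.bijOn.symm hinv'.symm
  refine ⟨ψ, hcont, deriv_ne_zero_of_inverse D.isOpen isOpen_ball hd hφ.bijOn hinv'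
    (hcont.mono ball_subset_closedBall), hb2, ?_, hb1, hinv⟩
  refine ⟨?_, hb1.injOn.mono sphere_subset_closedBall, ?_⟩
  · intro w hw
    rw [D.isOpen.frontier_eq]
    refine ⟨hb1.mapsTo (sphere_subset_closedBall hw), fun h => ?_⟩
    have := hφ.bijOn.mapsTo h
    rw [hinv.2 (sphere_subset_closedBall hw)] at this
    rw [mem_sphere] at hw; rw [mem_ball] at this; linarith
  · intro x hx
    refine ⟨φ x, ?_, hinv.1 (frontier_subset_closure hx)⟩
    rw [mem_sphere_zero_iff_norm]; exact hφ.norm_eq_one D.isOpen hφc hx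

theorem isPreconnected_norm_gt (R : ℝ) (hR : 0 < R) : IsPreconnected {z : ℂ | R < ‖z‖} := by
  have h : {z : ℂ | R < ‖z‖} = Complex.exp '' {z | Real.log R < z.re} := by
    ext z
    constructor
    · intro hz
      have hz' : R < ‖z‖ := hz
      have hz0 : z ≠ 0 := by rintro rfl; simp at hz'; linarith
      refine ⟨Complex.log z, ?_, Complex.exp_log hz0⟩
      rw [mem_setOf_eq, Complex.log_re]
      exact Real.log_lt_log hR hz'
    · rintro ⟨w, hw, rfl⟩
      rw [mem_setOf_eq, Complex.norm_exp]
      exact (Real.log_lt_iff_lt_exp hR).mp hw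
  rw [h]
  exact ((convex_halfSpace_re_gt _).isPreconnected).image _ Complex.continuous_exp.continuousOn

theorem JordanDomain.ext_preconnected (D : JordanDomain) {ψ : ℂ → ℂ}
    (hψ : ContinuousOn ψ (closedBall 0 1)) (hb : BijOn ψ (closedBall 0 1) (closure D.G)) :
    IsPreconnected (closure D.G)ᶜ := by
  classical
  set Ω := (closure D.G)ᶜ with hΩ
  have hΩo : IsOpen Ω := isClosed_closure.isOpen_compl
  obtain ⟨R0, hR0⟩ := D.bounded.subset_closedBall 0
  set R := max R0 1 with hR
  have hRpos : 0 < R := lt_of_lt_of_le one_pos (le_max_right _ _)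
  have hfar : {z : ℂ | R < ‖z‖} ⊆ Ω := by
    intro z hz hz2
    have := closure_minimal hR0 isClosed_closedBall hz2
    rw [mem_closedBall_zero_iff] at this
    have h1 : R < ‖z‖ := hz
    linarith [le_max_left R0 1]
  have key : ∀ v ∈ Ω, ∃ z ∈ connectedComponentIn Ω v, R < ‖z‖ := by
    intro v hv
    by_contra hcon
    push Not at hcon
    set V := connectedComponentIn Ω v with hV
    have hVo : IsOpen V := hΩo.connectedComponentIn
    have hfr : frontier V ⊆ closure D.G := by
      intro z hz
      by_contra hzΩ
      have hzΩ' : z ∈ Ω := hzΩ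
      have ho : IsOpen (connectedComponentIn Ω z) := hΩo.connectedComponentIn
      obtain ⟨y, hy1, hy2⟩ := (_root_.mem_closure_iff.mp hz.1) _ ho (mem_connectedComponentIn hzΩ')
      have h1 := connectedComponentIn_eq hy1
      have h2 := connectedComponentIn_eq hy2
      have hzV : z ∈ V := by rw [hV, h2, ← h1]; exact mem_connectedComponentIn hzΩ'
      apply hz.2; rwa [hVo.interior_eq]
    -- log of z - v on closure G
    have hret : Continuous (fun w : ℂ => ((max 1 ‖w‖ : ℝ) : ℂ)⁻¹ * w) := by
      refine Continuous.mul (Continuous.inv₀ (by fun_prop) ?_) continuous_id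
      intro w
      have : 0 < max 1 ‖w‖ := lt_of_lt_of_le one_pos (le_max_left _ _)
      exact_mod_cast this.ne'
    have hretm : ∀ w : ℂ, ((max 1 ‖w‖ : ℝ) : ℂ)⁻¹ * w ∈ closedBall (0:ℂ) 1 := by
      intro w
      have : 0 < max 1 ‖w‖ := lt_of_lt_of_le one_pos (le_max_left _ _)
      rw [mem_closedBall_zero_iff, norm_mul, norm_inv, Complex.norm_real, Real.norm_eq_abs,
        abs_of_pos this, inv_mul_le_iff₀ this, mul_one]
      exact le_max_right _ _
    have hvn : ∀ z ∈ closure D.G, z - v ≠ 0 := fun z hz h => hv (by rwa [← sub_eq_zero.mp h])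
    obtain ⟨u, hu, hue⟩ := exists_log_univ (fun w : ℂ => ψ (((max 1 ‖w‖ : ℝ) : ℂ)⁻¹ * w) - v)
      ((hψ.comp_continuous hret hretm).sub continuous_const)
      (fun w => hvn _ (hb.mapsTo (hretm w)))
    have hce : Topology.IsClosedEmbedding (fun w : closedBall (0:ℂ) 1 => ψ w) := by
      have : CompactSpace (closedBall (0:ℂ) 1) := isCompact_iff_compactSpace.mp (isCompact_closedBall _ _)
      refine Continuous.isClosedEmbedding (hψ.comp_continuous continuous_subtype_val fun w => w.2) ?_
      intro w w' h
      exact Subtype.ext (hb.injOn w.2 w'.2 h)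
    obtain ⟨g, hg⟩ := ContinuousMap.exists_extension hce
      ⟨fun w : closedBall (0:ℂ) 1 => u w, hu.comp continuous_subtype_val⟩
    have hg' : ∀ z ∈ closure D.G, Complex.exp (g z) = z - v := by
      intro z hz
      obtain ⟨w, hw, rfl⟩ := hb.surjOn hz
      have := congrArg (fun f : C(closedBall (0:ℂ) 1, ℂ) => f ⟨w, hw⟩) hg
      simp only [ContinuousMap.comp_apply, ContinuousMap.coe_mk] at this
      rw [this, hue]
      rw [max_eq_left (mem_closedBall_zero_iff.mp hw)]; simp
    refine no_log_ext v (V.piecewise (fun z => Complex.exp (g z)) (fun z => z - v))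
      (Continuous.piecewise (fun z hz => hg' z (hfr hz)) (by fun_prop) (by fun_prop)) ?_
      (R + ‖v‖ + 1) ?_
    · intro z
      by_cases hz : z ∈ V
      · rw [piecewise_eq_of_mem _ _ _ hz]; exact Complex.exp_ne_zero _
      · rw [piecewise_eq_of_notMem _ _ _ hz]
        rw [sub_ne_zero]; rintro rfl; exact hz (mem_connectedComponentIn hv)
    · intro z hz
      refine piecewise_eq_of_notMem _ _ _ ?_
      intro hzV
      linarith [hcon z hzV, norm_sub_le z v]
  obtain ⟨z0, hz0⟩ : ∃ z0 : ℂ, R < ‖z0‖ := ⟨((R + 1 : ℝ) : ℂ), by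
    rw [Complex.norm_real, Real.norm_eq_abs, abs_of_pos (by linarith)]; linarith⟩
  have hall : ∀ v ∈ Ω, v ∈ connectedComponentIn Ω z0 := by
    intro v hv
    obtain ⟨z, hz, hzR⟩ := key v hv
    have h1 : z ∈ connectedComponentIn Ω z0 :=
      (isPreconnected_norm_gt R hRpos).subset_connectedComponentIn hz0 hfar hzR
    rw [connectedComponentIn_eq h1, ← connectedComponentIn_eq hz]
    exact mem_connectedComponentIn hv
  have : Ω = connectedComponentIn Ω z0 :=
    Subset.antisymm hall (connectedComponentIn_subset _ _)
  rw [this]; exact isPreconnected_connectedComponentIn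

/-- uniform approximability by polynomials -/
def CApprox (K : Set ℂ) (f : ℂ → ℂ) : Prop :=
  ∀ ε > 0, ∃ q : Polynomial ℂ, ∀ z ∈ K, ‖f z - q.eval z‖ ≤ ε

/-- uniform approximability by real parts of polynomials -/
def ReApprox (K : Set ℂ) (f : ℂ → ℝ) : Prop :=
  ∀ ε > 0, ∃ q : Polynomial ℂ, ∀ z ∈ K, |f z - (q.eval z).re| ≤ ε

theorem CApprox.of_limit {K : Set ℂ} {f : ℂ → ℂ}
    (h : ∀ ε > 0, ∃ g, CApprox K g ∧ ∀ z ∈ K, ‖f z - g z‖ ≤ ε) : CApprox K f := by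
  intro ε hε
  obtain ⟨g, hg, hfg⟩ := h (ε/2) (by linarith)
  obtain ⟨q, hq⟩ := hg (ε/2) (by linarith)
  refine ⟨q, fun z hz => ?_⟩
  have := norm_sub_le_norm_sub_add_norm_sub (f z) (g z) (q.eval z)
  linarith [hfg z hz, hq z hz]

theorem ReApprox.of_limit {K : Set ℂ} {f : ℂ → ℝ}
    (h : ∀ ε > 0, ∃ g, ReApprox K g ∧ ∀ z ∈ K, |f z - g z| ≤ ε) : ReApprox K f := by
  intro ε hε
  obtain ⟨g, hg, hfg⟩ := h (ε/2) (by linarith)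
  obtain ⟨q, hq⟩ := hg (ε/2) (by linarith)
  refine ⟨q, fun z hz => ?_⟩
  have := abs_sub_le (f z) (g z) (q.eval z).re
  linarith [hfg z hz, hq z hz]

theorem CApprox.congr {K : Set ℂ} {f g : ℂ → ℂ} (h : CApprox K f) (he : ∀ z ∈ K, g z = f z) :
    CApprox K g := by
  intro ε hε
  obtain ⟨q, hq⟩ := h ε hε
  exact ⟨q, fun z hz => by rw [he z hz]; exact hq z hz⟩

theorem ReApprox.congr {K : Set ℂ} {f g : ℂ → ℝ} (h : ReApprox K f) (he : ∀ z ∈ K, g z = f z) :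
    ReApprox K g := by
  intro ε hε
  obtain ⟨q, hq⟩ := h ε hε
  exact ⟨q, fun z hz => by rw [he z hz]; exact hq z hz⟩

theorem ReApprox.mono {K K' : Set ℂ} {f : ℂ → ℝ} (h : ReApprox K f) (hk : K' ⊆ K) :
    ReApprox K' f := fun ε hε => by
  obtain ⟨q, hq⟩ := h ε hε
  exact ⟨q, fun z hz => hq z (hk hz)⟩

theorem CApprox.re {K : Set ℂ} {f : ℂ → ℂ} (h : CApprox K f) : ReApprox K (fun z => (f z).re) := by
  intro ε hε
  obtain ⟨q, hq⟩ := h ε hε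
  refine ⟨q, fun z hz => ?_⟩
  rw [← Complex.sub_re]
  exact (Complex.abs_re_le_norm _).trans (hq z hz)

theorem CApprox.poly (K : Set ℂ) (q : Polynomial ℂ) : CApprox K (fun z => q.eval z) :=
  fun ε hε => ⟨q, fun z _ => by simp [hε.le]⟩

theorem CApprox.const (K : Set ℂ) (c : ℂ) : CApprox K (fun _ => c) :=
  (CApprox.poly K (Polynomial.C c)).congr (by simp)

theorem CApprox.id (K : Set ℂ) : CApprox K (fun z => z) :=
  (CApprox.poly K Polynomial.X).congr (by simp)

theorem ReApprox.const (K : Set ℂ) (c : ℝ) : ReApprox K (fun _ => c) :=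
  (CApprox.const K c).re.congr (by simp)

theorem CApprox.add {K : Set ℂ} {f g : ℂ → ℂ} (hf : CApprox K f) (hg : CApprox K g) :
    CApprox K (fun z => f z + g z) := by
  intro ε hε
  obtain ⟨q, hq⟩ := hf (ε/2) (by linarith)
  obtain ⟨r, hr⟩ := hg (ε/2) (by linarith)
  refine ⟨q + r, fun z hz => ?_⟩
  rw [Polynomial.eval_add, add_sub_add_comm]
  linarith [norm_add_le (f z - q.eval z) (g z - r.eval z), hq z hz, hr z hz]

theorem ReApprox.add {K : Set ℂ} {f g : ℂ → ℝ} (hf : ReApprox K f) (hg : ReApprox K g) :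
    ReApprox K (fun z => f z + g z) := by
  intro ε hε
  obtain ⟨q, hq⟩ := hf (ε/2) (by linarith)
  obtain ⟨r, hr⟩ := hg (ε/2) (by linarith)
  refine ⟨q + r, fun z hz => ?_⟩
  rw [Polynomial.eval_add, Complex.add_re, add_sub_add_comm]
  linarith [abs_add_le (f z - (q.eval z).re) (g z - (r.eval z).re), hq z hz, hr z hz]

theorem ReApprox.smul {K : Set ℂ} {f : ℂ → ℝ} (hf : ReApprox K f) (c : ℝ) :
    ReApprox K (fun z => c * f z) := by
  intro ε hε
  obtain ⟨q, hq⟩ := hf (ε/(|c|+1)) (by positivity)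
  refine ⟨Polynomial.C (c : ℂ) * q, fun z hz => ?_⟩
  simp only [Polynomial.eval_mul, Polynomial.eval_C, Complex.re_ofReal_mul]
  rw [← mul_sub, abs_mul]
  calc |c| * |f z - (q.eval z).re| ≤ (|c| + 1) * (ε/(|c|+1)) := by
        gcongr
        · linarith
        · exact hq z hz
    _ = ε := by field_simp

theorem ReApprox.sum {K : Set ℂ} {ι : Type*} (s : Finset ι) {f : ι → ℂ → ℝ}
    (hf : ∀ i ∈ s, ReApprox K (f i)) : ReApprox K (fun z => ∑ i ∈ s, f i z) := by
  classical
  induction s using Finset.induction_on with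
  | empty => simpa using ReApprox.const K 0
  | insert a s ha ih =>
    simp only [Finset.sum_insert ha]
    exact (hf a (by simp)).add (ih fun i hi => hf i (by simp [hi]))

theorem CApprox.mul {K : Set ℂ} {f g : ℂ → ℂ} (hf : CApprox K f) (hg : CApprox K g) {B : ℝ}
    (hfB : ∀ z ∈ K, ‖f z‖ ≤ B) (hgB : ∀ z ∈ K, ‖g z‖ ≤ B) :
    CApprox K (fun z => f z * g z) := by
  intro ε hε
  have hB : 0 < |B| + 1 := by positivity
  obtain ⟨q, hq⟩ := hf (ε/(2 * (|B|+1))) (by positivity)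
  obtain ⟨r, hr⟩ := hg (min 1 (ε/(2 * (|B|+2)))) (by positivity)
  obtain ⟨q, hq⟩ := hf (ε/(2 * (|B|+2))) (by positivity)
  refine ⟨q * r, fun z hz => ?_⟩
  have h1 : f z * g z - (q * r).eval z = f z * (g z - r.eval z) + (f z - q.eval z) * r.eval z := by
    rw [Polynomial.eval_mul]; ring
  have hrz := hr z hz
  have h2 : ‖r.eval z‖ ≤ |B| + 2 := by
    have := norm_sub_norm_le (r.eval z) (g z)
    rw [norm_sub_rev] at this
    linarith [hgB z hz, le_abs_self B, min_le_left (1:ℝ) (ε/(2 * (|B|+2)))]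
  have h3 : ‖f z‖ ≤ |B| + 2 := by linarith [hfB z hz, le_abs_self B]
  rw [h1]
  calc _ ≤ ‖f z‖ * ‖g z - r.eval z‖ + ‖f z - q.eval z‖ * ‖r.eval z‖ := by
        refine (norm_add_le _ _).trans ?_
        rw [norm_mul, norm_mul]
    _ ≤ (|B| + 2) * (ε/(2 * (|B|+2))) + (ε/(2 * (|B|+2))) * (|B|+2) := by
        gcongr
        · exact hrz.trans (min_le_right _ _)
        · exact hq z hz
    _ = ε := by field_simp; norm_num

theorem CApprox.pow {K : Set ℂ} {f : ℂ → ℂ} (hf : CApprox K f) {B : ℝ}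
    (hfB : ∀ z ∈ K, ‖f z‖ ≤ B) (n : ℕ) : CApprox K (fun z => f z ^ n) := by
  induction n with
  | zero => simpa using CApprox.const K 1
  | succ n ih =>
    refine (ih.mul hf (B := max (|B|^n) |B|) ?_ ?_).congr fun z _ => pow_succ _ _
    · intro z hz
      rw [norm_pow]
      refine le_trans ?_ (le_max_left _ _)
      gcongr
      exact (hfB z hz).trans (le_abs_self _)
    · intro z hz
      exact ((hfB z hz).trans (le_abs_self _)).trans (le_max_right _ _)

theorem CApprox.smul {K : Set ℂ} {f : ℂ → ℂ} (hf : CApprox K f) (c : ℂ) :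
    CApprox K (fun z => c * f z) := by
  intro ε hε
  obtain ⟨q, hq⟩ := hf (ε/(‖c‖+1)) (by positivity)
  refine ⟨Polynomial.C (c : ℂ) * q, fun z hz => ?_⟩
  simp only [Polynomial.eval_mul, Polynomial.eval_C]
  rw [← mul_sub, norm_mul]
  calc ‖c‖ * ‖f z - (q.eval z)‖ ≤ (‖c‖ + 1) * (ε/(‖c‖+1)) := by
        gcongr
        · linarith
        · exact hq z hz
    _ = ε := by field_simp

theorem CApprox.sum {K : Set ℂ} {ι : Type*} (s : Finset ι) {f : ι → ℂ → ℂ}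
    (hf : ∀ i ∈ s, CApprox K (f i)) : CApprox K (fun z => ∑ i ∈ s, f i z) := by
  classical
  induction s using Finset.induction_on with
  | empty => simpa using CApprox.const K 0
  | insert a s ha ih =>
    simp only [Finset.sum_insert ha]
    exact (hf a (by simp)).add (ih fun i hi => hf i (by simp [hi]))

theorem CApprox.inv_one_sub {K : Set ℂ} {x : ℂ → ℂ} (hx : CApprox K x)
    (hb : ∀ z ∈ K, ‖x z‖ ≤ 1/2) : CApprox K (fun z => (1 - x z)⁻¹) := by
  apply CApprox.of_limit
  intro ε hε
  obtain ⟨N, hN⟩ := exists_pow_lt_of_lt_one (show 0 < ε/2 by linarith) (show (1/2:ℝ) < 1 by norm_num)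
  refine ⟨fun z => ∑ n ∈ Finset.range N, x z ^ n, CApprox.sum _ fun n _ => hx.pow hb n, ?_⟩
  intro z hz
  have h1 := hb z hz
  have hne : 1 - x z ≠ 0 := by
    intro h
    have : x z = 1 := (sub_eq_zero.mp h).symm
    rw [this] at h1; norm_num at h1
  have h2 : (1 - x z)⁻¹ - ∑ n ∈ Finset.range N, x z ^ n = x z ^ N / (1 - x z) := by
    have := geom_sum_mul_neg (x z) N
    field_simp
    rw [mul_comm, this]; ring
  rw [h2, norm_div, norm_pow]
  have h3 : 1/2 ≤ ‖1 - x z‖ := by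
    have := norm_sub_norm_le (1:ℂ) (x z)
    rw [norm_one] at this; linarith
  rw [div_le_iff₀ (by linarith)]
  have : ‖x z‖ ^ N ≤ (1/2)^N := by gcongr
  nlinarith

theorem CApprox.log_one_sub {K : Set ℂ} {x : ℂ → ℂ} (hx : CApprox K x)
    (hb : ∀ z ∈ K, ‖x z‖ ≤ 1/2) : CApprox K (fun z => Complex.log (1 - x z)) := by
  apply CApprox.of_limit
  intro ε hε
  obtain ⟨N, hN⟩ := exists_pow_lt_of_lt_one (show 0 < ε/2 by linarith) (show (1/2:ℝ) < 1 by norm_num)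
  refine ⟨fun z => Complex.logTaylor (N+1) (-x z), ?_, ?_⟩
  · unfold Complex.logTaylor
    refine CApprox.sum _ fun n _ => ?_
    refine (((hx.pow hb n)).smul ((-1) ^ (n + 1) * (-1)^n / n)).congr fun z _ => ?_
    rw [neg_pow]; ring
  intro z hz
  have h1 := hb z hz
  have h2 := Complex.norm_log_sub_logTaylor_le N (z := -x z) (by rw [norm_neg]; linarith)
  rw [norm_neg, ← sub_eq_add_neg] at h2
  refine h2.trans ?_
  have h3 : (1 - ‖x z‖)⁻¹ ≤ 2 := by
    rw [inv_le_comm₀ (by linarith) (by norm_num)]; linarith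
  have h4 : ‖x z‖ ^ (N+1) ≤ (1/2)^N := by
    calc ‖x z‖ ^ (N+1) ≤ (1/2)^(N+1) := by gcongr
      _ ≤ _ := by apply pow_le_pow_of_le_one <;> norm_num
  have h5 : 0 ≤ (1 - ‖x z‖)⁻¹ := inv_nonneg.mpr (by linarith)
  calc _ ≤ ‖x z‖ ^ (N + 1) * (1 - ‖x z‖)⁻¹ := by
        apply div_le_self (by positivity)
        have : (0:ℝ) ≤ N := by positivity
        linarith
    _ ≤ (1/2)^N * 2 := by gcongr
    _ ≤ ε := by linarith

theorem log_norm_mul_one_sub (u x : ℂ) (hu : u ≠ 0) (hx : ‖x‖ ≤ 1/2) :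
    Real.log ‖u * (1 - x)‖ = Real.log ‖u‖ + (Complex.log (1 - x)).re := by
  have h3 : 1/2 ≤ ‖1 - x‖ := by
    have := norm_sub_norm_le (1:ℂ) x
    rw [norm_one] at this; linarith
  rw [norm_mul, Real.log_mul (by simpa using hu) (by linarith), Complex.log_re]

/-- the pole-pushing set -/
def PoleSet (K : Set ℂ) : Set ℂ :=
  {a | a ∉ K ∧ CApprox K (fun t => (t - a)⁻¹) ∧ ReApprox K (fun t => Real.log ‖t - a‖)}

theorem PoleSet.step {K : Set ℂ} {a b : ℂ} (ha : a ∈ PoleSet K) {d : ℝ} (hd : 0 < d)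
    (hK : ∀ t ∈ K, d ≤ ‖t - a‖) (hab : ‖b - a‖ ≤ d / 2) : b ∈ PoleSet K := by
  obtain ⟨haK, h1, h2⟩ := ha
  have hne : ∀ t ∈ K, t - a ≠ 0 := fun t ht => norm_pos_iff.mp (hd.trans_le (hK t ht))
  have hx : CApprox K (fun t => (b - a) * (t - a)⁻¹) := h1.smul _
  have hxb : ∀ t ∈ K, ‖(b - a) * (t - a)⁻¹‖ ≤ 1/2 := by
    intro t ht
    rw [norm_mul, norm_inv, ← div_eq_mul_inv, div_le_iff₀ (norm_pos_iff.mpr (hne t ht))]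
    linarith [hK t ht]
  have hfac : ∀ t ∈ K, t - b = (t - a) * (1 - (b - a) * (t - a)⁻¹) := by
    intro t ht
    have := hne t ht
    field_simp; ring
  have hB : ∀ t ∈ K, ‖(t - a)⁻¹‖ ≤ max (1/d) 2 := by
    intro t ht
    refine le_trans ?_ (le_max_left _ _)
    rw [norm_inv, one_div]
    exact inv_anti₀ hd (hK t ht)
  refine ⟨?_, ?_, ?_⟩
  · intro hb
    have := hK b hb
    linarith
  · refine (h1.mul (hx.inv_one_sub hxb) hB ?_).congr ?_
    · intro t ht
      refine le_trans ?_ (le_max_right _ _)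
      have h3 : 1/2 ≤ ‖1 - (b - a) * (t - a)⁻¹‖ := by
        have := norm_sub_norm_le (1:ℂ) ((b - a) * (t - a)⁻¹)
        rw [norm_one] at this; linarith [hxb t ht]
      rw [norm_inv, inv_le_comm₀ (by linarith) (by norm_num)]; linarith
    · intro t ht
      rw [hfac t ht, mul_inv]
  · refine (h2.add (hx.log_one_sub hxb).re).congr ?_
    intro t ht
    rw [hfac t ht, log_norm_mul_one_sub _ _ (hne t ht) (hxb t ht)]

theorem PoleSet.far {K : Set ℂ} {R : ℝ} (hR : 0 < R) (hK : K ⊆ closedBall 0 R) {a : ℂ}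
    (ha : 2 * R ≤ ‖a‖) : a ∈ PoleSet K := by
  have ha0 : a ≠ 0 := by rw [← norm_pos_iff]; linarith
  have hx : CApprox K (fun t => a⁻¹ * t) := (CApprox.id K).smul _
  have hxb : ∀ t ∈ K, ‖a⁻¹ * t‖ ≤ 1/2 := by
    intro t ht
    have := mem_closedBall_zero_iff.mp (hK ht)
    rw [norm_mul, norm_inv, inv_mul_le_iff₀ (by linarith)]; linarith
  have hfac : ∀ t, t - a = (-a) * (1 - a⁻¹ * t) := by
    intro t; field_simp; ring
  refine ⟨?_, ?_, ?_⟩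
  · intro h
    have := mem_closedBall_zero_iff.mp (hK h); linarith
  · refine ((hx.inv_one_sub hxb).smul (-a)⁻¹).congr fun t _ => ?_
    rw [hfac t, mul_inv]
  · refine ((ReApprox.const K (Real.log ‖-a‖)).add (hx.log_one_sub hxb).re).congr fun t ht => ?_
    rw [hfac t, log_norm_mul_one_sub _ _ (neg_ne_zero.mpr ha0) (hxb t ht)]

theorem PoleSet.eq_compl {K : Set ℂ} (hK : IsCompact K) (hne : K.Nonempty)
    (hc : IsPreconnected Kᶜ) : Kᶜ ⊆ PoleSet K := by
  have hdist : ∀ a ∉ K, 0 < infDist a K := fun a ha =>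
    (hK.isClosed.notMem_iff_infDist_pos hne).mp ha
  have hdle : ∀ a, ∀ t ∈ K, infDist a K ≤ ‖t - a‖ := fun a t ht => by
    rw [← dist_eq_norm, dist_comm]; exact infDist_le_dist_of_mem ht
  refine hc.subset_of_closure_inter_subset ?_ ?_ ?_
  · rw [Metric.isOpen_iff]
    intro a ha
    refine ⟨infDist a K / 2, half_pos (hdist a ha.1), fun b hb => ?_⟩
    refine PoleSet.step ha (hdist a ha.1) (hdle a) ?_
    rw [mem_ball, dist_eq_norm] at hb; exact hb.le
  · obtain ⟨R, hR⟩ := hK.isBounded.subset_closedBall 0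
    have hR1 : 0 < max R 1 := lt_of_lt_of_le one_pos (le_max_right _ _)
    have hm : ((2 * max R 1 : ℝ) : ℂ) ∈ PoleSet K :=
      PoleSet.far hR1 (hR.trans (closedBall_subset_closedBall (le_max_left _ _))) (by
        rw [Complex.norm_real, Real.norm_eq_abs, abs_of_pos (by linarith)])
    exact ⟨_, hm.1, hm⟩
  · rintro b ⟨hb1, hb2⟩
    have hd := hdist b hb2
    obtain ⟨a, ha, hab⟩ := Metric.mem_closure_iff.mp hb1 (infDist b K / 4) (by linarith)
    refine PoleSet.step ha (d := infDist b K / 2) (by linarith) ?_ ?_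
    · intro t ht
      have h1 := hdle b t ht
      have h2 := dist_triangle t a b
      rw [dist_comm] at hab
      rw [← dist_eq_norm] at h1 ⊢
      linarith
    · rw [← dist_eq_norm]; linarith

theorem JordanDomain.log_ext_approx (D : JordanDomain) {ψ : ℂ → ℂ}
    (hψ : ContinuousOn ψ (closedBall 0 1)) (hb : BijOn ψ (closedBall 0 1) (closure D.G))
    {a : ℂ} (ha : a ∉ closure D.G) : ReApprox (closure D.G) (fun t => Real.log ‖t - a‖) :=
  (PoleSet.eq_compl D.bounded.isCompact_closure (D.nonempty.mono subset_closure)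
    (D.ext_preconnected hψ hb) ha).2.2

theorem sqrt_near_one {u w : ℂ} (h : u ^ 2 = 1 - w) (hu : 0 ≤ u.re) : ‖u - 1‖ ≤ ‖w‖ := by
  have h1 : (1:ℝ) ≤ ‖u + 1‖ := by
    calc (1:ℝ) ≤ (u + 1).re := by simp [hu]
    _ ≤ ‖u + 1‖ := Complex.re_le_norm _
  have h2 : (u - 1) * (u + 1) = - w := by linear_combination h
  have h3 : ‖u - 1‖ * ‖u + 1‖ = ‖w‖ := by rw [← norm_mul, h2, norm_neg]
  nlinarith [norm_nonneg (u - 1)]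

theorem re_pos_of_near_one {u : ℂ} (h : ‖u - 1‖ < 1) : 0 < u.re := by
  have := Complex.abs_re_le_norm (u - 1)
  rw [Complex.sub_re, Complex.one_re] at this
  have := abs_lt.mp (this.trans_lt h)
  linarith [this.1]

theorem CApprox.sqrt {K : Set ℂ} {x : ℂ → ℂ} (hx : CApprox K x)
    (hb : ∀ z ∈ K, ‖x z‖ ≤ 1/2) :
    ∃ v, CApprox K v ∧ ∀ z ∈ K, v z ^ 2 = 1 - x z ∧ ‖v z - 1‖ ≤ ‖x z‖ := by
  have hl := hx.log_one_sub hb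
  have hy : CApprox K (fun z => (1/2) * Complex.log (1 - x z)) := hl.smul _
  have hyb : ∀ z ∈ K, ‖(1/2) * Complex.log (1 - x z)‖ ≤ 3/8 := by
    intro z hz
    have := Complex.norm_log_one_add_half_le_self (z := - x z) (by rw [norm_neg]; exact hb z hz)
    rw [← sub_eq_add_neg, norm_neg] at this
    rw [norm_mul]
    have h2 := hb z hz
    norm_num
    linarith
  refine ⟨fun z => Complex.exp ((1/2) * Complex.log (1 - x z)), ?_, ?_⟩
  · apply CApprox.of_limit
    intro ε hε
    obtain ⟨N, hN⟩ := exists_pow_lt_of_lt_one (show 0 < ε/2 by linarith)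
      (show (1/2:ℝ) < 1 by norm_num)
    refine ⟨fun z => ∑ m ∈ Finset.range (N+1),
      (1 / (m.factorial : ℂ)) * ((1/2) * Complex.log (1 - x z)) ^ m,
      CApprox.sum _ (fun m _ => (hy.pow hyb m).smul _), ?_⟩
    intro z hz
    have h1 := Complex.exp_bound (x := (1/2) * Complex.log (1 - x z))
      ((hyb z hz).trans (by norm_num)) (Nat.succ_pos N)
    have h2 : ∑ m ∈ Finset.range (N+1),
      (1 / (m.factorial : ℂ)) * ((1/2) * Complex.log (1 - x z)) ^ m =
      ∑ m ∈ Finset.range N.succ, ((1/2) * Complex.log (1 - x z)) ^ m / (m.factorial : ℂ) := by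
      apply Finset.sum_congr rfl; intro m _; ring
    beta_reduce
    rw [h2]
    refine h1.trans ?_
    have h3 : ‖(1/2) * Complex.log (1 - x z)‖ ^ N.succ ≤ (1/2)^(N+1) := by
      apply pow_le_pow_left₀ (norm_nonneg _) ((hyb z hz).trans (by norm_num))
    have h4 : (N.succ.succ : ℝ) * ((N.succ.factorial : ℝ) * (N.succ:ℝ))⁻¹ ≤ 2 := by
      rw [← div_eq_mul_inv, div_le_iff₀ (by positivity)]
      have : (1:ℝ) ≤ N.succ.factorial := by exact_mod_cast Nat.succ_le_of_lt (Nat.factorial_pos _)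
      push_cast
      have h5 : (0:ℝ) ≤ N := Nat.cast_nonneg _
      nlinarith
    calc _ ≤ (1/2)^(N+1) * 2 := by
          apply mul_le_mul h3 h4 (by positivity) (by positivity)
    _ ≤ ε := by rw [pow_succ]; linarith
  · intro z hz
    have hx1 : 1 - x z ≠ 0 := by
      intro h
      have h1 : x z = 1 := by linear_combination -h
      have := hb z hz
      rw [h1] at this; norm_num at this
    have hsq : Complex.exp ((1/2) * Complex.log (1 - x z)) ^ 2 = 1 - x z := by
      rw [← Complex.exp_nat_mul]
      rw [show ((2:ℕ):ℂ) * (1 / 2 * Complex.log (1 - x z)) = Complex.log (1 - x z) by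
        push_cast; ring, Complex.exp_log hx1]
    refine ⟨hsq, sqrt_near_one hsq ?_⟩
    refine (re_pos_of_near_one ?_).le
    have h1 := Complex.norm_exp_sub_one_le (x := (1/2) * Complex.log (1 - x z))
      ((hyb z hz).trans (by norm_num))
    have := hyb z hz
    linarith

/-- set of `e` for which there is a good branch of `√((z-a)(z-e))` -/
def BranchSet (K : Set ℂ) (a : ℂ) (δ : ℝ) : Set ℂ :=
  {e | e ∉ K ∧ ‖e - a‖ < δ ∧ ∃ F : ℂ → ℂ, CApprox K F ∧
    (∀ z ∈ K, F z ^ 2 = (z - a) * (z - e)) ∧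
    ∀ z ∈ K, 4 * δ ≤ ‖z - a‖ → 0 < (F z / (z - a)).re}

theorem BranchSet.near {K : Set ℂ} {a : ℂ} {δ : ℝ} (hδ : 0 < δ) {e : ℂ} (he : ‖e - a‖ < δ)
    {F : ℂ → ℂ} (hF : ∀ z ∈ K, F z ^ 2 = (z - a) * (z - e))
    (hF2 : ∀ z ∈ K, 4 * δ ≤ ‖z - a‖ → 0 < (F z / (z - a)).re) {z : ℂ} (hz : z ∈ K)
    (hza : 4 * δ ≤ ‖z - a‖) : ‖F z / (z - a) - 1‖ ≤ 1/4 := by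
  have h0 : 0 < ‖z - a‖ := by linarith
  have hne : z - a ≠ 0 := norm_pos_iff.mp h0
  have h1 : (F z / (z - a)) ^ 2 = 1 - (e - a) / (z - a) := by
    rw [div_pow, hF z hz]; field_simp; ring
  refine (sqrt_near_one h1 (hF2 z hz hza).le).trans ?_
  rw [norm_div, div_le_iff₀ h0]; linarith

theorem BranchSet.step {K : Set ℂ} (hKb : ∃ B, ∀ z ∈ K, ‖z‖ ≤ B) (hP : Kᶜ ⊆ PoleSet K) {a : ℂ} {δ : ℝ}
    (hδ : 0 < δ) {e e' : ℂ}
    (he : e ∈ BranchSet K a δ) {d : ℝ} (hd : 0 < d)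
    (hK : ∀ t ∈ K, d ≤ ‖t - e‖) (hab : ‖e' - e‖ ≤ d / 2) (he' : ‖e' - a‖ < δ) :
    e' ∈ BranchSet K a δ := by
  obtain ⟨heK, hea, F, hF, hF1, hF2⟩ := he
  have hne : ∀ t ∈ K, t - e ≠ 0 := fun t ht => norm_pos_iff.mp (hd.trans_le (hK t ht))
  have hx : CApprox K (fun t => (e' - e) * (t - e)⁻¹) := (hP heK).2.1.smul _
  have hxb : ∀ t ∈ K, ‖(e' - e) * (t - e)⁻¹‖ ≤ 1/2 := by
    intro t ht
    have h1 := hK t ht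
    rw [norm_mul, norm_inv, ← div_eq_mul_inv, div_le_iff₀ (by linarith)]
    linarith
  obtain ⟨v, hv, hv1⟩ := hx.sqrt hxb
  obtain ⟨B, hB⟩ := hKb
  refine ⟨?_, he', fun z => F z * v z, ?_, ?_, ?_⟩
  · intro h
    have := hK e' h
    linarith
  · refine hF.mul hv (B := max (B + ‖a‖ + B + ‖e‖ + 1) 2) ?_ ?_
    · intro z hz
      refine le_trans ?_ (le_max_left _ _)
      have h1 : ‖F z‖ ^ 2 = ‖z - a‖ * ‖z - e‖ := by rw [← norm_pow, hF1 z hz, norm_mul]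
      have h2 := norm_sub_le z a
      have h3 := norm_sub_le z e
      have h4 := hB z hz
      nlinarith [norm_nonneg (z - a), norm_nonneg (z - e), norm_nonneg (F z), norm_nonneg z,
        norm_nonneg a, norm_nonneg e]
    · intro z hz
      refine le_trans ?_ (le_max_right _ _)
      have h1 := (hv1 z hz).2.trans (hxb z hz)
      have h2 := norm_sub_norm_le (v z) 1
      rw [norm_one] at h2
      linarith
  · intro z hz
    have h1 := hne z hz
    rw [mul_pow, hF1 z hz, (hv1 z hz).1]
    field_simp; ring
  · intro z hz hza
    have h1 := BranchSet.near hδ hea hF1 hF2 hz hza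
    have h2 := (hv1 z hz).2.trans (hxb z hz)
    apply re_pos_of_near_one
    have h3 : F z * v z / (z - a) - 1 = (F z / (z - a) - 1) * (v z - 1) +
      (F z / (z - a) - 1) + (v z - 1) := by ring
    rw [h3]
    have h4 : ‖(F z / (z - a) - 1) * (v z - 1)‖ ≤ 1/4 * (1/2) := by
      rw [norm_mul]; exact mul_le_mul h1 h2 (norm_nonneg _) (by norm_num)
    have h5 := norm_add₃_le (a := (F z / (z - a) - 1) * (v z - 1)) (b := (F z / (z - a) - 1))
      (c := (v z - 1))
    linarith

theorem BranchSet.exists_far {K : Set ℂ} (hK : IsCompact K) (hne : K.Nonempty)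
    (hc : IsPreconnected Kᶜ) {a : ℂ} (ha : a ∉ K) {δ : ℝ} (hδ : 0 < δ) :
    ∃ e ∈ BranchSet K a δ, δ / 2 < ‖e - a‖ := by
  have hP := PoleSet.eq_compl hK hne hc
  by_contra! hcon
  have hdist : ∀ a ∉ K, 0 < infDist a K := fun a ha =>
    (hK.isClosed.notMem_iff_infDist_pos hne).mp ha
  have hdle : ∀ a, ∀ t ∈ K, infDist a K ≤ ‖t - a‖ := fun a t ht => by
    rw [← dist_eq_norm, dist_comm]; exact infDist_le_dist_of_mem ht
  have hKb : ∃ B, ∀ z ∈ K, ‖z‖ ≤ B := hK.isBounded.exists_norm_le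
  have haB : a ∈ BranchSet K a δ := by
    refine ⟨ha, by simpa using hδ, fun z => z - a, ?_, fun z _ => by ring, ?_⟩
    · exact (CApprox.poly K (Polynomial.X - Polynomial.C a)).congr (by simp)
    · intro z _ hza
      have h0 : 0 < ‖z - a‖ := by linarith
      rw [div_self (norm_pos_iff.mp h0)]; simp
  have hsub : Kᶜ ⊆ BranchSet K a δ := by
    refine hc.subset_of_closure_inter_subset ?_ ⟨a, ha, haB⟩ ?_
    · rw [Metric.isOpen_iff]
      intro e he
      refine ⟨min (infDist e K / 2) (δ / 2), lt_min (half_pos (hdist e he.1)) (half_pos hδ),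
        fun b hb => ?_⟩
      rw [mem_ball, dist_eq_norm] at hb
      refine BranchSet.step hKb hP hδ he (hdist e he.1) (hdle e) (hb.le.trans (min_le_left _ _)) ?_
      have h1 := norm_sub_le_norm_sub_add_norm_sub b e a
      have h2 := hcon e he
      have h3 := min_le_right (infDist e K / 2) (δ / 2)
      linarith
    · rintro b ⟨hb1, hb2⟩
      have hd := hdist b hb2
      obtain ⟨e, he, hab⟩ := Metric.mem_closure_iff.mp hb1 (min (infDist b K / 4) (δ/2))
        (lt_min (by linarith) (by linarith))
      refine BranchSet.step hKb hP hδ he (d := infDist b K / 2) (by linarith) ?_ ?_ ?_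
      · intro t ht
        have h1 := hdle b t ht
        have h2 := dist_triangle t e b
        rw [dist_comm] at hab
        have h3 := min_le_left (infDist b K / 4) (δ / 2)
        rw [← dist_eq_norm] at h1 ⊢
        linarith
      · rw [← dist_eq_norm]
        have h3 := min_le_left (infDist b K / 4) (δ / 2)
        linarith
      · have h1 := norm_sub_le_norm_sub_add_norm_sub b e a
        have h2 := hcon e he
        have h3 := min_le_right (infDist b K / 4) (δ / 2)
        rw [dist_eq_norm] at hab
        linarith
  -- Kᶜ is unbounded
  obtain ⟨B, hB⟩ := hKb
  have hm : ((|B| + ‖a‖ + δ + 1 : ℝ) : ℂ) ∉ K := by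
    intro h
    have := hB _ h
    rw [Complex.norm_real, Real.norm_eq_abs, abs_of_pos (by positivity)] at this
    have := le_abs_self B
    have := norm_nonneg a
    linarith
  have h1 := (hsub hm).2.1
  have h2 := norm_sub_norm_le ((|B| + ‖a‖ + δ + 1 : ℝ) : ℂ) a
  rw [Complex.norm_real, Real.norm_eq_abs, abs_of_pos (by positivity)] at h2
  have := abs_nonneg B
  linarith

theorem kernel_far {w F d η : ℂ} {δ : ℝ} (hδ : 0 < δ) (hd0 : d ≠ 0) (hd : ‖d‖ ≤ δ) (hw : 30 * δ ≤ ‖w‖)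
    (hF : F ^ 2 = w ^ 2 - d ^ 2 / 4) (hre : 0 ≤ (F / w).re) (hη : ‖η‖ ≤ 5 * δ) :
    ‖(8 / d ^ 2 * (w - F)) + η * (8 / d ^ 2 * (w - F)) ^ 2 - (w - η)⁻¹‖ ≤
      52 * δ ^ 2 / ‖w‖ ^ 3 := by
  have hw0 : 0 < ‖w‖ := by linarith
  have hw' : w ≠ 0 := norm_pos_iff.mp hw0
  have h1 : (F / w) ^ 2 = 1 - (d ^ 2 / 4 / w ^ 2) := by
    rw [div_pow, hF]; field_simp
  have h2 := sqrt_near_one h1 hre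
  have h3 : ‖w - F‖ ≤ δ ^ 2 / (4 * ‖w‖) := by
    have e1 : w - F = - (w * (F / w - 1)) := by field_simp; ring
    rw [e1, norm_neg, norm_mul]
    calc ‖w‖ * ‖F / w - 1‖ ≤ ‖w‖ * ‖d ^ 2 / 4 / w ^ 2‖ := by gcongr
    _ = ‖d‖ ^ 2 / (4 * ‖w‖) := by
      rw [norm_div, norm_div, norm_pow, norm_pow]; norm_num; field_simp
    _ ≤ δ ^ 2 / (4 * ‖w‖) := by gcongr
  have h4 : ‖w‖ ≤ ‖w + F‖ := by
    have e1 : w + F = w * (1 + F / w) := by field_simp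
    rw [e1, norm_mul]
    have : (1:ℝ) ≤ ‖1 + F / w‖ := by
      calc (1:ℝ) ≤ (1 + F / w).re := by rw [Complex.add_re, Complex.one_re]; linarith
      _ ≤ _ := Complex.re_le_norm _
    nlinarith
  have hwF : w + F ≠ 0 := norm_pos_iff.mp (by linarith)
  set g := 8 / d ^ 2 * (w - F) with hg
  have h5 : g = 2 / (w + F) := by
    rw [hg, div_mul_eq_mul_div, div_eq_div_iff (pow_ne_zero 2 hd0) hwF]
    linear_combination (-8) * hF
  have h6 : g - w⁻¹ = (w - F) / (w * (w + F)) := by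
    rw [h5]; field_simp; ring
  have h7 : ‖g - w⁻¹‖ ≤ δ ^ 2 / (4 * ‖w‖ ^ 3) := by
    rw [h6, norm_div, norm_mul]
    calc ‖w - F‖ / (‖w‖ * ‖w + F‖) ≤ (δ ^ 2 / (4 * ‖w‖)) / (‖w‖ * ‖w‖) := by gcongr
    _ = _ := by field_simp
  have h8 : ‖g‖ ≤ 2 / ‖w‖ := by
    rw [h5, norm_div]; norm_num; gcongr
  have h9 : ‖w‖ / 2 ≤ ‖w - η‖ := by
    have := norm_sub_norm_le w η; linarith
  have hwη : w - η ≠ 0 := norm_pos_iff.mp (by linarith)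
  have e2 : g + η * g ^ 2 - (w - η)⁻¹ = (g - w⁻¹) + η * ((g - w⁻¹) * (g + w⁻¹))
      - η ^ 2 / (w ^ 2 * (w - η)) := by
    field_simp; ring
  rw [e2]
  have a1 : ‖η * ((g - w⁻¹) * (g + w⁻¹))‖ ≤ δ ^ 2 / ‖w‖ ^ 3 := by
    rw [norm_mul, norm_mul]
    have : ‖g + w⁻¹‖ ≤ 3 / ‖w‖ := by
      refine (norm_add_le _ _).trans ?_
      rw [norm_inv]
      calc ‖g‖ + ‖w‖⁻¹ ≤ 2 / ‖w‖ + ‖w‖⁻¹ := by gcongr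
      _ = _ := by field_simp; norm_num
    calc ‖η‖ * (‖g - w⁻¹‖ * ‖g + w⁻¹‖) ≤ (5 * δ) * (δ ^ 2 / (4 * ‖w‖ ^ 3) * (3 / ‖w‖)) := by gcongr
    _ = (15 / 4 * (δ / ‖w‖)) * (δ ^ 2 / ‖w‖ ^ 3) := by field_simp; norm_num
    _ ≤ 1 * (δ ^ 2 / ‖w‖ ^ 3) := by
      gcongr
      rw [← mul_div_assoc, div_le_one hw0]; linarith
    _ = _ := one_mul _
  have a2 : ‖η ^ 2 / (w ^ 2 * (w - η))‖ ≤ 50 * δ ^ 2 / ‖w‖ ^ 3 := by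
    rw [norm_div, norm_mul, norm_pow, norm_pow]
    calc ‖η‖ ^ 2 / (‖w‖ ^ 2 * ‖w - η‖) ≤ (5 * δ) ^ 2 / (‖w‖ ^ 2 * (‖w‖ / 2)) := by gcongr
    _ = _ := by field_simp; norm_num
  calc _ ≤ ‖g - w⁻¹‖ + ‖η * ((g - w⁻¹) * (g + w⁻¹))‖ + ‖η ^ 2 / (w ^ 2 * (w - η))‖ :=
        (norm_sub_le _ _).trans (by gcongr; exact norm_add_le _ _)
  _ ≤ δ ^ 2 / (4 * ‖w‖ ^ 3) + δ ^ 2 / ‖w‖ ^ 3 + 50 * δ ^ 2 / ‖w‖ ^ 3 := by gcongr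
  _ = (205 / 4) * (δ ^ 2 / ‖w‖ ^ 3) := by field_simp; norm_num
  _ ≤ 52 * (δ ^ 2 / ‖w‖ ^ 3) := by gcongr; norm_num
  _ = _ := by ring

theorem exists_kernel {K : Set ℂ} (hK : IsCompact K) (hne : K.Nonempty)
    (hc : IsPreconnected Kᶜ) {a : ℂ} (ha : a ∉ K) {δ : ℝ} (hδ : 0 < δ) :
    ∃ (g : ℂ → ℂ) (m : ℂ), CApprox K g ∧ (∃ B, ∀ z ∈ K, ‖g z‖ ≤ B) ∧
      ∀ ζ : ℂ, ‖ζ - a‖ ≤ 4 * δ → ∀ z ∈ K, z ≠ ζ →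
        ‖g z + (ζ - m) * g z ^ 2 - (z - ζ)⁻¹‖ ≤
          10 ^ 14 * (δ ^ 2 / (‖z - ζ‖ * (‖z - ζ‖ + δ) ^ 2)) := by
  obtain ⟨e, ⟨heK, hea, F, hF, hF1, hF2⟩, hfar⟩ := BranchSet.exists_far hK hne hc ha hδ
  have hd0 : e - a ≠ 0 := norm_pos_iff.mp (by linarith)
  set m := (a + e) / 2 with hm
  have hma : ‖m - a‖ ≤ δ / 2 := by
    have : m - a = (e - a) / 2 := by rw [hm]; ring
    rw [this, norm_div]; norm_num; linarith
  have hFn : ∀ z ∈ K, ‖F z‖ ≤ ‖z - a‖ + δ := by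
    intro z hz
    have h1 : ‖F z‖ ^ 2 = ‖z - a‖ * ‖z - e‖ := by rw [← norm_pow, hF1 z hz, norm_mul]
    have h2 : ‖z - e‖ ≤ ‖z - a‖ + δ := by
      have := norm_sub_le_norm_sub_add_norm_sub z a e
      rw [norm_sub_rev a e] at this; linarith
    have h3 := norm_nonneg (z - a)
    apply le_of_sq_le_sq _ (by positivity)
    rw [h1]; nlinarith
  have hzm : ∀ z, ‖z - m‖ ≤ ‖z - a‖ + δ := fun z => by
    have := norm_sub_le_norm_sub_add_norm_sub z a m
    rw [norm_sub_rev a m] at this; linarith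
  have hgn : ∀ z ∈ K, ‖8 / (e - a) ^ 2 * (z - m - F z)‖ ≤ 32 / δ ^ 2 * (2 * (‖z - a‖ + δ)) := by
    intro z hz
    rw [norm_mul, norm_div, norm_pow]
    have h1 : ‖z - m - F z‖ ≤ 2 * (‖z - a‖ + δ) := by
      have := norm_sub_le (z - m) (F z)
      linarith [hzm z, hFn z hz]
    have h2 : ‖(8:ℂ)‖ / ‖e - a‖ ^ 2 ≤ 32 / δ ^ 2 := by
      norm_num
      rw [div_le_div_iff₀ (by nlinarith) (by positivity)]
      nlinarith
    exact mul_le_mul h2 h1 (norm_nonneg _) (by positivity)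
  refine ⟨fun z => 8 / (e - a) ^ 2 * (z - m - F z), m, ?_, ?_, ?_⟩
  · refine CApprox.smul ?_ _
    refine ((CApprox.poly K (Polynomial.X - Polynomial.C m)).add (hF.smul (-1))).congr ?_
    intro z _; simp [sub_eq_add_neg]
  · obtain ⟨B, hB⟩ := hK.isBounded.exists_norm_le
    refine ⟨32 / δ ^ 2 * (2 * ((B + ‖a‖) + δ)), fun z hz => (hgn z hz).trans ?_⟩
    have := norm_sub_le z a
    have := hB z hz
    gcongr; linarith
  · intro ζ hζ z hz hzζ
    have hρ0 : 0 < ‖z - ζ‖ := norm_pos_iff.mpr (sub_ne_zero.mpr hzζ)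
    have hηm : ‖ζ - m‖ ≤ 5 * δ := by linarith [hzm ζ]
    by_cases hn : ‖z - a‖ < 40 * δ
    · have hρ : ‖z - ζ‖ ≤ 44 * δ := by
        have := norm_sub_le_norm_sub_add_norm_sub z a ζ
        rw [norm_sub_rev a ζ] at this; linarith
      have hg2 : ‖8 / (e - a) ^ 2 * (z - m - F z)‖ ≤ 2624 / δ := by
        refine (hgn z hz).trans ?_
        calc 32 / δ ^ 2 * (2 * (‖z - a‖ + δ)) ≤ 32 / δ ^ 2 * (2 * (40 * δ + δ)) := by gcongr
        _ = _ := by field_simp; norm_num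
      beta_reduce
      generalize 8 / (e - a) ^ 2 * (z - m - F z) = g at hg2 ⊢
      have hQ : ‖g + (ζ - m) * g ^ 2 - (z - ζ)⁻¹‖ ≤ 4 * 10 ^ 7 / δ + ‖z - ζ‖⁻¹ := by
        calc _ ≤ ‖g + (ζ - m) * g ^ 2‖ + ‖(z - ζ)⁻¹‖ := norm_sub_le _ _
        _ ≤ (‖g‖ + ‖ζ - m‖ * ‖g‖ ^ 2) + ‖z - ζ‖⁻¹ := by
            rw [norm_inv]; gcongr
            refine (norm_add_le _ _).trans ?_
            rw [norm_mul, norm_pow]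
        _ ≤ (2624 / δ + (5 * δ) * (2624 / δ) ^ 2) + ‖z - ζ‖⁻¹ := by gcongr
        _ = 34429504 / δ + ‖z - ζ‖⁻¹ := by field_simp; ring
        _ ≤ _ := by gcongr; norm_num
      refine hQ.trans ?_
      set ρ := ‖z - ζ‖
      have h1 : 4 * 10 ^ 7 / δ + ρ⁻¹ ≤ (2 * 10 ^ 9) / ρ := by
        rw [div_add' _ _ _ hδ.ne', div_le_div_iff₀ hδ hρ0]
        have : ρ⁻¹ * δ * ρ = δ := by field_simp
        nlinarith
      refine h1.trans ?_
      rw [← mul_div_assoc, div_le_div_iff₀ hρ0 (by positivity)]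
      have h2 : (ρ + δ) ^ 2 ≤ (45 * δ) ^ 2 := by gcongr; linarith
      have h3 : 2 * 10 ^ 9 * (ρ + δ) ^ 2 ≤ 10 ^ 14 * δ ^ 2 := by nlinarith
      nlinarith
    · push Not at hn
      have hw : 30 * δ ≤ ‖z - m‖ := by
        have := norm_sub_le_norm_sub_add_norm_sub z m a
        linarith
      have hw0 : 0 < ‖z - m‖ := by linarith
      have hzm0 : z - m ≠ 0 := norm_pos_iff.mp hw0
      have hza0 : z - a ≠ 0 := norm_pos_iff.mp (by linarith)
      have h1 := BranchSet.near hδ hea hF1 hF2 hz (by linarith)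
      have h2 : ‖(z - a) / (z - m) - 1‖ ≤ 1/4 := by
        have : (z - a) / (z - m) - 1 = (m - a) / (z - m) := by field_simp; ring
        rw [this, norm_div, div_le_iff₀ hw0]; linarith
      have hre : 0 < (F z / (z - m)).re := by
        apply re_pos_of_near_one
        have e1 : F z / (z - m) - 1 = (F z / (z - a) - 1) * ((z - a) / (z - m) - 1) +
          (F z / (z - a) - 1) + ((z - a) / (z - m) - 1) := by field_simp; ring
        rw [e1]
        have h4 : ‖(F z / (z - a) - 1) * ((z - a) / (z - m) - 1)‖ ≤ 1/4 * (1/4) := by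
          rw [norm_mul]; exact mul_le_mul h1 h2 (norm_nonneg _) (by norm_num)
        have h5 := norm_add₃_le (a := (F z / (z - a) - 1) * ((z - a) / (z - m) - 1))
          (b := (F z / (z - a) - 1)) (c := ((z - a) / (z - m) - 1))
        linarith
      have hk := kernel_far (w := z - m) (F := F z) (d := e - a) (η := ζ - m) hδ hd0 hea.le hw
        (by rw [hF1 z hz, hm]; ring) hre.le hηm
      rw [show z - m - (ζ - m) = z - ζ by ring] at hk
      refine hk.trans ?_
      have hρ : ‖z - ζ‖ ≤ 2 * ‖z - m‖ := by
        have := norm_sub_le_norm_sub_add_norm_sub z m ζ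
        rw [norm_sub_rev m ζ] at this; linarith
      set ρ := ‖z - ζ‖
      set W := ‖z - m‖
      calc 52 * δ ^ 2 / W ^ 3 = (52 * 18) * (δ ^ 2 / ((2 * W) * (3 * W) ^ 2)) := by
            field_simp; norm_num
      _ ≤ (52 * 18) * (δ ^ 2 / (ρ * (ρ + δ) ^ 2)) := by
            gcongr; linarith
      _ ≤ _ := by gcongr; norm_num

theorem kernel_int {δ : ℝ} (hδ : 0 < δ) (z : ℂ) :
    Integrable (fun ζ : ℂ => δ ^ 2 / (‖z - ζ‖ * (‖z - ζ‖ + δ) ^ 2)) ∧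
    ∫ ζ : ℂ, δ ^ 2 / (‖z - ζ‖ * (‖z - ζ‖ + δ) ^ 2) = 2 * Real.pi * δ := by
  have hder : ∀ x ∈ Ioi (0:ℝ), HasDerivAt (fun x : ℝ => - (δ ^ 2 / (x + δ)))
      (δ ^ 2 / (x + δ) ^ 2) x := by
    intro x hx
    have hx' : (0:ℝ) < x := hx
    have h1 : HasDerivAt (fun x : ℝ => x + δ) 1 x := (hasDerivAt_id x).add_const δ
    have h2 := ((hasDerivAt_const x (δ ^ 2)).div h1 (by positivity)).neg
    refine h2.congr_deriv ?_
    field_simp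
    ring
  have hcont : ContinuousWithinAt (fun x : ℝ => - (δ ^ 2 / (x + δ))) (Ici 0) 0 := by
    apply ContinuousAt.continuousWithinAt
    have : (0:ℝ) + δ ≠ 0 := by positivity
    fun_prop (disch := assumption)
  have hpos : ∀ x ∈ Ioi (0:ℝ), 0 ≤ δ ^ 2 / (x + δ) ^ 2 := fun x _ => by positivity
  have hlim : Tendsto (fun x : ℝ => - (δ ^ 2 / (x + δ))) atTop (nhds 0) := by
    rw [← neg_zero]
    exact (tendsto_const_nhds.div_atTop (tendsto_atTop_add_const_right _ _ tendsto_id)).neg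
  have i1 := integrableOn_Ioi_deriv_of_nonneg hcont hder hpos hlim
  have i2 := integral_Ioi_of_hasDerivAt_of_nonneg hcont hder hpos hlim
  have e1 : ∀ y ∈ Ioi (0:ℝ), y ^ (Module.finrank ℝ ℂ - 1) • (δ ^ 2 / (y * (y + δ) ^ 2)) =
      δ ^ 2 / (y + δ) ^ 2 := by
    intro y hy
    have hy' : (0:ℝ) < y := hy
    rw [Complex.finrank_real_complex]
    simp only [smul_eq_mul]; field_simp; norm_num
  have j1 : Integrable (fun x : ℂ => δ ^ 2 / (‖x‖ * (‖x‖ + δ) ^ 2)) :=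
    (integrable_fun_norm_addHaar (volume : Measure ℂ)
      (f := fun y => δ ^ 2 / (y * (y + δ) ^ 2))).2
      ((integrableOn_congr_fun e1 measurableSet_Ioi).2 i1)
  have j2 : ∫ x : ℂ, δ ^ 2 / (‖x‖ * (‖x‖ + δ) ^ 2) = 2 * Real.pi * δ := by
    rw [integral_fun_norm_addHaar (volume : Measure ℂ) (fun y => δ ^ 2 / (y * (y + δ) ^ 2)),
      setIntegral_congr_fun measurableSet_Ioi e1, i2, Complex.finrank_real_complex,
      measureReal_def, Complex.volume_ball]
    simp
    field_simp
  refine ⟨?_, ?_⟩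
  · exact (integrable_comp_sub_left (fun x : ℂ => δ ^ 2 / (‖x‖ * (‖x‖ + δ) ^ 2)) z).2 j1
  · rw [← j2]
    exact integral_sub_left_eq_self (fun x : ℂ => δ ^ 2 / (‖x‖ * (‖x‖ + δ) ^ 2)) volume z

theorem cauchy_integrable {R : ℝ} (z : ℂ) :
    Integrable (fun ζ : ℂ => (closedBall (0:ℂ) R).indicator (fun ζ => ‖ζ - z‖⁻¹) ζ) := by
  have h := ((kernel_int one_pos z).1).const_mul ((|R| + ‖z‖ + 1) ^ 2)
  refine h.mono' ?_ (ae_of_all _ fun ζ => ?_)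
  · exact (Measurable.indicator (by fun_prop) measurableSet_closedBall).aestronglyMeasurable
  · by_cases hζ : ζ ∈ closedBall (0:ℂ) R
    · rw [indicator_of_mem hζ, norm_inv, norm_norm]
      rw [mem_closedBall_zero_iff] at hζ
      rw [norm_sub_rev]
      have h1 : ‖z - ζ‖ ≤ |R| + ‖z‖ := by
        have := norm_sub_le z ζ; have := le_abs_self R; linarith
      rcases eq_or_lt_of_le (norm_nonneg (z - ζ)) with h0 | h0
      · rw [← h0]; simp
      have h2 : (‖z - ζ‖ + 1) ^ 2 ≤ (|R| + ‖z‖ + 1) ^ 2 := by gcongr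
      rw [one_pow, mul_one_div, inv_eq_one_div, div_le_div_iff₀ h0 (by positivity)]
      nlinarith
    · rw [indicator_of_notMem hζ]; simp; positivity

/-- the density of the Cauchy representation of the disc average -/
noncomputable def muf (f : ℂ → ℂ) (δ : ℝ) (ζ : ℂ) : ℂ :=
  ∫ θ in Ioc 0 (2 * Real.pi), f (ζ - circleMap 0 δ θ) * circleMap 0 δ θ

theorem circ_int {δ : ℝ} (hδ : 0 < δ) {x : ℂ} (hx : ‖x‖ ≠ δ) :
    ∫ θ in Ioc 0 (2 * Real.pi), circleMap 0 δ θ / (circleMap 0 δ θ - x) =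
      if ‖x‖ < δ then (2 * Real.pi : ℂ) else 0 := by
  have h1 : ∮ w in C(0, δ), (w - x)⁻¹ = Complex.I *
      ∫ θ in Ioc 0 (2 * Real.pi), circleMap 0 δ θ / (circleMap 0 δ θ - x) := by
    rw [circleIntegral, intervalIntegral.integral_of_le (by positivity), ← integral_const_mul]
    congr 1; ext θ
    rw [deriv_circleMap, smul_eq_mul]; ring
  have h2 : (∮ w in C(0, δ), (w - x)⁻¹) = Complex.I * if ‖x‖ < δ then (2 * Real.pi : ℂ) else 0 := by
    split_ifs with h
    · rw [circleIntegral.integral_sub_inv_of_mem_ball (by simpa using h)]; ring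
    · rw [mul_zero]
      have h' : δ < ‖x‖ := lt_of_le_of_ne (not_lt.mp h) (Ne.symm hx)
      have hne : ∀ w ∈ closedBall (0:ℂ) δ, w - x ≠ 0 := by
        intro w hw h0
        rw [sub_eq_zero.mp h0, mem_closedBall_zero_iff] at hw; linarith
      refine Complex.circleIntegral_eq_zero_of_differentiable_on_off_countable hδ.le
        countable_empty ?_ ?_
      · exact ContinuousOn.inv₀ (by fun_prop) hne
      · intro w hw
        exact DifferentiableAt.inv (by fun_prop) (hne w (ball_subset_closedBall hw.1))
  rw [h1] at h2
  exact mul_left_cancel₀ Complex.I_ne_zero h2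

theorem cauchy_rep {f : ℂ → ℂ} (hf : Continuous f) {R : ℝ} (hR : ∀ x, f x ≠ 0 → ‖x‖ ≤ R)
    {δ : ℝ} (hδ : 0 < δ) (z : ℂ) :
    Integrable (fun ζ => muf f δ ζ / (ζ - z)) ∧
    ∫ ζ, muf f δ ζ / (ζ - z) = 2 * Real.pi * ∫ y in ball z δ, f y := by
  obtain ⟨M, hM⟩ : ∃ M, ∀ x, ‖f x‖ ≤ M := by
    obtain ⟨M, hM⟩ := (isCompact_closedBall (0:ℂ) R).exists_bound_of_continuousOn hf.continuousOn
    refine ⟨max M 0, fun x => ?_⟩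
    by_cases hx : f x = 0
    · rw [hx, norm_zero]; exact le_max_right _ _
    · exact (hM x (by simpa using hR x hx)).trans (le_max_left _ _)
  have hcn : ∀ θ, ‖circleMap 0 δ θ‖ = δ := fun θ => by simp [circleMap, abs_of_pos hδ]
  set ν : Measure ℝ := volume.restrict (Ioc 0 (2 * Real.pi)) with hν
  have : IsFiniteMeasure ν := by rw [hν]; infer_instance
  have hcm : Continuous (circleMap 0 δ) := continuous_circleMap 0 δ
  have hH : Integrable (Function.uncurry fun (ζ : ℂ) (θ : ℝ) =>
      f (ζ - circleMap 0 δ θ) * circleMap 0 δ θ / (ζ - z)) (volume.prod ν) := by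
    have h0 : Integrable (fun x : ℂ × ℝ => (M * δ) *
      (closedBall (0:ℂ) (R + δ)).indicator (fun ζ => ‖ζ - z‖⁻¹) x.1) (volume.prod ν) :=
      ((cauchy_integrable z).const_mul (M * δ)).comp_fst ν
    refine h0.mono' ?_ (ae_of_all _ ?_)
    · have : Measurable (fun x : ℂ × ℝ =>
          f (x.1 - circleMap 0 δ x.2) * circleMap 0 δ x.2 / (x.1 - z)) := by
        refine Measurable.div (Continuous.measurable (by fun_prop)) (by fun_prop)
      exact this.aestronglyMeasurable
    · rintro ⟨ζ, θ⟩
      have hM0 : 0 ≤ M := (norm_nonneg _).trans (hM 0)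
      simp only [Function.uncurry]
      by_cases hz : f (ζ - circleMap 0 δ θ) = 0
      · rw [hz]; simp
        apply mul_nonneg (by positivity)
        apply indicator_nonneg; intro x _; positivity
      · have h1 := hR _ hz
        have h2 : ζ ∈ closedBall (0:ℂ) (R + δ) := by
          rw [mem_closedBall_zero_iff]
          have := norm_sub_norm_le ζ (circleMap 0 δ θ)
          rw [hcn] at this; linarith
        rw [indicator_of_mem h2, norm_div, norm_mul, hcn, div_eq_mul_inv]
        gcongr; exact hM _
  have hG : Integrable (Function.uncurry fun (y : ℂ) (θ : ℝ) =>
      f y * circleMap 0 δ θ / (y + circleMap 0 δ θ - z)) (volume.prod ν) := by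
    have hmeas : Measurable (fun x : ℂ × ℝ =>
          f x.1 * circleMap 0 δ x.2 / (x.1 + circleMap 0 δ x.2 - z)) := by
        refine Measurable.div (Continuous.measurable (by fun_prop))
          (Continuous.measurable (by fun_prop))
    refine (integrable_prod_iff' hmeas.aestronglyMeasurable).2 ?_
    have hH' := (integrable_prod_iff' hH.1).1 hH
    refine ⟨?_, ?_⟩
    · filter_upwards [hH'.1] with θ hθ
      have := hθ.comp_add_right (circleMap 0 δ θ)
      refine this.congr (ae_of_all _ fun y => ?_)
      simp [Function.uncurry]
    · refine hH'.2.congr (ae_of_all _ fun θ => ?_)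
      simp only [Function.uncurry]
      rw [← integral_add_right_eq_self _ (circleMap 0 δ θ)]
      simp
  have hfst : ∀ ζ, ∫ θ, f (ζ - circleMap 0 δ θ) * circleMap 0 δ θ / (ζ - z) ∂ν =
      muf f δ ζ / (ζ - z) := fun ζ => by rw [muf, integral_div]
  refine ⟨?_, ?_⟩
  · refine hH.integral_prod_left.congr (ae_of_all _ fun ζ => hfst ζ)
  · simp_rw [← hfst]
    rw [integral_integral_swap hH]
    have h1 : ∀ θ, ∫ ζ, f (ζ - circleMap 0 δ θ) * circleMap 0 δ θ / (ζ - z) =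
        ∫ y, f y * circleMap 0 δ θ / (y + circleMap 0 δ θ - z) := by
      intro θ
      rw [← integral_add_right_eq_self _ (circleMap 0 δ θ)]
      simp
    simp_rw [h1]
    rw [← integral_integral_swap hG, ← integral_indicator measurableSet_ball,
      ← integral_const_mul]
    apply integral_congr_ae
    have hs : ∀ᵐ y : ℂ, y ∉ sphere z δ := by
      rw [ae_iff]; simp only [not_not]
      exact Measure.addHaar_sphere volume z δ
    filter_upwards [hs] with y hy
    have hx : ‖z - y‖ ≠ δ := by
      rw [mem_sphere, dist_eq_norm, norm_sub_rev] at hy; exact hy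
    have h2 : ∀ θ, f y * circleMap 0 δ θ / (y + circleMap 0 δ θ - z) =
        f y * (circleMap 0 δ θ / (circleMap 0 δ θ - (z - y))) := fun θ => by
      rw [mul_div_assoc]; congr 2; ring
    simp_rw [h2]
    rw [integral_const_mul, hν, circ_int hδ hx]
    by_cases hb : y ∈ ball z δ
    · rw [indicator_of_mem hb]
      rw [mem_ball, dist_eq_norm, norm_sub_rev] at hb
      rw [if_pos hb]; ring
    · rw [indicator_of_notMem hb]
      rw [mem_ball, dist_eq_norm, norm_sub_rev] at hb
      rw [if_neg hb]; ring

theorem muf_zero {f : ℂ → ℂ} (hf : Continuous f) {δ : ℝ} (hδ : 0 < δ) {ζ : ℂ}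
    (hd : ∀ x ∈ ball ζ δ, DifferentiableAt ℂ f x) : muf f δ ζ = 0 := by
  have h1 : ∮ w in C(0, δ), f (ζ - w) = 0 := by
    refine Complex.circleIntegral_eq_zero_of_differentiable_on_off_countable hδ.le
        countable_empty (by fun_prop) ?_
    intro w hw
    have hw1 := hw.1
    rw [mem_ball_zero_iff] at hw1
    have h2 : DifferentiableAt ℂ f (ζ - w) := hd _ (by simpa [mem_ball, dist_eq_norm] using hw1)
    exact h2.comp w (by fun_prop)
  rw [circleIntegral, intervalIntegral.integral_of_le (by positivity)] at h1
  have h2 : ∀ θ, deriv (circleMap 0 δ) θ • f (ζ - circleMap 0 δ θ) =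
      Complex.I * (f (ζ - circleMap 0 δ θ) * circleMap 0 δ θ) := fun θ => by
    rw [deriv_circleMap, smul_eq_mul]; ring
  simp_rw [h2] at h1
  rw [integral_const_mul] at h1
  exact (mul_eq_zero.mp h1).resolve_left Complex.I_ne_zero

theorem muf_bound {f : ℂ → ℂ} (hf : Continuous f) {δ ω : ℝ} (hδ : 0 < δ) {ζ : ℂ}
    (hω : ∀ x y, ‖x - y‖ ≤ δ → ‖f x - f y‖ ≤ ω) : ‖muf f δ ζ‖ ≤ 2 * Real.pi * (ω * δ) := by
  have hcn : ∀ θ, ‖circleMap 0 δ θ‖ = δ := fun θ => by simp [circleMap, abs_of_pos hδ]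
  have h0 : muf (fun _ => f ζ) δ ζ = 0 := muf_zero (by fun_prop) hδ (by simp)
  have h1 : muf f δ ζ = ∫ θ in Ioc 0 (2 * Real.pi),
      (f (ζ - circleMap 0 δ θ) - f ζ) * circleMap 0 δ θ := by
    have h0' : muf f δ ζ = muf f δ ζ - muf (fun _ => f ζ) δ ζ := by rw [h0, sub_zero]
    rw [h0', muf, muf, ← integral_sub]
    · congr 1; ext θ; ring
    · exact (Continuous.integrableOn_Icc (by fun_prop)).mono_set Ioc_subset_Icc_self
    · exact (Continuous.integrableOn_Icc (by fun_prop)).mono_set Ioc_subset_Icc_self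
  rw [h1]
  refine (norm_setIntegral_le_of_norm_le_const (C := ω * δ) measure_Ioc_lt_top ?_).trans ?_
  · intro θ _
    rw [norm_mul, hcn]
    gcongr
    apply hω
    rw [sub_sub_cancel_left, norm_neg, hcn]
  · rw [Real.volume_real_Ioc_of_le (by positivity)]
    simp; linarith

theorem exists_ext {K : Set ℂ} (hK : IsCompact K) {f : ℂ → ℂ} (hf : ContinuousOn f K) :
    ∃ (g : ℂ → ℂ) (R : ℝ), Continuous g ∧ (∀ x, g x ≠ 0 → ‖x‖ ≤ R) ∧ ∀ x ∈ K, g x = f x := by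
  obtain ⟨g, hg⟩ := ContinuousMap.exists_restrict_eq hK.isClosed ⟨K.domRestrict f, hf.domRestrict⟩
  obtain ⟨B, hB⟩ := hK.isBounded.exists_norm_le
  refine ⟨fun x => ((max 0 (min 1 (B + 1 - ‖x‖)) : ℝ) : ℂ) * g x, B + 1, ?_, ?_, ?_⟩
  · have := g.continuous
    fun_prop
  · intro x hx
    by_contra! h
    apply hx
    beta_reduce
    rw [max_eq_left ((min_le_right _ _).trans (by linarith))]; simp
  · intro x hx
    have h1 := hB x hx
    have h2 : g x = f x := congrArg (fun F => F ⟨x, hx⟩) hg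
    beta_reduce
    rw [min_eq_left (by linarith), max_eq_right zero_le_one, h2]; simp

noncomputable def cell (δ : ℝ) (ζ : ℂ) : ℤ × ℤ := (⌊ζ.re / δ⌋, ⌊ζ.im / δ⌋)

theorem cell_dist {δ : ℝ} (hδ : 0 < δ) {x y : ℂ} (h : cell δ x = cell δ y) : ‖x - y‖ ≤ 2 * δ := by
  have aux : ∀ a b : ℝ, ⌊a / δ⌋ = ⌊b / δ⌋ → |a - b| ≤ δ := by
    intro a b hab
    have := Int.abs_sub_lt_one_of_floor_eq_floor hab
    rw [← sub_div, abs_div, abs_of_pos hδ, div_lt_one hδ] at this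
    exact this.le
  simp only [cell, Prod.mk.injEq] at h
  have h1 := aux _ _ h.1
  have h2 := aux _ _ h.2
  have := Complex.norm_le_abs_re_add_abs_im (x - y)
  rw [Complex.sub_re, Complex.sub_im] at this
  linarith

theorem cell_meas (δ : ℝ) (c : ℤ × ℤ) : MeasurableSet {ζ | cell δ ζ = c} := by
  have : Measurable (cell δ) := by
    apply Measurable.prodMk
    · exact Int.measurable_floor.comp (by fun_prop)
    · exact Int.measurable_floor.comp (by fun_prop)
  exact this (measurableSet_singleton c)

theorem cell_fin {δ : ℝ} (hδ : 0 < δ) (R : ℝ) :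
    ∃ t : Finset (ℤ × ℤ), ∀ ζ : ℂ, ‖ζ‖ ≤ R → cell δ ζ ∈ t := by
  have aux : ∀ a : ℝ, |a| ≤ R → ⌊a / δ⌋ ∈ Finset.Icc ⌊-R / δ⌋ ⌊R / δ⌋ := by
    intro a ha
    rw [Finset.mem_Icc]
    constructor
    · exact Int.floor_mono (by gcongr; exact (abs_le.mp ha).1)
    · exact Int.floor_mono (by gcongr; exact (abs_le.mp ha).2)
  refine ⟨Finset.Icc ⌊-R / δ⌋ ⌊R / δ⌋ ×ˢ Finset.Icc ⌊-R / δ⌋ ⌊R / δ⌋, fun ζ hζ => ?_⟩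
  rw [Finset.mem_product]
  exact ⟨aux _ ((Complex.abs_re_le_norm ζ).trans hζ), aux _ ((Complex.abs_im_le_norm ζ).trans hζ)⟩

theorem avg_near {f : ℂ → ℂ} (hf : Continuous f) {δ ω : ℝ} (hδ : 0 < δ) (z : ℂ)
    (hω : ∀ x y, ‖x - y‖ ≤ δ → ‖f x - f y‖ ≤ ω) :
    ‖((Real.pi * δ ^ 2 : ℝ) : ℂ) * f z - ∫ y in ball z δ, f y‖ ≤ Real.pi * δ ^ 2 * ω := by
  have hvol : volume.real (ball z δ) = Real.pi * δ ^ 2 := by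
    rw [measureReal_def, Complex.volume_ball]
    simp [hδ.le, mul_comm]
  have hlt : volume (ball z δ) < ⊤ := measure_ball_lt_top
  have h1 : ((Real.pi * δ ^ 2 : ℝ) : ℂ) * f z = ∫ y in ball z δ, f z := by
    rw [setIntegral_const, hvol]; simp
  rw [h1, ← integral_sub]
  · refine (norm_setIntegral_le_of_norm_le_const (C := ω) hlt ?_).trans ?_
    · intro y hy
      apply hω
      rw [mem_ball, dist_eq_norm, norm_sub_rev] at hy; exact hy.le
    · rw [hvol]; linarith
  · exact integrableOn_const hlt.ne
  · exact (hf.continuousOn.integrableOn_compact (isCompact_closedBall z δ)).mono_set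
      ball_subset_closedBall

theorem muf_cont {f : ℂ → ℂ} (hf : Continuous f) (δ : ℝ) : Continuous (muf f δ) := by
  have h : Continuous fun ζ => ∫ θ in Icc 0 (2 * Real.pi),
      f (ζ - circleMap 0 δ θ) * circleMap 0 δ θ := by
    refine continuous_parametric_integral_of_continuous
      (f := fun ζ θ => f (ζ - circleMap 0 δ θ) * circleMap 0 δ θ) ?_ isCompact_Icc
    have := continuous_circleMap 0 δ
    fun_prop
  simp_rw [integral_Icc_eq_integral_Ioc] at h
  exact h

theorem mergelyan {K : Set ℂ} (hK : IsCompact K) (hne : K.Nonempty)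
    (hc : IsPreconnected Kᶜ) {f₀ : ℂ → ℂ} (hf₀ : ContinuousOn f₀ K)
    (hd₀ : ∀ z ∈ interior K, DifferentiableAt ℂ f₀ z) : CApprox K f₀ := by
  obtain ⟨f, R, hf, hR, hfK⟩ := exists_ext hK hf₀
  have hd : ∀ z ∈ interior K, DifferentiableAt ℂ f z := by
    intro z hz
    refine (hd₀ z hz).congr_of_eventuallyEq ?_
    filter_upwards [isOpen_interior.mem_nhds hz] with x hx using hfK x (interior_subset hx)
  refine CApprox.congr (f := f) ?_ (fun z hz => (hfK z hz).symm)
  clear hf₀ hd₀ hfK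
  have hcs : HasCompactSupport f := HasCompactSupport.of_support_subset_isCompact
    (isCompact_closedBall (0:ℂ) R) (fun x hx => by simpa using hR x hx)
  apply CApprox.of_limit
  intro ε hε
  set ω := ε / (3 * 10 ^ 14) with hωd
  have hω0 : 0 < ω := by positivity
  obtain ⟨δ', hδ', hδω⟩ := Metric.uniformContinuous_iff.mp
    (hcs.uniformContinuous_of_continuous hf) ω hω0
  set δ := δ' / 2 with hδd
  have hδ : 0 < δ := by positivity
  have hω : ∀ x y, ‖x - y‖ ≤ δ → ‖f x - f y‖ ≤ ω := by
    intro x y hxy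
    rw [← dist_eq_norm] at hxy ⊢
    exact (hδω (by linarith)).le
  have hcn : ∀ θ, ‖circleMap 0 δ θ‖ = δ := fun θ => by simp [circleMap, abs_of_pos hδ]
  have hmS : ∀ ζ, muf f δ ζ ≠ 0 → ‖ζ‖ ≤ R + δ := by
    intro ζ h
    by_contra! hcon
    apply h
    rw [muf]
    have : ∀ θ, f (ζ - circleMap 0 δ θ) * circleMap 0 δ θ = 0 := by
      intro θ
      by_cases hz : f (ζ - circleMap 0 δ θ) = 0
      · rw [hz, zero_mul]
      · have h1 := hR _ hz
        have := norm_sub_norm_le ζ (circleMap 0 δ θ)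
        rw [hcn] at this; linarith
    simp [this]
  have hmS2 : ∀ ζ, muf f δ ζ ≠ 0 → ∃ a ∉ K, ‖ζ - a‖ < 2 * δ := by
    intro ζ h
    by_contra! hcon
    apply h
    apply muf_zero hf hδ
    intro x hx
    apply hd
    rw [mem_interior]
    refine ⟨ball ζ δ, ?_, isOpen_ball, hx⟩
    intro y hy
    by_contra hyK
    have := hcon y hyK
    rw [mem_ball, dist_eq_norm, norm_sub_rev] at hy
    linarith
  have hmc := muf_cont hf δ
  have hmcs : HasCompactSupport (muf f δ) := HasCompactSupport.of_support_subset_isCompact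
    (isCompact_closedBall (0:ℂ) (R + δ)) (fun x hx => by simpa using hmS x hx)
  have hmi : Integrable (muf f δ) := hmc.integrable_of_hasCompactSupport hmcs
  have hmb : ∀ ζ, ‖muf f δ ζ‖ ≤ 2 * Real.pi * (ω * δ) := fun ζ => muf_bound hf hδ hω
  have hker : ∀ c : ℤ × ℤ, ∃ (g : ℂ → ℂ) (m : ℂ), CApprox K g ∧ (∃ B, ∀ z ∈ K, ‖g z‖ ≤ B) ∧
      ∀ ζ : ℂ, muf f δ ζ ≠ 0 → cell δ ζ = c → ∀ z ∈ K, z ≠ ζ →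
        ‖g z + (ζ - m) * g z ^ 2 - (z - ζ)⁻¹‖ ≤
          10 ^ 14 * (δ ^ 2 / (‖z - ζ‖ * (‖z - ζ‖ + δ) ^ 2)) := by
    intro c
    by_cases h : ∃ ζ, muf f δ ζ ≠ 0 ∧ cell δ ζ = c
    · obtain ⟨ζ₀, h1, h2⟩ := h
      obtain ⟨a, ha, haζ⟩ := hmS2 ζ₀ h1
      obtain ⟨g, m, hg1, hg2, hg3⟩ := exists_kernel hK hne hc ha hδ
      refine ⟨g, m, hg1, hg2, fun ζ _ h4 z hz hzζ => hg3 ζ ?_ z hz hzζ⟩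
      have h5 := cell_dist hδ (h4.trans h2.symm)
      have := norm_sub_le_norm_sub_add_norm_sub ζ ζ₀ a
      linarith
    · push Not at h
      exact ⟨fun _ => 0, 0, CApprox.const K 0, ⟨0, by simp⟩, fun ζ h1 h2 => (h ζ h1 h2).elim⟩
  choose g m hg1 hg2 hg3 using hker
  obtain ⟨t, ht⟩ := cell_fin hδ (R + δ)
  set A : ℝ := 2 * Real.pi * (Real.pi * δ ^ 2) with hA
  have hA0 : 0 < A := by positivity
  have hmi2 : ∀ c, Integrable (fun ζ => muf f δ ζ * (ζ - m c)) := by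
    intro c
    refine Continuous.integrable_of_hasCompactSupport (by fun_prop) ?_
    exact hmcs.mul_right
  refine ⟨fun z => (-(A:ℂ)⁻¹) * ∑ c ∈ t, ((∫ ζ in {ζ | cell δ ζ = c}, muf f δ ζ) * g c z +
    (∫ ζ in {ζ | cell δ ζ = c}, muf f δ ζ * (ζ - m c)) * g c z ^ 2), ?_, ?_⟩
  · refine CApprox.smul (CApprox.sum _ fun c _ => CApprox.add ((hg1 c).smul _) ?_) _
    obtain ⟨B, hB⟩ := hg2 c
    exact ((hg1 c).pow hB 2).smul _
  · intro z hz
    obtain ⟨hri, hrep⟩ := cauchy_rep hf hR hδ z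
    have hdisj : (↑t : Set (ℤ × ℤ)).Pairwise
        (Function.onFun Disjoint fun c => {ζ | cell δ ζ = c}) := by
      intro c _ c' _ hcc
      rw [Function.onFun, Set.disjoint_left]
      intro ζ h1 h2
      exact hcc (h1.symm.trans h2)
    have hsplit : ∫ ζ, muf f δ ζ / (ζ - z) =
        ∑ c ∈ t, ∫ ζ in {ζ | cell δ ζ = c}, muf f δ ζ / (ζ - z) := by
      rw [← integral_biUnion_finset t (fun c _ => cell_meas δ c) hdisj
        (fun c _ => hri.integrableOn)]
      symm
      apply setIntegral_eq_integral_of_forall_compl_eq_zero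
      intro ζ hζ
      by_cases h0 : muf f δ ζ = 0
      · rw [h0, zero_div]
      · exfalso; apply hζ
        simp only [mem_iUnion]
        exact ⟨_, ht ζ (hmS ζ h0), rfl⟩
    set k : ℂ → ℝ := fun ζ => δ ^ 2 / (‖z - ζ‖ * (‖z - ζ‖ + δ) ^ 2) with hk
    obtain ⟨hki, hkv⟩ := kernel_int hδ z
    set C : ℝ := 2 * Real.pi * (ω * δ) * 10 ^ 14 with hC
    have hcell : ∀ c, ‖(∫ ζ in {ζ | cell δ ζ = c}, muf f δ ζ / (ζ - z)) +
        ((∫ ζ in {ζ | cell δ ζ = c}, muf f δ ζ) * g c z +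
        (∫ ζ in {ζ | cell δ ζ = c}, muf f δ ζ * (ζ - m c)) * g c z ^ 2)‖ ≤
        ∫ ζ in {ζ | cell δ ζ = c}, C * k ζ := by
      intro c
      rw [← integral_mul_const, ← integral_mul_const, ← integral_add, ← integral_add]
      · refine norm_integral_le_of_norm_le (hki.const_mul C).integrableOn ?_
        have hzz : ∀ᵐ ζ ∂(volume.restrict {ζ | cell δ ζ = c}), ζ ≠ z := by
          apply ae_restrict_of_ae
          rw [ae_iff]; simp
        filter_upwards [hzz, ae_restrict_mem (cell_meas δ c)] with ζ h1 h2
        have hkn : 0 ≤ k ζ := by rw [hk]; positivity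
        by_cases h0 : muf f δ ζ = 0
        · rw [h0]; simp; positivity
        · have h3 := hg3 c ζ h0 h2 z hz h1.symm
          have e : muf f δ ζ / (ζ - z) + (muf f δ ζ * g c z + muf f δ ζ * (ζ - m c) * g c z ^ 2) =
              muf f δ ζ * (g c z + (ζ - m c) * g c z ^ 2 - (z - ζ)⁻¹) := by
            rw [← neg_sub z ζ, div_neg, div_eq_mul_inv]; ring
          rw [e, norm_mul]
          calc _ ≤ (2 * Real.pi * (ω * δ)) * (10 ^ 14 * k ζ) := by
                apply mul_le_mul (hmb ζ) h3 (norm_nonneg _) (by positivity)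
          _ = C * k ζ := by rw [hC]; ring
      · exact hri.integrableOn
      · exact (hmi.integrableOn.mul_const _).add ((hmi2 c).integrableOn.mul_const _)
      · exact hmi.integrableOn.mul_const _
      · exact (hmi2 c).integrableOn.mul_const _
    set Sg := ∑ c ∈ t, ((∫ ζ in {ζ | cell δ ζ = c}, muf f δ ζ) * g c z +
      (∫ ζ in {ζ | cell δ ζ = c}, muf f δ ζ * (ζ - m c)) * g c z ^ 2) with hSg
    have hsum : ‖(∫ ζ, muf f δ ζ / (ζ - z)) + Sg‖ ≤ C * (2 * Real.pi * δ) := by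
      rw [hsplit, hSg, ← Finset.sum_add_distrib]
      calc _ ≤ ∑ c ∈ t, ∫ ζ in {ζ | cell δ ζ = c}, C * k ζ :=
            (norm_sum_le _ _).trans (Finset.sum_le_sum fun c _ => hcell c)
      _ = ∫ ζ in ⋃ c ∈ t, {ζ | cell δ ζ = c}, C * k ζ := by
          rw [integral_biUnion_finset t (fun c _ => cell_meas δ c) hdisj
            (fun c _ => (hki.const_mul C).integrableOn)]
      _ ≤ ∫ ζ, C * k ζ := by
          apply setIntegral_le_integral (hki.const_mul C)
          filter_upwards with ζ
          simp only [Pi.zero_apply]; positivity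
      _ = C * (2 * Real.pi * δ) := by rw [integral_const_mul, hkv]
    have havg := avg_near hf hδ z hω
    rw [hrep] at hsum
    have hfin : f z - -(A:ℂ)⁻¹ * Sg = (A:ℂ)⁻¹ * ((2 * Real.pi : ℝ) *
        (((Real.pi * δ ^ 2 : ℝ) : ℂ) * f z - ∫ y in ball z δ, f y) +
        (2 * Real.pi * (∫ y in ball z δ, f y) + Sg)) := by
      have hA' : (A:ℂ) ≠ 0 := by exact_mod_cast hA0.ne'
      have : (A:ℂ) = (2 * Real.pi : ℝ) * ((Real.pi * δ ^ 2 : ℝ) : ℂ) := by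
        rw [hA]; push_cast; ring
      field_simp
      rw [this]; push_cast; ring
    rw [hfin, norm_mul, norm_inv, Complex.norm_real, Real.norm_eq_abs, abs_of_pos hA0,
      inv_mul_le_iff₀ hA0]
    calc _ ≤ (2 * Real.pi) * (Real.pi * δ ^ 2 * ω) + C * (2 * Real.pi * δ) := by
          refine (norm_add_le _ _).trans ?_
          gcongr
          rw [norm_mul, Complex.norm_real, Real.norm_eq_abs, abs_of_pos (by positivity)]
          gcongr
    _ = A * ((1 + 2 * 10 ^ 14) * ω) := by rw [hA, hC]; ring
    _ ≤ A * ε := by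
          gcongr
          have : ω * (3 * 10 ^ 14) = ε := by rw [hωd]; field_simp
          nlinarith

structure DiskParam (D : JordanDomain) (ψ : ℂ → ℂ) (g : ℝ → ℂ) (σ : ℝ → ℝ) : Prop where
  cont : ContinuousOn ψ (closedBall 0 1)
  diff : DifferentiableOn ℂ ψ (ball 0 1)
  bij : BijOn ψ (ball 0 1) D.G
  bijs : BijOn ψ (sphere 0 1) (frontier D.G)
  bijc : BijOn ψ (closedBall 0 1) (closure D.G)
  g_lip : LipschitzWith 1 g
  g_per : Function.Periodic g D.l
  g_var : ∀ s t : ℝ, s ≤ t → t ≤ s + D.l → eVariationOn g (Icc s t) = ENNReal.ofReal (t - s)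
  g_eq : (∀ s, g s = D.γ s) ∨ (∀ s, g s = D.γ (-s))
  σ_mono : Monotone σ
  σ_zero : σ 0 = 0
  σ_add : ∀ θ, σ (θ + 2 * Real.pi) = σ θ + D.l
  bdry : ∀ θ : ℝ, ψ (exp (θ * I)) = g (σ θ)

theorem lip_of_var {g : ℝ → ℂ} {l : ℝ} (hl : 0 < l)
    (h : ∀ s t : ℝ, s ≤ t → t ≤ s + l → eVariationOn g (Icc s t) = ENNReal.ofReal (t - s))
    (hp : Function.Periodic g l) : LipschitzWith 1 g := by
  have key : ∀ s t : ℝ, s ≤ t → dist (g s) (g t) ≤ t - s := by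
    intro s t hst
    have aux : ∀ t', s ≤ t' → t' ≤ s + l → dist (g s) (g t') ≤ t' - s := by
      intro t' h1 h2
      have := eVariationOn.edist_le g (left_mem_Icc.mpr h1) (right_mem_Icc.mpr h1)
      rw [h _ _ h1 h2, edist_dist] at this
      exact (ENNReal.ofReal_le_ofReal_iff (by linarith)).mp this
    by_cases hc : t ≤ s + l
    · exact aux t hst hc
    obtain ⟨t', ht', hgt⟩ := hp.exists_mem_Ico hl t s
    rw [hgt]
    refine (aux t' ht'.1 ht'.2.le).trans ?_
    linarith [ht'.2]
  refine LipschitzWith.of_dist_le_mul fun x y => ?_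
  rw [NNReal.coe_one, one_mul, Real.dist_eq]
  rcases le_total x y with hxy | hxy
  · rw [abs_of_nonpos (by linarith)]; linarith [key x y hxy]
  · rw [dist_comm, abs_of_nonneg (by linarith)]; linarith [key y x hxy]

theorem quasi_ext {σ : ℝ → ℝ} {l T : ℝ} (hT : 0 < T) (hl : 0 < l) (h : MonotoneOn σ (Ico 0 T)) (h0 : ∀ x ∈ Ico 0 T, σ x ∈ Icc 0 l) : ∃ τ : ℝ → ℝ, Monotone τ ∧ (∀ x, τ (x + T) = τ x + l) ∧ (∀ x, ∃ n : ℤ, τ x = σ (x - n * T) + n * l ∧ x - n * T ∈ Ico 0 T) ∧ τ 0 = σ 0 := by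
  have hm : ∀ x : ℝ, x - ⌊x / T⌋ * T ∈ Ico 0 T := by
    intro x
    have h1 := Int.floor_le (x / T)
    have h2 := Int.lt_floor_add_one (x / T)
    rw [le_div_iff₀ hT] at h1
    rw [div_lt_iff₀ hT] at h2
    constructor <;> linarith
  refine ⟨fun x => σ (x - ⌊x / T⌋ * T) + ⌊x / T⌋ * l, ?_, ?_, fun x => ⟨⌊x / T⌋, rfl, hm x⟩, by simp⟩
  · intro x y hxy
    have hf : ⌊x / T⌋ ≤ ⌊y / T⌋ := Int.floor_mono (by gcongr)
    beta_reduce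
    rcases hf.eq_or_lt with h1 | h1
    · rw [h1]
      have := h (h1 ▸ hm x) (hm y) (by linarith)
      linarith
    · have h2 : (⌊x / T⌋ : ℝ) + 1 ≤ ⌊y / T⌋ := by exact_mod_cast h1
      have h3 := (h0 _ (hm x)).2
      have h4 := (h0 _ (hm y)).1
      nlinarith
  · intro x
    have : (x + T) / T = x / T + 1 := by field_simp
    beta_reduce
    rw [this, Int.floor_add_one]
    push_cast
    rw [show x + T - (⌊x / T⌋ + 1 : ℝ) * T = x - ⌊x / T⌋ * T by ring]
    ring

theorem exp_inj_Ico {x y : ℝ} (hx : x ∈ Ico 0 (2 * Real.pi)) (hy : y ∈ Ico 0 (2 * Real.pi))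
    (h : exp (x * I) = exp (y * I)) : x = y := by
  obtain ⟨n, hn⟩ := Complex.exp_eq_exp_iff_exists_int.mp h
  have h1 : x = y + n * (2 * Real.pi) := by
    have := congrArg Complex.im hn
    simpa using this
  have hpi := Real.pi_pos
  have hn1 : (n : ℝ) < 1 := by
    by_contra! hc
    nlinarith [hx.2, hy.1]
  have hn2 : (-1 : ℝ) < n := by
    by_contra! hc
    nlinarith [hx.1, hy.2]
  have : n = 0 := by
    have a : n < 1 := by exact_mod_cast hn1
    have b : -1 < n := by exact_mod_cast hn2
    omega
  rw [h1, this]; simp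

theorem exists_diskParam (D : JordanDomain) {φ : ℂ → ℂ} {ζ : ℂ}
    (hφ : ConformalOnto D.G φ ζ) (hφc : ContinuousOn φ (closure D.G)) (hζ : ζ ∈ D.G) :
    ∃ ψ g σ u, DiskParam D ψ g σ ∧ ‖u‖ = 1 ∧ (∀ w ∈ closedBall (0:ℂ) 1, φ (ψ w) = u * w) ∧
      ψ 0 = ζ := by
  obtain ⟨ψ₀, hc, hd, hb, hbs, hbc, hinv⟩ := ConformalOnto.exists_inverse D hφ hφc
  obtain ⟨u, hu, hu0⟩ := hbs.surjOn (D.γ_mem 0)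
  have hun : ‖u‖ = 1 := by simpa using hu
  have hu0' : u ≠ 0 := by intro h; simp [h] at hun
  have hpi := Real.pi_pos
  set ψ : ℂ → ℂ := fun w => ψ₀ (u * w) with hψ
  have hrot : ∀ w : ℂ, ‖u * w‖ = ‖w‖ := fun w => by rw [norm_mul, hun, one_mul]
  have rb : BijOn (fun w => u * w) (ball (0:ℂ) 1) (ball 0 1) := by
    refine ⟨fun w hw => ?_, fun a _ b _ h => mul_left_cancel₀ hu0' h, fun w hw => ⟨u⁻¹ * w, ?_, ?_⟩⟩
    · simpa [hun] using hw
    · simpa [hun] using hw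
    · simp [hu0']
  have rc : BijOn (fun w => u * w) (closedBall (0:ℂ) 1) (closedBall 0 1) := by
    refine ⟨fun w hw => ?_, fun a _ b _ h => mul_left_cancel₀ hu0' h, fun w hw => ⟨u⁻¹ * w, ?_, ?_⟩⟩
    · simpa [hun] using hw
    · simpa [hun] using hw
    · simp [hu0']
  have rs : BijOn (fun w => u * w) (sphere (0:ℂ) 1) (sphere 0 1) := by
    refine ⟨fun w hw => ?_, fun a _ b _ h => mul_left_cancel₀ hu0' h, fun w hw => ⟨u⁻¹ * w, ?_, ?_⟩⟩
    · simpa [hun] using hw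
    · simpa [hun] using hw
    · simp [hu0']
  have hψc : ContinuousOn ψ (closedBall 0 1) := hc.comp (by fun_prop) rc.mapsTo
  have hψd : DifferentiableOn ℂ ψ (ball 0 1) := hd.comp (by fun_prop) rb.mapsTo
  have hψb := hb.comp rb
  have hψbs := hbs.comp rs
  have hψbc := hbc.comp rc
  have hψ1 : ψ 1 = D.γ 0 := by simp [hψ, hu0]
  have hsph : ∀ θ : ℝ, exp (θ * I) ∈ sphere (0:ℂ) 1 := fun θ => by simp [Complex.norm_exp_ofReal_mul_I]
  have hex : ∀ θ : ℝ, ∃ s ∈ Ico 0 D.l, D.γ s = ψ (exp (θ * I)) := by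
    intro θ
    have h1 := hψbs.mapsTo (hsph θ)
    rw [← D.γ_boundary] at h1
    exact h1
  choose σ₀ hσ₀ hσγ using hex
  have hne0 : ∀ θ ∈ Ioo 0 (2 * Real.pi), ψ (exp (θ * I)) ≠ D.γ 0 := by
    intro θ hθ h
    rw [← hψ1] at h
    have h2 := hψbs.injOn (hsph θ) (by simp) h
    have h3 := exp_inj_Ico (x := θ) (y := 0) ⟨hθ.1.le, hθ.2⟩ ⟨le_rfl, by positivity⟩ (by simpa using h2)
    linarith [hθ.1]
  have hpos : ∀ θ ∈ Ioo 0 (2 * Real.pi), 0 < σ₀ θ := by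
    intro θ hθ
    refine lt_of_le_of_ne (hσ₀ θ).1 fun h => hne0 θ hθ ?_
    rw [← hσγ, ← h]
  have hcont : ContinuousOn σ₀ (Ioo 0 (2 * Real.pi)) := by
    rw [continuousOn_iff_isClosed]
    intro C hC
    have hcomp : IsCompact (D.γ '' (Icc 0 D.l ∩ C)) :=
      (isCompact_Icc.inter_right hC).image D.γ_cont
    have hcc : Continuous (fun θ : ℝ => ψ (exp (θ * I))) := by
      apply hψc.comp_continuous (by fun_prop)
      intro θ; exact sphere_subset_closedBall (hsph θ)
    refine ⟨_, hcomp.isClosed.preimage hcc, ?_⟩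
    ext θ
    constructor
    · rintro ⟨h1, h2⟩
      exact ⟨⟨σ₀ θ, ⟨⟨(hσ₀ θ).1, (hσ₀ θ).2.le⟩, h1⟩, hσγ θ⟩, h2⟩
    · rintro ⟨⟨s, ⟨hs, hsC⟩, hsγ⟩, h2⟩
      have hsl : s ≠ D.l := by
        rintro rfl
        apply hne0 θ h2
        have := D.γ_periodic 0
        rw [zero_add] at this
        rw [← this]; exact hsγ.symm
      have : s = σ₀ θ := D.γ_injOn ⟨hs.1, lt_of_le_of_ne hs.2 hsl⟩ (hσ₀ θ) (hsγ.trans (hσγ θ).symm)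
      exact ⟨by rw [mem_preimage, ← this]; exact hsC, h2⟩
  have hinj : InjOn σ₀ (Ioo 0 (2 * Real.pi)) := by
    intro x hx y hy h
    have h1 : ψ (exp (x * I)) = ψ (exp (y * I)) := by rw [← hσγ, ← hσγ, h]
    exact exp_inj_Ico ⟨hx.1.le, hx.2⟩ ⟨hy.1.le, hy.2⟩ (hψbs.injOn (hsph x) (hsph y) h1)
  have hfin : ∀ (g : ℝ → ℂ) (σ₁ : ℝ → ℝ), Function.Periodic g D.l →
      (∀ s t : ℝ, s ≤ t → t ≤ s + D.l → eVariationOn g (Icc s t) = ENNReal.ofReal (t - s)) →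
      ((∀ s, g s = D.γ s) ∨ (∀ s, g s = D.γ (-s))) → MonotoneOn σ₁ (Ioo 0 (2 * Real.pi)) →
      (∀ θ ∈ Ioo 0 (2 * Real.pi), σ₁ θ ∈ Icc 0 D.l ∧ ψ (exp (θ * I)) = g (σ₁ θ)) → σ₁ 0 = 0 →
      ∃ ψ g σ u, DiskParam D ψ g σ ∧ ‖u‖ = 1 ∧ (∀ w ∈ closedBall (0:ℂ) 1, φ (ψ w) = u * w) ∧
      ψ 0 = ζ := by
    intro g σ₁ hper hvar hg hm hσ₁ h0
    have hdec : ∀ x ∈ Ico 0 (2 * Real.pi), x = 0 ∨ x ∈ Ioo 0 (2 * Real.pi) := by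
      intro x hx
      rcases hx.1.eq_or_lt with h | h
      · exact Or.inl h.symm
      · exact Or.inr ⟨h, hx.2⟩
    have hI : ∀ x ∈ Ico 0 (2 * Real.pi), σ₁ x ∈ Icc 0 D.l := by
      intro x hx
      rcases hdec x hx with rfl | h
      · rw [h0]; exact ⟨le_rfl, D.l_pos.le⟩
      · exact (hσ₁ x h).1
    have hm' : MonotoneOn σ₁ (Ico 0 (2 * Real.pi)) := by
      intro x hx y hy hxy
      rcases hdec x hx with rfl | h
      · rw [h0]; exact (hI y hy).1
      · exact hm h ⟨h.1.trans_le hxy, hy.2⟩ hxy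
    obtain ⟨τ, h1, h2, h3, h4⟩ := quasi_ext (by positivity) D.l_pos hm' hI
    refine ⟨ψ, g, τ, u, ⟨hψc, hψd, hψb, hψbs, hψbc, lip_of_var D.l_pos hvar hper, hper, hvar, hg, h1,
      h4.trans h0, h2, ?_⟩, hun, ?_, ?_⟩
    · intro θ
      obtain ⟨n, hn, hn'⟩ := h3 θ
      have e1 : exp (θ * I) = exp (((θ - n * (2 * Real.pi) : ℝ) : ℂ) * I) := by
        rw [Complex.exp_eq_exp_iff_exists_int]
        exact ⟨n, by push_cast; ring⟩
      rw [hn, hper.int_mul n, e1]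
      rcases hdec _ hn' with h | h
      · rw [h, h0]
        have : g 0 = D.γ 0 := by rcases hg with hg | hg <;> simp [hg]
        rw [this, ← hψ1]; simp
      · exact (hσ₁ _ h).2
    · intro w hw
      exact hinv.2 (rc.mapsTo hw)
    · have : φ (ψ₀ 0) = 0 := hinv.2 (by simp)
      have h5 : ψ 0 ∈ D.G := hψb.mapsTo (by simp)
      apply hφ.bijOn.injOn h5 hζ
      rw [hφ.map_center]
      simpa [hψ] using this
  rcases hcont.strictMonoOn_of_injOn_Ioo (by positivity) hinj with hm | hm
  · refine hfin D.γ (fun θ => if θ = 0 then 0 else σ₀ θ) D.γ_periodic D.γ_unitSpeed (Or.inl fun _ => rfl)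
      ?_ ?_ (by simp)
    · intro x hx y hy hxy
      simp only [hx.1.ne', hy.1.ne', if_false]
      exact hm.monotoneOn hx hy hxy
    · intro x hx
      simp only [hx.1.ne', if_false]
      exact ⟨⟨(hσ₀ x).1, (hσ₀ x).2.le⟩, (hσγ x).symm⟩
  · refine hfin (fun s => D.γ (-s)) (fun θ => if θ = 0 then 0 else D.l - σ₀ θ) ?_ ?_
      (Or.inr fun _ => rfl) ?_ ?_ (by simp)
    · intro s
      beta_reduce
      rw [neg_add', D.γ_periodic.sub_eq]
    · intro s t hst ht
      have : eVariationOn (D.γ ∘ fun x => -x) (Icc s t) = eVariationOn D.γ ((fun x => -x) '' Icc s t) :=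
        eVariationOn.comp_eq_of_antitoneOn _ _ (fun _ _ _ _ h => neg_le_neg h)
      rw [show (fun s => D.γ (-s)) = D.γ ∘ fun x => -x from rfl, this]
      rw [show (fun x : ℝ => -x) '' Icc s t = Icc (-t) (-s) by simp]
      rw [D.γ_unitSpeed _ _ (by linarith) (by linarith)]
      congr 1; ring
    · intro x hx y hy hxy
      simp only [hx.1.ne', hy.1.ne', if_false]
      linarith [hm.antitoneOn hx hy hxy]
    · intro x hx
      simp only [hx.1.ne', if_false]
      refine ⟨⟨by linarith [(hσ₀ x).2], by linarith [(hσ₀ x).1]⟩, ?_⟩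
      rw [← hσγ x, neg_sub, D.γ_periodic.sub_eq]

noncomputable def polyInt (S : Polynomial ℂ) (ζ z : ℂ) : ℂ :=
  ∑ i ∈ Finset.range (S.natDegree + 1), S.coeff i * ((z ^ (i + 1) - ζ ^ (i + 1)) / ((i : ℂ) + 1))

theorem polyInt_hasDerivAt (S : Polynomial ℂ) (ζ z : ℂ) : HasDerivAt (polyInt S ζ) (S.eval z) z := by
  rw [Polynomial.eval_eq_sum_range]
  unfold polyInt
  apply HasDerivAt.fun_sum
  intro i _
  have h1 := (((hasDerivAt_pow (i + 1) z).sub_const (ζ ^ (i + 1))).div_const ((i:ℂ) + 1)).const_mul (S.coeff i)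
  have : (i : ℂ) + 1 ≠ 0 := Nat.cast_add_one_ne_zero i
  have h2 : S.coeff i * (((i + 1 : ℕ) : ℂ) * z ^ (i + 1 - 1) / ((i : ℂ) + 1)) = S.coeff i * z ^ i := by
    push_cast
    rw [mul_div_cancel_left₀ _ this]
  rw [h2] at h1
  exact h1

theorem lip_int_bound {γ : ℝ → ℂ} (hγ : LipschitzWith 1 γ) {Q q : ℂ → ℂ} (hQ : ∀ z, HasDerivAt Q (q z) z)
    (hq : Continuous q) {a b : ℝ} (hab : a ≤ b) :
    ‖Q (γ b) - Q (γ a)‖ ≤ ∫ s in a..b, ‖q (γ s)‖ := by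
  have hγc := hγ.continuous
  have hQc : Continuous Q := continuous_iff_continuousAt.mpr fun z => (hQ z).continuousAt
  have hqc : Continuous fun s => ‖q (γ s)‖ := by fun_prop
  refine image_le_of_liminf_slope_right_le_deriv_boundary (f := fun t => ‖Q (γ t) - Q (γ a)‖)
    (B := fun t => ∫ s in a..t, ‖q (γ s)‖) (B' := fun s => ‖q (γ s)‖) (a := a) (b := b) ?_ ?_ ?_ ?_ ?_
    (right_mem_Icc.mpr hab)
  · fun_prop
  · simp
  · exact (intervalIntegral.continuous_primitive (fun _ _ => hqc.intervalIntegrable _ _) a).continuousOn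
  · intro x _
    exact (intervalIntegral.integral_hasDerivAt_right (hqc.intervalIntegrable _ _)
      (hqc.stronglyMeasurableAtFilter _ _) hqc.continuousAt).hasDerivWithinAt
  · intro x _ r hr
    have h1 := (hQ (γ x)).isLittleO
    have hη : 0 < (r - ‖q (γ x)‖) / 2 := by linarith
    have h2 := h1.bound hη
    have h3 := (hγc.tendsto x).eventually h2
    have h4 : ∀ᶠ z in nhdsWithin x (Ioi x), slope (fun t => ‖Q (γ t) - Q (γ a)‖) x z < r := by
      filter_upwards [nhdsWithin_le_nhds h3, self_mem_nhdsWithin] with z hz hzx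
      have hzx' : 0 < z - x := sub_pos.mpr hzx
      rw [slope_def_field, div_lt_iff₀ hzx']
      have h5 : ‖γ z - γ x‖ ≤ z - x := by
        have := hγ.dist_le_mul z x
        rw [NNReal.coe_one, one_mul, Real.dist_eq, abs_of_pos hzx', dist_eq_norm] at this
        exact this
      have h6 : ‖Q (γ z) - Q (γ x)‖ ≤ (‖q (γ x)‖ + (r - ‖q (γ x)‖) / 2) * ‖γ z - γ x‖ := by
        have : Q (γ z) - Q (γ x) = (Q (γ z) - Q (γ x) - (γ z - γ x) • q (γ x)) + (γ z - γ x) • q (γ x) := by ring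
        rw [this]
        refine (norm_add_le _ _).trans ?_
        rw [norm_smul]
        linarith
      have h7 : ‖Q (γ z) - Q (γ a)‖ - ‖Q (γ x) - Q (γ a)‖ ≤ ‖Q (γ z) - Q (γ x)‖ := by
        have := norm_sub_norm_le (Q (γ z) - Q (γ a)) (Q (γ x) - Q (γ a))
        rwa [sub_sub_sub_cancel_right] at this
      have h8 : 0 ≤ ‖q (γ x)‖ := norm_nonneg _
      have h9 : 0 ≤ (‖q (γ x)‖ + (r - ‖q (γ x)‖) / 2) := by linarith
      have h10 := mul_le_mul_of_nonneg_left h5 h9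
      nlinarith
    exact h4.frequently

section
variable {D : JordanDomain} {ψ : ℂ → ℂ} {g : ℝ → ℂ} {σ : ℝ → ℝ}

theorem DiskParam.int_eq (P : DiskParam D ψ g σ) (F : ℂ → ℝ) :
    ∫ s in (0:ℝ)..D.l, F (g s) = ∫ s in (0:ℝ)..D.l, F (D.γ s) := by
  rcases P.g_eq with h | h
  · simp_rw [h]
  · simp_rw [h]
    rw [intervalIntegral.integral_comp_neg (fun s => F (D.γ s))]
    have := Function.Periodic.intervalIntegral_add_eq (f := fun s => F (D.γ s)) (T := D.l)
      (fun s => by simp only [D.γ_periodic s]) (-D.l) 0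
    simpa using this

theorem disc_sum_bound (P : DiskParam D ψ g σ) {Q q : ℂ → ℂ} (hQ : ∀ z, HasDerivAt Q (q z) z)
    (hq : Continuous q) (N : ℕ) {z : ℂ} (hz : ‖z‖ ≤ 1) :
    ∑ k ∈ Finset.range (N + 1), ‖Q (ψ (exp (((k + 1 : ℕ) * (2 * Real.pi / (N + 1)) : ℝ) * I) * z)) -
      Q (ψ (exp ((k * (2 * Real.pi / (N + 1)) : ℝ) * I) * z))‖ ≤ ∫ s in (0:ℝ)..D.l, ‖q (D.γ s)‖ := by
  set δ : ℝ := 2 * Real.pi / (N + 1) with hδ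
  have hδ0 : 0 ≤ δ := by have := Real.pi_pos; positivity
  set E : ℕ → ℂ := fun k => exp ((k * δ : ℝ) * I) with hE
  have hEn : ∀ k, ‖E k‖ = 1 := fun k => Complex.norm_exp_ofReal_mul_I _
  set T : ℕ → ℂ → ℂ := fun k z => Q (ψ (E (k+1) * z)) - Q (ψ (E k * z)) with hT
  have hQd : Differentiable ℂ Q := fun z => (hQ z).differentiableAt
  have hd : ∀ k, DiffContOnCl ℂ (fun z => Q (ψ (E k * z))) (ball 0 1) := by
    intro k
    constructor
    · refine hQd.comp_differentiableOn (P.diff.comp (by fun_prop) ?_)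
      intro w hw; simpa [hEn] using hw
    · rw [closure_ball _ one_ne_zero]
      refine hQd.continuous.comp_continuousOn (P.cont.comp (by fun_prop) ?_)
      intro w hw; simpa [hEn] using hw
  have hbd : ∀ w : ℂ, ‖w‖ = 1 → ∑ k ∈ Finset.range (N + 1), ‖T k w‖ ≤ ∫ s in (0:ℝ)..D.l, ‖q (D.γ s)‖ := by
    intro w hw
    obtain ⟨θ, rfl⟩ := (Complex.norm_eq_one_iff w).mp hw
    have h1 : ∀ k : ℕ, ψ (E k * exp (θ * I)) = g (σ (θ + k * δ)) := by
      intro k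
      rw [← P.bdry, hE, ← Complex.exp_add]
      congr 2; push_cast; ring
    have hgc := P.g_lip.continuous
    have hii : ∀ a b : ℝ, IntervalIntegrable (fun s => ‖q (g s)‖) volume a b := fun a b =>
      Continuous.intervalIntegrable (by fun_prop) _ _
    calc _ ≤ ∑ k ∈ Finset.range (N + 1), ∫ s in (σ (θ + k * δ))..(σ (θ + (k + 1 : ℕ) * δ)), ‖q (g s)‖ := by
          refine Finset.sum_le_sum fun k _ => ?_
          simp only [hT]
          rw [h1, h1]
          refine lip_int_bound P.g_lip hQ hq (P.σ_mono ?_)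
          push_cast; nlinarith
    _ = ∫ s in (σ (θ + (0:ℕ) * δ))..(σ (θ + (N + 1 : ℕ) * δ)), ‖q (g s)‖ := by
          rw [intervalIntegral.sum_integral_adjacent_intervals (a := fun k : ℕ => σ (θ + k * δ)) (n := N + 1)
            (fun k _ => hii _ _)]
    _ = ∫ s in (σ θ)..(σ θ + D.l), ‖q (g s)‖ := by
          rw [← P.σ_add]
          congr 2
          · simp
          · rw [hδ]; push_cast; field_simp
    _ = ∫ s in (0:ℝ)..(0 + D.l), ‖q (g s)‖ := by
          apply Function.Periodic.intervalIntegral_add_eq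
          intro s; simp only [P.g_per s]
    _ = _ := by rw [zero_add]; exact P.int_eq (fun z => ‖q z‖)
  have hex : ∀ k, ∃ e : ℂ, ‖e‖ = 1 ∧ e * T k z = ‖T k z‖ := by
    intro k
    by_cases h : T k z = 0
    · exact ⟨1, by simp, by simp [h]⟩
    · have h' : (‖T k z‖ : ℂ) ≠ 0 := by simpa using h
      refine ⟨‖T k z‖ / T k z, ?_, ?_⟩
      · simp [h]
      · field_simp
  choose e he1 he2 using hex
  have hmax := Complex.norm_le_of_forall_mem_frontier_norm_le (f := fun w => ∑ k ∈ Finset.range (N+1), e k * T k w)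
    (U := ball 0 1) isBounded_ball (C := ∫ s in (0:ℝ)..D.l, ‖q (D.γ s)‖) ?_ ?_ (z := z) ?_
  · beta_reduce at hmax
    rw [Finset.sum_congr rfl (fun k _ => he2 k), ← Complex.ofReal_sum, Complex.norm_real, Real.norm_of_nonneg
      (Finset.sum_nonneg fun _ _ => norm_nonneg _)] at hmax
    exact hmax
  · have : ∀ k, DiffContOnCl ℂ (fun w => e k * T k w) (ball 0 1) := fun k =>
      ((hd (k+1)).sub (hd k)).const_smul (e k)
    constructor
    · exact DifferentiableOn.fun_sum fun k _ => (this k).1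
    · exact continuousOn_finsetSum _ fun k _ => (this k).2
  · intro w hw
    rw [frontier_ball _ one_ne_zero] at hw
    refine (norm_sum_le _ _).trans ?_
    refine le_trans (le_of_eq ?_) (hbd w (by simpa using hw))
    exact Finset.sum_congr rfl fun k _ => by rw [norm_mul, he1, one_mul]
  · rw [closure_ball _ one_ne_zero]; simpa using hz

theorem DiskParam.deriv_cont (P : DiskParam D ψ g σ) : ContinuousOn (deriv ψ) (ball 0 1) :=
  (P.diff.deriv isOpen_ball).continuousOn

theorem circ_mem {r : ℝ} (hr0 : 0 ≤ r) (hr : r < 1) (θ : ℝ) : (r : ℂ) * exp (θ * I) ∈ ball (0:ℂ) 1 := by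
  simp [Complex.norm_exp_ofReal_mul_I, abs_of_nonneg hr0, hr]

theorem circ_comp_cont {E : Type*} [TopologicalSpace E] {F : ℂ → E} (hF : ContinuousOn F (ball 0 1))
    {r : ℝ} (hr0 : 0 ≤ r) (hr : r < 1) :
    Continuous fun θ : ℝ => F (r * exp (θ * I)) :=
  hF.comp_continuous (by fun_prop) (circ_mem hr0 hr)

theorem circ_hasDerivAt {F F' : ℂ → ℂ} (hF : ∀ z ∈ ball (0:ℂ) 1, HasDerivAt F (F' z) z) {r : ℝ} (hr0 : 0 ≤ r) (hr : r < 1)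
    (θ : ℝ) : HasDerivAt (fun θ : ℝ => F (r * exp (θ * I))) (F' (r * exp (θ * I)) * (r * (exp (θ * I) * I))) θ := by
  have h1 : HasDerivAt (fun t : ℝ => (t : ℂ)) 1 θ := Complex.ofRealCLM.hasDerivAt
  have h2 := ((h1.mul_const I).cexp.const_mul (r : ℂ))
  have h3 := (hF _ (circ_mem hr0 hr θ)).comp θ h2
  simp only [one_mul] at h3
  exact h3

theorem circ_bound (P : DiskParam D ψ g σ) {Q q : ℂ → ℂ} (hQ : ∀ z, HasDerivAt Q (q z) z)
    (hq : Continuous q) {r : ℝ} (hr0 : 0 ≤ r) (hr : r < 1) :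
    ∫ θ in (0:ℝ)..(2 * Real.pi), ‖q (ψ (r * exp (θ * I)))‖ * ‖deriv ψ (r * exp (θ * I))‖ * r ≤
      ∫ s in (0:ℝ)..D.l, ‖q (D.γ s)‖ := by
  set V := ∫ s in (0:ℝ)..D.l, ‖q (D.γ s)‖ with hV
  have hpi := Real.pi_pos
  set f : ℝ → ℂ := fun θ => Q (ψ (r * exp (θ * I))) with hf
  set f' : ℝ → ℂ := fun θ => (q (ψ (r * exp (θ * I))) * deriv ψ (r * exp (θ * I))) * (r * (exp (θ * I) * I)) with hf'
  have hder : ∀ θ, HasDerivAt f (f' θ) θ := by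
    apply circ_hasDerivAt (F := fun z => Q (ψ z)) (F' := fun z => q (ψ z) * deriv ψ z) _ hr0 hr
    intro z hz
    exact (hQ (ψ z)).comp z (P.diff.differentiableAt (isOpen_ball.mem_nhds hz)).hasDerivAt
  have hf'c : Continuous f' := by
    have h1 := circ_comp_cont (P.cont.mono ball_subset_closedBall) hr0 hr
    have h2 := circ_comp_cont P.deriv_cont hr0 hr
    exact ((hq.comp h1).mul h2).mul (by fun_prop)
  have hfc : Continuous f := continuous_iff_continuousAt.mpr fun θ => (hder θ).continuousAt
  have hfp : Function.Periodic f (2 * Real.pi) := by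
    intro θ
    have : exp (((θ + 2 * Real.pi : ℝ) : ℂ) * I) = exp (θ * I) := by
      rw [Complex.exp_eq_exp_iff_exists_int]; exact ⟨1, by push_cast; ring⟩
    simp only [hf, this]
  have hnorm : ∀ θ : ℝ, ‖q (ψ (r * exp (θ * I)))‖ * ‖deriv ψ (r * exp (θ * I))‖ * r = ‖f' θ‖ := by
    intro θ
    simp [hf', Complex.norm_exp_ofReal_mul_I, abs_of_nonneg hr0]
  simp_rw [hnorm]
  set δ : ℕ → ℝ := fun N => 2 * Real.pi / (N + 1) with hδ
  have hδ0 : ∀ N, 0 < δ N := fun N => by simp only [hδ]; positivity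
  have hb : ∀ N : ℕ, ∫ θ in (0:ℝ)..(2 * Real.pi), ‖f (θ + δ N) - f θ‖ / δ N ≤ V := by
    intro N
    have hshift : ∀ k : ℕ, ∫ θ in (0:ℝ)..(2 * Real.pi), ‖f (θ + (k + 1 : ℕ) * δ N) - f (θ + k * δ N)‖ =
        ∫ θ in (0:ℝ)..(2 * Real.pi), ‖f (θ + δ N) - f θ‖ := by
      intro k
      have h1 := intervalIntegral.integral_comp_add_right (fun θ => ‖f (θ + δ N) - f θ‖) (k * δ N) (a := 0) (b := 2 * Real.pi)
      have h2 := Function.Periodic.intervalIntegral_add_eq (f := fun θ => ‖f (θ + δ N) - f θ‖) (T := 2 * Real.pi)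
        (fun θ => by beta_reduce; rw [add_right_comm, hfp, hfp]) (k * δ N) 0
      rw [zero_add] at h1 h2
      rw [add_comm (k * δ N), h1.symm] at h2
      rw [← h2]
      congr 1; ext θ; congr 3; push_cast; ring
    have hsum : ∫ θ in (0:ℝ)..(2 * Real.pi), ∑ k ∈ Finset.range (N + 1),
        ‖f (θ + (k + 1 : ℕ) * δ N) - f (θ + k * δ N)‖ ≤ ∫ θ in (0:ℝ)..(2 * Real.pi), V := by
      apply intervalIntegral.integral_mono_on (by positivity)
      · exact Continuous.intervalIntegrable (by fun_prop) _ _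
      · simp
      · intro θ _
        have := disc_sum_bound P hQ hq N (z := r * exp (θ * I)) (by
          simp [Complex.norm_exp_ofReal_mul_I, abs_of_nonneg hr0, hr.le])
        refine le_trans (le_of_eq ?_) this
        refine Finset.sum_congr rfl fun k _ => ?_
        simp only [hf]
        have e1 : ∀ t : ℝ, (r:ℂ) * exp (((θ + t : ℝ) : ℂ) * I) = exp (t * I) * (r * exp (θ * I)) := by
          intro t
          rw [mul_left_comm, ← Complex.exp_add]; congr 2; push_cast; ring
        rw [e1, e1]
    rw [intervalIntegral.integral_finsetSum (fun k _ => Continuous.intervalIntegrable (by fun_prop) _ _)] at hsum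
    simp_rw [hshift] at hsum
    rw [Finset.sum_const, Finset.card_range, nsmul_eq_mul, intervalIntegral.integral_const, smul_eq_mul] at hsum
    rw [intervalIntegral.integral_div, div_le_iff₀ (hδ0 N)]
    simp only [hδ]
    rw [mul_div_assoc', le_div_iff₀ (by positivity)]
    push_cast at hsum
    linarith
  obtain ⟨C, hC⟩ := isCompact_Icc.exists_bound_of_continuousOn (hf'c.continuousOn (s := Icc 0 (4 * Real.pi)))
  have hlim : Tendsto (fun N => ∫ θ in (0:ℝ)..(2 * Real.pi), ‖f (θ + δ N) - f θ‖ / δ N) atTop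
      (nhds (∫ θ in (0:ℝ)..(2 * Real.pi), ‖f' θ‖)) := by
    apply intervalIntegral.tendsto_integral_filter_of_dominated_convergence (fun _ => C)
    · filter_upwards with N
      exact Continuous.aestronglyMeasurable (by fun_prop)
    · filter_upwards with N
      filter_upwards with θ hθ
      rw [uIoc_of_le (by positivity)] at hθ
      rw [Real.norm_of_nonneg (div_nonneg (norm_nonneg _) (hδ0 N).le), div_le_iff₀ (hδ0 N)]
      have hδ1 : δ N ≤ 2 * Real.pi := by
        simp only [hδ]; apply div_le_self (by positivity); linarith [(Nat.cast_nonneg N : (0:ℝ) ≤ N)]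
      have := (convex_Icc (0:ℝ) (4 * Real.pi)).norm_image_sub_le_of_norm_hasDerivWithin_le
        (f := f) (fun x _ => (hder x).hasDerivWithinAt) hC (x := θ) (y := θ + δ N)
        ⟨hθ.1.le, by linarith [hθ.2]⟩ ⟨by linarith [hθ.1, hδ0 N], by linarith [hθ.2]⟩
      rwa [add_sub_cancel_left, Real.norm_of_nonneg (hδ0 N).le] at this
    · simp
    · filter_upwards with θ _
      have h1 := (hasDerivAt_iff_tendsto_slope.mp (hder θ)).norm
      have h2 : Tendsto (fun N => θ + δ N) atTop (nhdsWithin θ {θ}ᶜ) := by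
        apply tendsto_nhdsWithin_of_tendsto_nhds_of_eventually_within
        · have : Tendsto δ atTop (nhds 0) := by
            have := (tendsto_one_div_add_atTop_nhds_zero_nat (𝕜 := ℝ)).const_mul (2 * Real.pi)
            rw [mul_zero] at this
            refine this.congr fun N => ?_
            simp only [hδ]; ring
          simpa using this.const_add θ
        · filter_upwards with N
          simpa using (hδ0 N).ne'
      refine (h1.comp h2).congr fun N => ?_
      simp only [Function.comp, slope_def_module, add_sub_cancel_left, norm_smul, norm_inv,
        Real.norm_of_nonneg (hδ0 N).le]
      rw [div_eq_inv_mul]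
  exact le_of_tendsto' hlim hb
end

noncomputable abbrev mu0 : Measure ℝ := volume.restrict (Ioc (0:ℝ) (2 * Real.pi))

theorem mu0_int (f : ℝ → ℝ) : ∫ θ in (0:ℝ)..(2 * Real.pi), f θ = ∫ θ, f θ ∂mu0 :=
  intervalIntegral.integral_of_le (by have := Real.pi_pos; positivity)

theorem mu0_cont_int {f : ℝ → ℝ} (hf : Continuous f) : Integrable f mu0 :=
  (hf.integrableOn_Icc (a := 0) (b := 2 * Real.pi)).mono_set Ioc_subset_Icc_self

theorem fatou_real {α : Type*} [MeasurableSpace α] {μ : Measure α} {f : ℕ → α → ℝ} {F : α → ℝ} {c : ℝ} {C : ℕ → ℝ} (hi : ∀ n, Integrable (f n) μ)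
    (h0 : ∀ n x, 0 ≤ f n x) (hF0 : ∀ x, 0 ≤ F x) (hC : ∀ n, ∫ x, f n x ∂μ ≤ C n)
    (hc : Tendsto C atTop (nhds c)) (hl : ∀ᵐ x ∂μ, Tendsto (fun n => f n x) atTop (nhds (F x))) :
    Integrable F μ ∧ ∫ x, F x ∂μ ≤ c := by
  have hm : AEStronglyMeasurable F μ := aestronglyMeasurable_of_tendsto_ae atTop (fun n => (hi n).1) hl
  have hc0 : 0 ≤ c := ge_of_tendsto' hc fun n => (integral_nonneg (h0 n)).trans (hC n)
  have key : ∫⁻ x, ENNReal.ofReal (F x) ∂μ ≤ ENNReal.ofReal c := by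
    calc ∫⁻ x, ENNReal.ofReal (F x) ∂μ = ∫⁻ x, liminf (fun n => ENNReal.ofReal (f n x)) atTop ∂μ := by
          apply lintegral_congr_ae
          filter_upwards [hl] with x hx
          exact ((ENNReal.continuous_ofReal.tendsto _).comp hx).liminf_eq.symm
    _ ≤ liminf (fun n => ∫⁻ x, ENNReal.ofReal (f n x) ∂μ) atTop :=
          lintegral_liminf_le' fun n => (hi n).1.aemeasurable.ennreal_ofReal
    _ ≤ liminf (fun n => ENNReal.ofReal (C n)) atTop := by
          refine liminf_le_liminf (Eventually.of_forall fun n => ?_)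
          rw [← ofReal_integral_eq_lintegral_ofReal (hi n) (Eventually.of_forall (h0 n))]
          exact ENNReal.ofReal_le_ofReal (hC n)
    _ = ENNReal.ofReal c := ((ENNReal.continuous_ofReal.tendsto _).comp hc).liminf_eq
  have hFi : Integrable F μ := ⟨hm, (hasFiniteIntegral_iff_ofReal (Eventually.of_forall hF0)).mpr
    (key.trans_lt ENNReal.ofReal_lt_top)⟩
  refine ⟨hFi, ?_⟩
  rw [← ofReal_integral_eq_lintegral_ofReal hFi (Eventually.of_forall hF0)] at key
  exact (ENNReal.ofReal_le_ofReal_iff hc0).mp key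

theorem scheffe_set {μ : Measure ℝ} {f : ℕ → ℝ → ℝ} {F : ℝ → ℝ} (hi : ∀ n, Integrable (f n) μ)
    (h0 : ∀ n x, 0 ≤ f n x) (hF0 : ∀ x, 0 ≤ F x) (hF : Integrable F μ) (hC : ∀ n, ∫ x, f n x ∂μ ≤ ∫ x, F x ∂μ)
    (hl : ∀ᵐ x ∂μ, Tendsto (fun n => f n x) atTop (nhds (F x))) :
    ∃ ε : ℕ → ℝ, Tendsto ε atTop (nhds 0) ∧ ∀ A, MeasurableSet A → ∀ n, ∫ x in A, f n x ∂μ ≤ ∫ x in A, F x ∂μ + ε n := by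
  have hpi : ∀ n, Integrable (fun x => max (F x - f n x) 0) μ := fun n => (hF.sub (hi n)).pos_part
  refine ⟨fun n => ∫ x, max (F x - f n x) 0 ∂μ, ?_, ?_⟩
  · have := tendsto_integral_of_dominated_convergence (μ := μ) (F := fun n x => max (F x - f n x) 0) (f := fun _ => 0) F
      (fun n => (hpi n).1) hF ?_ ?_
    · simpa using this
    · intro n
      filter_upwards with x
      rw [Real.norm_of_nonneg (le_max_right _ _)]
      exact max_le (by linarith [h0 n x]) (hF0 x)
    · filter_upwards [hl] with x hx
      have := (hx.const_sub (F x)).max (tendsto_const_nhds (x := (0:ℝ)))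
      simpa using this
  · intro A hA n
    have h1 : ∫ x in A, (f n x - F x) ∂μ ≤ ∫ x in A, max (f n x - F x) 0 ∂μ :=
      setIntegral_mono ((hi n).sub hF).integrableOn ((hi n).sub hF).pos_part.integrableOn fun x => le_max_left _ _
    have h2 : ∫ x in A, max (f n x - F x) 0 ∂μ ≤ ∫ x, max (f n x - F x) 0 ∂μ :=
      setIntegral_le_integral ((hi n).sub hF).pos_part (Eventually.of_forall fun x => le_max_right _ _)
    have h3 : ∫ x, max (f n x - F x) 0 ∂μ = ∫ x, ((f n x - F x) + max (F x - f n x) 0) ∂μ := by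
      congr 1; ext x
      rcases le_total (f n x) (F x) with h | h
      · rw [max_eq_right (by linarith), max_eq_left (by linarith)]; ring
      · rw [max_eq_left (by linarith), max_eq_right (by linarith)]; ring
    rw [integral_add (f := fun x => f n x - F x) ((hi n).sub hF) (hpi n), integral_sub (hi n) hF] at h3
    beta_reduce
    rw [integral_sub (hi n).integrableOn hF.integrableOn] at h1
    linarith [hC n]

noncomputable def rr (n : ℕ) : ℝ := 1 - 1 / ((n : ℝ) + 1)
theorem rr_nonneg (n : ℕ) : 0 ≤ rr n := by
  unfold rr
  rw [sub_nonneg, div_le_one (by positivity)]; linarith [(Nat.cast_nonneg n : (0:ℝ) ≤ n)]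
theorem rr_lt (n : ℕ) : rr n < 1 := by
  unfold rr
  have : (0:ℝ) < 1 / ((n : ℝ) + 1) := by positivity
  linarith
theorem rr_tendsto' : Tendsto rr atTop (nhds 1) := by
  have := (tendsto_one_div_add_atTop_nhds_zero_nat (𝕜 := ℝ)).const_sub 1
  rw [sub_zero] at this
  exact this
theorem rr_tendsto : Tendsto rr atTop (nhdsWithin 1 (Iio 1)) :=
  tendsto_nhdsWithin_of_tendsto_nhds_of_eventually_within _ rr_tendsto' (Eventually.of_forall rr_lt)

structure Setup (D : JordanDomain) (ψ : ℂ → ℂ) (g : ℝ → ℂ) (σ h : ℝ → ℝ) : Prop extends DiskParam D ψ g σ where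
  ne : ∀ w ∈ ball (0:ℂ) 1, deriv ψ w ≠ 0
  hint : Integrable h mu0
  hlim : ∀ᵐ θ : ℝ ∂mu0, Tendsto (fun r : ℝ => Real.log ‖deriv ψ ((r : ℂ) * exp ((θ : ℂ) * I))‖)
          (nhdsWithin 1 (Iio 1)) (nhds (h θ))
  hpois : ∀ w ∈ ball (0 : ℂ) 1, Real.log ‖deriv ψ w‖ =
          (1 / (2 * Real.pi)) * ∫ θ, ((1 - ‖w‖ ^ 2) / ‖exp ((θ : ℂ) * I) - w‖ ^ 2) * h θ ∂mu0

theorem setup_exists (D : JordanDomain) (hS : IsSmirnovDomain D.G) {φ : ℂ → ℂ} {ζ : ℂ}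
    (hφ : ConformalOnto D.G φ ζ) (hφc : ContinuousOn φ (closure D.G)) (hζ : ζ ∈ D.G) :
    ∃ ψ g σ u h, Setup D ψ g σ h ∧ ‖u‖ = 1 ∧ (∀ w ∈ closedBall (0:ℂ) 1, φ (ψ w) = u * w) ∧
      ψ 0 = ζ := by
  obtain ⟨ψ, g, σ, u, P, hu, hφψ, h0⟩ := exists_diskParam D hφ hφc hζ
  obtain ⟨h, h1, h2, h3⟩ := hS ψ (fun w hw => P.diff.differentiableAt (isOpen_ball.mem_nhds hw)) P.bij
  refine ⟨ψ, g, σ, u, h, ⟨P, ?_, ?_, h2, ?_⟩, hu, hφψ, h0⟩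
  · intro w hw hz
    have e1 : HasDerivAt ψ (deriv ψ w) w := (P.diff.differentiableAt (isOpen_ball.mem_nhds hw)).hasDerivAt
    have e2 := (hφ.differentiable _ (P.bij.mapsTo hw)).hasDerivAt.comp w e1
    have e3 : HasDerivAt (fun w => u * w) u w := by simpa using (hasDerivAt_id w).const_mul u
    have e4 : HasDerivAt (φ ∘ ψ) u w := by
      apply e3.congr_of_eventuallyEq
      filter_upwards [isOpen_ball.mem_nhds hw] with y hy
      exact hφψ y (ball_subset_closedBall hy)
    have := e2.unique e4
    rw [hz, mul_zero] at this
    rw [← this] at hu; simp at hu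
  · rw [intervalIntegrable_iff_integrableOn_Ioc_of_le (by have := Real.pi_pos; positivity)] at h1
    exact h1
  · intro w hw
    rw [h3 w hw, mu0_int]

theorem poisson_norm {w : ℂ} (hw : w ∈ ball (0:ℂ) 1) :
    ∫ θ, ((1 - ‖w‖ ^ 2) / ‖exp ((θ : ℂ) * I) - w‖ ^ 2) ∂mu0 = 2 * Real.pi := by
  have h := DiffContOnCl.circleAverage_poissonKernel_smul (f := fun _ => (1:ℂ)) (c := 0) (R := 1) (w := w)
    diffContOnCl_const hw
  rw [Real.circleAverage] at h
  have h1 : ∀ θ : ℝ, (poissonKernel 0 w • fun _ => (1:ℂ)) (circleMap 0 1 θ) =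
      (((1 - ‖w‖ ^ 2) / ‖exp ((θ : ℂ) * I) - w‖ ^ 2 : ℝ) : ℂ) := by
    intro θ
    simp [poissonKernel, circleMap, Complex.norm_exp_ofReal_mul_I]
  simp_rw [h1] at h
  rw [intervalIntegral.integral_ofReal, Complex.real_smul, ← Complex.ofReal_mul, mu0_int] at h
  have h2 := Complex.ofReal_injective (h.trans Complex.ofReal_one.symm)
  have := Real.pi_pos
  field_simp at h2
  linarith

theorem poisson_cont {w : ℂ} (hw : w ∈ ball (0:ℂ) 1) :
    Continuous fun θ : ℝ => (1 - ‖w‖ ^ 2) / ‖exp ((θ : ℂ) * I) - w‖ ^ 2 := by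
  refine Continuous.div (by fun_prop) (by fun_prop) fun θ => ?_
  have : exp ((θ : ℂ) * I) - w ≠ 0 := by
    intro h
    rw [sub_eq_zero] at h
    rw [← h] at hw
    simp [Complex.norm_exp_ofReal_mul_I] at hw
  positivity

theorem poisson_pos {w : ℂ} (hw : w ∈ ball (0:ℂ) 1) (θ : ℝ) :
    0 ≤ (1 - ‖w‖ ^ 2) / ‖exp ((θ : ℂ) * I) - w‖ ^ 2 := by
  have : ‖w‖ < 1 := by simpa using hw
  have : 0 ≤ 1 - ‖w‖ ^ 2 := by nlinarith [norm_nonneg w]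
  positivity

theorem poisson_bdd {w : ℂ} (hw : w ∈ ball (0:ℂ) 1) (θ : ℝ) :
    (1 - ‖w‖ ^ 2) / ‖exp ((θ : ℂ) * I) - w‖ ^ 2 ≤ 2 / (1 - ‖w‖) := by
  have h1 : ‖w‖ < 1 := by simpa using hw
  have h2 : 1 - ‖w‖ ≤ ‖exp ((θ : ℂ) * I) - w‖ := by
    have := norm_sub_norm_le (exp ((θ : ℂ) * I)) w
    rwa [Complex.norm_exp_ofReal_mul_I] at this
  have h0 := norm_nonneg w
  have h3 : 0 < 1 - ‖w‖ := by linarith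
  have h4 : 0 < ‖exp ((θ : ℂ) * I) - w‖ := by linarith
  rw [div_le_div_iff₀ (by positivity) h3]
  nlinarith [mul_le_mul h2 h2 h3.le (norm_nonneg _)]

theorem poisson_int {w : ℂ} (hw : w ∈ ball (0:ℂ) 1) {f : ℝ → ℝ} (hf : Integrable f mu0) :
    Integrable (fun θ : ℝ => ((1 - ‖w‖ ^ 2) / ‖exp ((θ : ℂ) * I) - w‖ ^ 2) * f θ) mu0 := by
  refine hf.bdd_mul (c := 2 / (1 - ‖w‖)) (poisson_cont hw).aestronglyMeasurable ?_
  filter_upwards with θ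
  rw [Real.norm_of_nonneg (poisson_pos hw θ)]
  exact poisson_bdd hw θ

section
variable {D : JordanDomain} {ψ : ℂ → ℂ} {g : ℝ → ℂ} {σ h : ℝ → ℝ}

theorem Setup.lim_norm (P : Setup D ψ g σ h) : ∀ᵐ θ : ℝ ∂mu0,
    Tendsto (fun r : ℝ => ‖deriv ψ ((r : ℂ) * exp ((θ : ℂ) * I))‖) (nhdsWithin 1 (Iio 1)) (nhds (Real.exp (h θ))) := by
  filter_upwards [P.hlim] with θ hθ
  refine ((Real.continuous_exp.tendsto _).comp hθ).congr' ?_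
  have h1 : ∀ᶠ r : ℝ in nhdsWithin 1 (Iio 1), r ∈ Ioo (0:ℝ) 1 := Ioo_mem_nhdsLT zero_lt_one
  filter_upwards [h1] with r hr
  exact Real.exp_log (norm_pos_iff.mpr (P.ne _ (circ_mem hr.1.le hr.2 θ)))

theorem Setup.fn_cont (P : Setup D ψ g σ h) {r : ℝ} (hr0 : 0 ≤ r) (hr : r < 1) :
    Continuous fun θ : ℝ => ‖deriv ψ (r * exp (θ * I))‖ :=
  (circ_comp_cont P.deriv_cont hr0 hr).norm

theorem Setup.exp_int (P : Setup D ψ g σ h) : Integrable (fun θ => Real.exp (h θ)) mu0 ∧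
    ∫ θ, Real.exp (h θ) ∂mu0 ≤ D.l := by
  refine fatou_real (f := fun n (θ : ℝ) => ‖deriv ψ (rr n * exp (θ * I))‖ * rr n) (C := fun _ => D.l) ?_ ?_ ?_ ?_
    tendsto_const_nhds ?_
  · exact fun n => mu0_cont_int ((P.fn_cont (rr_nonneg n) (rr_lt n)).mul_const _)
  · exact fun n θ => mul_nonneg (norm_nonneg _) (rr_nonneg n)
  · exact fun θ => (Real.exp_pos _).le
  · intro n
    have := circ_bound P.toDiskParam (Q := id) (q := fun _ => 1) (fun z => hasDerivAt_id z) continuous_const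
      (rr_nonneg n) (rr_lt n)
    simp only [norm_one, one_mul, intervalIntegral.integral_const, sub_zero, smul_eq_mul, mul_one] at this
    rw [mu0_int] at this
    exact this
  · filter_upwards [P.lim_norm] with θ hθ
    simpa using (hθ.comp rr_tendsto).mul rr_tendsto'

theorem Setup.jensen (P : Setup D ψ g σ h) {w : ℂ} (hw : w ∈ ball (0:ℂ) 1) : ‖deriv ψ w‖ ≤
    (1 / (2 * Real.pi)) * ∫ θ, ((1 - ‖w‖ ^ 2) / ‖exp ((θ : ℂ) * I) - w‖ ^ 2) * Real.exp (h θ) ∂mu0 := by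
  set m := Real.log ‖deriv ψ w‖ with hm
  have hem : ‖deriv ψ w‖ = Real.exp m := (Real.exp_log (norm_pos_iff.mpr (P.ne w hw))).symm
  have hpi := Real.pi_pos
  have h1 := P.hpois w hw
  have h2 := poisson_norm hw
  set p : ℝ → ℝ := fun θ => (1 - ‖w‖ ^ 2) / ‖exp ((θ : ℂ) * I) - w‖ ^ 2 with hp
  have ip : Integrable p mu0 := mu0_cont_int (poisson_cont hw)
  have iph : Integrable (fun θ => p θ * h θ) mu0 := poisson_int hw P.hint
  have ipe : Integrable (fun θ => p θ * Real.exp (h θ)) mu0 := poisson_int hw P.exp_int.1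
  have h3 : ∫ θ, (Real.exp m * (1 - m) * p θ + Real.exp m * (p θ * h θ)) ∂mu0 ≤ ∫ θ, p θ * Real.exp (h θ) ∂mu0 := by
    refine integral_mono ((ip.const_mul _).add (iph.const_mul _)) ipe fun θ => ?_
    have h4 : Real.exp m * (1 + (h θ - m)) ≤ Real.exp (h θ) := by
      have := Real.add_one_le_exp (h θ - m)
      have h5 : Real.exp (h θ) = Real.exp m * Real.exp (h θ - m) := by rw [← Real.exp_add]; ring_nf
      rw [h5]
      exact mul_le_mul_of_nonneg_left (by linarith) (Real.exp_pos m).le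
    have := mul_le_mul_of_nonneg_left h4 (poisson_pos hw θ)
    simp only [hp] at this ⊢
    linarith
  rw [integral_add (ip.const_mul _) (iph.const_mul _), integral_const_mul, integral_const_mul, h2] at h3
  have h6 : ∫ θ, p θ * h θ ∂mu0 = 2 * Real.pi * m := by
    rw [hm, h1, ← mul_assoc, mul_one_div_cancel (by positivity), one_mul]
  rw [h6] at h3
  rw [hem, one_div, ← div_eq_inv_mul, le_div_iff₀ (by positivity)]
  linarith

theorem Setup.mean_le (P : Setup D ψ g σ h) {r : ℝ} (hr0 : 0 ≤ r) (hr : r < 1) :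
    ∫ θ, ‖deriv ψ (r * exp (θ * I))‖ ∂mu0 ≤ ∫ θ, Real.exp (h θ) ∂mu0 := by
  have hpi := Real.pi_pos
  set k : ℝ → ℝ → ℝ := fun α θ => (1 - ‖(r:ℂ) * exp (α * I)‖ ^ 2) / ‖exp ((θ : ℂ) * I) - r * exp (α * I)‖ ^ 2 with hk
  have hsym : ∀ α θ, k α θ = k θ α := by
    intro α θ
    have e1 : ‖exp ((θ : ℂ) * I) - r * exp (α * I)‖ = ‖exp ((α : ℂ) * I) - r * exp (θ * I)‖ := by
      have a1 : ∀ x y : ℝ, ‖exp ((x : ℂ) * I) - r * exp (y * I)‖ = ‖1 - r * exp ((y - x : ℝ) * I)‖ := by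
        intro x y
        have : exp ((x : ℂ) * I) - r * exp (y * I) = exp (x * I) * (1 - r * exp ((y - x : ℝ) * I)) := by
          rw [mul_sub, mul_one, mul_left_comm, ← Complex.exp_add]; congr 3; push_cast; ring
        rw [this, norm_mul, Complex.norm_exp_ofReal_mul_I, one_mul]
      rw [a1, a1, ← Complex.norm_conj]
      congr 1
      simp only [map_sub, map_one, map_mul, Complex.conj_ofReal, ← Complex.exp_conj, Complex.conj_I]
      congr 3; push_cast; ring
    simp only [hk]
    rw [e1]; simp [Complex.norm_exp_ofReal_mul_I]
  have hkc : Continuous (Function.uncurry k) := by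
    simp only [hk]
    refine Continuous.div (by fun_prop) (by fun_prop) fun x => ?_
    have : exp ((x.2 : ℂ) * I) - r * exp (x.1 * I) ≠ 0 := by
      intro h
      rw [sub_eq_zero] at h
      have := congrArg norm h
      simp [Complex.norm_exp_ofReal_mul_I, abs_of_nonneg hr0] at this
      linarith
    positivity
  have hprod : Integrable (Function.uncurry fun α θ => k α θ * Real.exp (h θ)) (mu0.prod mu0) := by
    have h1 : Integrable (fun x : ℝ × ℝ => (1:ℝ) * Real.exp (h x.2)) (mu0.prod mu0) :=
      (integrable_const (1:ℝ)).mul_prod P.exp_int.1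
    simp only [one_mul] at h1
    refine h1.bdd_mul (c := 2 / (1 - r)) hkc.aestronglyMeasurable ?_
    filter_upwards with x
    have := poisson_bdd (circ_mem hr0 hr x.1) x.2
    have h0 := poisson_pos (circ_mem hr0 hr x.1) x.2
    simp only [hk]
    rw [Real.norm_of_nonneg h0]
    refine this.trans (le_of_eq ?_)
    simp [Complex.norm_exp_ofReal_mul_I, abs_of_nonneg hr0]
  calc ∫ θ, ‖deriv ψ (r * exp (θ * I))‖ ∂mu0 ≤ ∫ α, (1 / (2 * Real.pi)) * ∫ θ, k α θ * Real.exp (h θ) ∂mu0 ∂mu0 := by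
        refine integral_mono (mu0_cont_int (P.fn_cont hr0 hr)) (hprod.integral_prod_left.const_mul _) fun α => ?_
        exact P.jensen (circ_mem hr0 hr α)
  _ = (1 / (2 * Real.pi)) * ∫ θ, ∫ α, k α θ * Real.exp (h θ) ∂mu0 ∂mu0 := by
        rw [integral_const_mul, integral_integral_swap hprod]
  _ = _ := by
        have : ∀ θ, ∫ α, k α θ * Real.exp (h θ) ∂mu0 = 2 * Real.pi * Real.exp (h θ) := by
          intro θ
          simp_rw [hsym _ θ]
          rw [integral_mul_const]
          rw [poisson_norm (circ_mem hr0 hr θ)]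
        simp_rw [this]
        rw [integral_const_mul]; field_simp
end

section
variable {D : JordanDomain} {ψ : ℂ → ℂ} {g : ℝ → ℂ} {σ h : ℝ → ℝ}

theorem mu0_restrict {α β : ℝ} (h0 : 0 ≤ α) (h2 : β ≤ 2 * Real.pi) :
    mu0.restrict (Ioc α β) = volume.restrict (Ioc α β) := by
  rw [Measure.restrict_restrict measurableSet_Ioc, inter_eq_left.mpr (Ioc_subset_Ioc h0 h2)]

theorem bdry_tendsto (P : DiskParam D ψ g σ) (θ : ℝ) :
    Tendsto (fun n => ψ (rr n * exp (θ * I))) atTop (nhds (ψ (exp (θ * I)))) := by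
  have h1 : ContinuousWithinAt ψ (closedBall 0 1) (exp (θ * I)) :=
    P.cont _ (by simp [Complex.norm_exp_ofReal_mul_I])
  refine h1.tendsto.comp (tendsto_nhdsWithin_of_tendsto_nhds_of_eventually_within _ ?_ ?_)
  · have : Tendsto (fun n => ((rr n : ℝ) : ℂ)) atTop (nhds ((1:ℝ) : ℂ)) :=
      (Complex.continuous_ofReal.tendsto 1).comp rr_tendsto'
    simpa using this.mul_const (exp (θ * I))
  · exact Eventually.of_forall fun n => ball_subset_closedBall (circ_mem (rr_nonneg n) (rr_lt n) θ)

theorem Setup.arc_bound (P : Setup D ψ g σ h) {α β : ℝ} (h0 : 0 ≤ α) (hab : α ≤ β) (h2 : β ≤ 2 * Real.pi) :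
    ‖ψ (exp (β * I)) - ψ (exp (α * I))‖ ≤ ∫ θ in α..β, Real.exp (h θ) := by
  obtain ⟨ε, hε, hA⟩ := scheffe_set (μ := mu0) (f := fun n (θ:ℝ) => ‖deriv ψ (rr n * exp (θ * I))‖)
    (F := fun θ => Real.exp (h θ)) (fun n => mu0_cont_int (P.fn_cont (rr_nonneg n) (rr_lt n)))
    (fun n θ => norm_nonneg _) (fun θ => (Real.exp_pos _).le) P.exp_int.1
    (fun n => P.mean_le (rr_nonneg n) (rr_lt n)) (by
      filter_upwards [P.lim_norm] with θ hθ using hθ.comp rr_tendsto)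
  have hl := ((bdry_tendsto P.toDiskParam β).sub (bdry_tendsto P.toDiskParam α)).norm
  have hr := hε.const_add (∫ θ in α..β, Real.exp (h θ))
  rw [add_zero] at hr
  refine le_of_tendsto_of_tendsto' hl hr fun n => ?_
  have h3 := hA (Ioc α β) measurableSet_Ioc n
  rw [mu0_restrict h0 h2, ← intervalIntegral.integral_of_le hab, ← intervalIntegral.integral_of_le hab] at h3
  refine le_trans ?_ h3
  have hd := circ_hasDerivAt (F := ψ) (F' := deriv ψ)
    (fun z hz => (P.diff.differentiableAt (isOpen_ball.mem_nhds hz)).hasDerivAt) (rr_nonneg n) (rr_lt n)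
  have hc1 := circ_comp_cont P.deriv_cont (rr_nonneg n) (rr_lt n)
  have hc : Continuous fun θ : ℝ => deriv ψ (rr n * exp (θ * I)) * (rr n * (exp (θ * I) * I)) :=
    hc1.mul (by fun_prop)
  rw [← intervalIntegral.integral_eq_sub_of_hasDerivAt (fun θ _ => hd θ) (hc.intervalIntegrable _ _)]
  refine (intervalIntegral.norm_integral_le_integral_norm hab).trans ?_
  refine intervalIntegral.integral_mono_on hab (hc.norm.intervalIntegrable _ _) (hc1.norm.intervalIntegrable _ _) ?_
  intro θ _
  rw [norm_mul]
  refine mul_le_of_le_one_right (norm_nonneg _) ?_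
  simp [Complex.norm_exp_ofReal_mul_I, abs_of_nonneg (rr_nonneg n), (rr_lt n).le]

theorem DiskParam.g_inj (P : DiskParam D ψ g σ) {s t : ℝ} (hst : |s - t| < D.l) (he : g s = g t) : s = t := by
  rcases P.g_eq with hg | hg
  · rw [hg, hg] at he; exact D.inj_of_lt hst he
  · rw [hg, hg] at he
    have := D.inj_of_lt (t := -s) (t' := -t) (by rw [← abs_neg]; convert hst using 2; ring) he
    linarith

theorem DiskParam.σ_add_int (P : DiskParam D ψ g σ) (θ : ℝ) (n : ℤ) :
    σ (θ + n * (2 * Real.pi)) = σ θ + n * D.l := by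
  induction n with
  | zero => simp
  | succ n ih =>
    have := P.σ_add (θ + n * (2 * Real.pi))
    push_cast at ih ⊢
    rw [ih] at this
    rw [show θ + ((n:ℝ) + 1) * (2 * Real.pi) = θ + n * (2 * Real.pi) + 2 * Real.pi by ring, this]; ring
  | pred n ih =>
    have := P.σ_add (θ + (-(n:ℝ) - 1) * (2 * Real.pi))
    push_cast at ih ⊢
    rw [show θ + (-(n:ℝ) - 1) * (2 * Real.pi) + 2 * Real.pi = θ + -(n:ℝ) * (2 * Real.pi) by ring, ih] at this
    linarith

theorem DiskParam.σ_surj (P : DiskParam D ψ g σ) : Function.Surjective σ := by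
  intro s
  have h1 : g s ∈ frontier D.G := by
    rcases P.g_eq with hg | hg <;> rw [hg] <;> exact D.γ_mem _
  obtain ⟨w, hw, hws⟩ := P.bijs.surjOn h1
  obtain ⟨θ, rfl⟩ := (Complex.norm_eq_one_iff w).mp (by simpa using hw)
  rw [P.bdry] at hws
  set n := ⌊(s - σ θ) / D.l⌋ with hn
  have a1 := Int.floor_le ((s - σ θ) / D.l)
  have a2 := Int.lt_floor_add_one ((s - σ θ) / D.l)
  rw [le_div_iff₀ D.l_pos] at a1
  rw [div_lt_iff₀ D.l_pos] at a2
  refine ⟨θ + n * (2 * Real.pi), ?_⟩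
  rw [P.σ_add_int]
  apply P.g_inj
  · rw [abs_lt]; constructor <;> linarith [D.l_pos]
  · rw [← hws, P.g_per.int_mul n]

theorem eVar_le {f : ℝ → ℂ} {M : ℝ → ℝ} {a b : ℝ} (hab : a ≤ b)
    (hf : ∀ x y, a ≤ x → x ≤ y → y ≤ b → ‖f y - f x‖ ≤ M y - M x) :
    eVariationOn f (Icc a b) ≤ ENNReal.ofReal (M b - M a) := by
  have hM : MonotoneOn M (Icc a b) := by
    intro x hx y hy hxy
    have := hf x y hx.1 hxy hy.2
    linarith [norm_nonneg (f y - f x)]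
  have h1 := hM.eVariationOn_eq (left_mem_Icc.mpr hab) (right_mem_Icc.mpr hab)
  rw [inter_self] at h1
  rw [← h1]
  refine iSup_le fun p => ?_
  refine le_trans ?_ (le_iSup _ p)
  refine Finset.sum_le_sum fun i _ => ?_
  have h2 := p.2.2.2 i
  have h3 := p.2.2.2 (i + 1)
  have h4 := hf _ _ h2.1 (p.2.2.1 (Nat.le_succ i)) h3.2
  rw [edist_dist, edist_dist, dist_eq_norm, Real.dist_eq]
  exact ENNReal.ofReal_le_ofReal (h4.trans (le_abs_self _))

theorem Setup.exp_ii (P : Setup D ψ g σ h) {α β : ℝ} (h0 : 0 ≤ α) (hab : α ≤ β) (h2 : β ≤ 2 * Real.pi) :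
    IntervalIntegrable (fun θ => Real.exp (h θ)) volume α β := by
  rw [intervalIntegrable_iff_integrableOn_Ioc_of_le hab, IntegrableOn, ← mu0_restrict h0 h2]
  exact P.exp_int.1.restrict

theorem Setup.σ_le (P : Setup D ψ g σ h) {α β : ℝ} (h0 : 0 ≤ α) (hab : α ≤ β) (h2 : β ≤ 2 * Real.pi) :
    σ β - σ α ≤ ∫ θ in α..β, Real.exp (h θ) := by
  have hl : σ (2 * Real.pi) = D.l := by
    have := P.σ_add 0; rwa [zero_add, P.σ_zero, zero_add] at this
  have h1 : σ '' Icc α β = Icc (σ α) (σ β) := by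
    apply Subset.antisymm
    · rintro _ ⟨x, hx, rfl⟩; exact ⟨P.σ_mono hx.1, P.σ_mono hx.2⟩
    · exact intermediate_value_Icc hab (P.σ_mono.continuous_of_surjective P.σ_surj).continuousOn
  have h3 := eVariationOn.comp_eq_of_monotoneOn g σ (P.σ_mono.monotoneOn (Icc α β))
  have hσ0 : 0 ≤ σ α := P.σ_zero ▸ P.σ_mono h0
  have hσ1 : σ β ≤ D.l := hl ▸ P.σ_mono h2
  rw [h1, P.g_var _ _ (P.σ_mono hab) (by linarith)] at h3
  have h4 := eVar_le (f := g ∘ σ) (M := fun x => ∫ θ in α..x, Real.exp (h θ)) hab (by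
    intro x y hx hxy hy
    rw [intervalIntegral.integral_interval_sub_left (P.exp_ii h0 (hx.trans hxy) (hy.trans h2)) (P.exp_ii h0 hx (hxy.trans (hy.trans h2)))]
    simp only [Function.comp, ← P.bdry]
    exact P.arc_bound (h0.trans hx) hxy (hy.trans h2))
  rw [h3, intervalIntegral.integral_same, sub_zero] at h4
  refine (ENNReal.ofReal_le_ofReal_iff ?_).mp h4
  exact intervalIntegral.integral_nonneg hab fun _ _ => (Real.exp_pos _).le

theorem Setup.σ_eq (P : Setup D ψ g σ h) {β : ℝ} (hb : 0 ≤ β) (h2 : β ≤ 2 * Real.pi) :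
    σ β = ∫ θ in (0:ℝ)..β, Real.exp (h θ) := by
  have hl : σ (2 * Real.pi) = D.l := by
    have := P.σ_add 0; rwa [zero_add, P.σ_zero, zero_add] at this
  have h1 := P.σ_le le_rfl hb h2
  have h3 := P.σ_le hb h2 le_rfl
  have h4 := intervalIntegral.integral_add_adjacent_intervals (P.exp_ii le_rfl hb h2) (P.exp_ii hb h2 le_rfl)
  have h5 := P.exp_int.2
  rw [← mu0_int] at h5
  rw [P.σ_zero] at h1
  linarith

theorem Setup.σ_strict (P : Setup D ψ g σ h) : StrictMonoOn σ (Icc 0 (2 * Real.pi)) := by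
  intro x hx y hy hxy
  rw [P.σ_eq hx.1 hx.2, P.σ_eq hy.1 hy.2, ← intervalIntegral.integral_add_adjacent_intervals
    (P.exp_ii le_rfl hx.1 hx.2) (P.exp_ii hx.1 hxy.le hy.2)]
  have := intervalIntegral.intervalIntegral_pos_of_pos (P.exp_ii hx.1 hxy.le hy.2) (fun _ => Real.exp_pos _) hxy
  linarith

noncomputable def muE (h : ℝ → ℝ) : Measure ℝ := mu0.withDensity fun θ => ENNReal.ofReal (Real.exp (h θ))

theorem Setup.σ_cont (P : Setup D ψ g σ h) : Continuous σ := P.σ_mono.continuous_of_surjective P.σ_surj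

theorem Setup.σ_two_pi (P : Setup D ψ g σ h) : σ (2 * Real.pi) = D.l := by
  have := P.σ_add 0; rwa [zero_add, P.σ_zero, zero_add] at this

theorem Setup.map_eq (P : Setup D ψ g σ h) : (muE h).map σ = volume.restrict (Ioc 0 D.l) := by
  have hpi := Real.pi_pos
  have hl := P.σ_two_pi
  symm
  apply Measure.ext_of_Iic
  intro a
  rw [Measure.map_apply P.σ_cont.measurable measurableSet_Iic, Measure.restrict_apply measurableSet_Iic, muE,
    withDensity_apply _ (P.σ_cont.measurable measurableSet_Iic),
    Measure.restrict_restrict (P.σ_cont.measurable measurableSet_Iic)]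
  have key : ∀ β ∈ Icc 0 (2 * Real.pi), ∫⁻ θ in Ioc 0 β, ENNReal.ofReal (Real.exp (h θ)) = ENNReal.ofReal (σ β) := by
    intro β hβ
    rw [P.σ_eq hβ.1 hβ.2, intervalIntegral.integral_of_le hβ.1]
    refine (ofReal_integral_eq_lintegral_ofReal ?_ (Eventually.of_forall fun _ => (Real.exp_pos _).le)).symm
    exact (intervalIntegrable_iff_integrableOn_Ioc_of_le hβ.1).mp (P.exp_ii le_rfl hβ.1 hβ.2)
  rcases lt_or_ge a 0 with ha | ha
  · have e1 : Iic a ∩ Ioc 0 D.l = ∅ := by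
      ext x; simp only [mem_inter_iff, mem_Iic, mem_Ioc, mem_empty_iff_false, iff_false]; intro hx; linarith [hx.2.1]
    have e2 : σ ⁻¹' Iic a ∩ Ioc 0 (2 * Real.pi) = ∅ := by
      ext x; simp only [mem_inter_iff, mem_preimage, mem_Iic, mem_Ioc, mem_empty_iff_false, iff_false]
      intro hx
      have := P.σ_mono hx.2.1.le
      rw [P.σ_zero] at this; linarith [hx.1]
    rw [e1, e2]; simp
  obtain ⟨β, hβ, hβa⟩ : ∃ β ∈ Icc 0 (2 * Real.pi), σ β = min a D.l := by
    have := intermediate_value_Icc (by positivity : (0:ℝ) ≤ 2 * Real.pi) P.σ_cont.continuousOn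
    rw [P.σ_zero, hl] at this
    exact this ⟨le_min ha D.l_pos.le, min_le_right _ _⟩
  have e1 : Iic a ∩ Ioc 0 D.l = Ioc 0 (min a D.l) := by
    ext x; simp only [mem_inter_iff, mem_Iic, mem_Ioc, le_min_iff]; tauto
  have e2 : σ ⁻¹' Iic a ∩ Ioc 0 (2 * Real.pi) = Ioc 0 β := by
    ext x
    simp only [mem_inter_iff, mem_preimage, mem_Iic, mem_Ioc]
    constructor
    · rintro ⟨h1, h2, h3⟩
      refine ⟨h2, (P.σ_strict.le_iff_le ⟨h2.le, h3⟩ hβ).mp ?_⟩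
      rw [hβa, le_min_iff]
      exact ⟨h1, hl ▸ P.σ_mono h3⟩
    · rintro ⟨h1, h2⟩
      refine ⟨?_, h1, h2.trans hβ.2⟩
      exact (P.σ_mono h2).trans (hβa ▸ min_le_left _ _)
  rw [e1, e2, key β hβ, hβa, Real.volume_Ioc, sub_zero]

end

theorem trig_unif {F : ℝ → ℝ} (hF : Continuous F) (hp : F 0 = F (2 * Real.pi)) {ε : ℝ} (hε : 0 < ε) :
    ∃ P : Polynomial ℂ, ∀ θ ∈ Ioc 0 (2 * Real.pi), |F θ - (P.eval (exp ((θ:ℝ) * I))).re| ≤ ε := by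
  have : Fact (0 < 2 * Real.pi) := ⟨by have := Real.pi_pos; positivity⟩
  have hFc : Continuous fun θ => (F θ : ℂ) := Complex.continuous_ofReal.comp hF
  let f : C(AddCircle (2 * Real.pi), ℂ) := ⟨AddCircle.liftIco (2 * Real.pi) 0 fun θ => (F θ : ℂ),
    AddCircle.liftIco_continuous (by simp [hp]) hFc.continuousOn⟩
  have hf : ∀ θ ∈ Ioc 0 (2 * Real.pi), f (θ : ℝ) = F θ := by
    intro θ hθ
    rcases hθ.2.lt_or_eq with h | h
    · exact AddCircle.liftIco_coe_apply (a := (0:ℝ)) (p := 2 * Real.pi) (x := θ) (f := fun θ => (F θ : ℂ)) (by rw [zero_add]; exact ⟨hθ.1.le, h⟩)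
    · rw [h, AddCircle.coe_period, ← AddCircle.coe_zero, ← hp]
      exact AddCircle.liftIco_coe_apply (a := (0:ℝ)) (p := 2 * Real.pi) (x := 0) (f := fun θ => (F θ : ℂ)) (by rw [zero_add]; exact ⟨le_rfl, this.out⟩)
  have hm : f ∈ (Submodule.span ℂ (Set.range (fourier (T := 2 * Real.pi)))).topologicalClosure := by
    rw [span_fourier_closure_eq_top]; trivial
  obtain ⟨t, ht, htd⟩ := Metric.mem_closure_iff.mp hm ε hε
  have key : ∃ P Q : Polynomial ℂ, ∀ θ : ℝ, t (θ : AddCircle (2 * Real.pi)) =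
      P.eval (exp (θ * I)) + (starRingEnd ℂ) (Q.eval (exp (θ * I))) := by
    refine Submodule.span_induction (p := fun t _ => ∃ P Q : Polynomial ℂ, ∀ θ : ℝ, t (θ : AddCircle (2 * Real.pi)) =
      P.eval (exp (θ * I)) + (starRingEnd ℂ) (Q.eval (exp (θ * I)))) ?_ ?_ ?_ ?_ ht
    · rintro _ ⟨n, rfl⟩
      have hpi : (Real.pi : ℂ) ≠ 0 := by exact_mod_cast Real.pi_ne_zero
      have e : ∀ θ : ℝ, 2 * (Real.pi : ℂ) * I * n * θ / ((2 * Real.pi : ℝ) : ℂ) = n * (θ * I) := by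
        intro θ; push_cast; field_simp
      rcases Int.eq_nat_or_neg n with ⟨m, rfl | rfl⟩
      · refine ⟨Polynomial.X ^ m, 0, fun θ => ?_⟩
        rw [fourier_coe_apply, e]
        simp [← Complex.exp_nat_mul]
      · refine ⟨0, Polynomial.X ^ m, fun θ => ?_⟩
        rw [fourier_coe_apply, e]
        simp [← Complex.exp_nat_mul, ← Complex.exp_conj]
    · exact ⟨0, 0, by simp⟩
    · rintro x y _ _ ⟨P, Q, h1⟩ ⟨P', Q', h2⟩
      refine ⟨P + P', Q + Q', fun θ => ?_⟩
      simp only [ContinuousMap.add_apply, h1, h2, Polynomial.eval_add, map_add]; ring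
    · rintro a x _ ⟨P, Q, h1⟩
      refine ⟨Polynomial.C a * P, Polynomial.C ((starRingEnd ℂ) a) * Q, fun θ => ?_⟩
      simp only [ContinuousMap.smul_apply, h1, Polynomial.eval_mul, Polynomial.eval_C, map_mul, Complex.conj_conj, smul_eq_mul]; ring
  obtain ⟨P, Q, hPQ⟩ := key
  refine ⟨P + Q, fun θ hθ => ?_⟩
  have h1 := (ContinuousMap.dist_apply_le_dist (f := f) (g := t) (θ : AddCircle (2 * Real.pi))).trans htd.le
  rw [dist_eq_norm, hf θ hθ, hPQ] at h1
  have h2 := (Complex.abs_re_le_norm _).trans h1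
  simpa [Polynomial.eval_add] using h2

theorem clamp_close {N a b : ℝ} (ha : |a| ≤ N) : |a - max (-N) (min b N)| ≤ |a - b| := by
  rw [abs_le] at ha
  rcases max_cases (-N) (min b N) with ⟨h1, h2⟩ | ⟨h1, h2⟩ <;> rcases min_cases b N with ⟨h3, h4⟩ | ⟨h3, h4⟩ <;>
    rw [h1] <;> try rw [h3]
  all_goals rw [abs_le]; constructor <;> (try rw [h3] at h2) <;> (rcases abs_cases (a - b) with ⟨h5, h6⟩ | ⟨h5, h6⟩ <;> linarith)

theorem clamp_abs {N b : ℝ} (hN : 0 ≤ N) : |max (-N) (min b N)| ≤ N := by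
  rw [abs_le]; exact ⟨le_max_left _ _, max_le (by linarith) (min_le_right _ _)⟩

theorem cont_L1 {W v : ℝ → ℝ} (hW : Integrable W mu0) (hW0 : ∀ θ, 0 ≤ W θ) (hv : Integrable (fun θ => v θ * W θ) mu0)
    {ε : ℝ} (hε : 0 < ε) : ∃ F : ℝ → ℝ, Continuous F ∧ Integrable (fun θ => |v θ - F θ| * W θ) mu0 ∧
      ∫ θ, |v θ - F θ| * W θ ∂mu0 ≤ ε := by
  have hm : AEMeasurable (fun θ => ENNReal.ofReal (W θ)) mu0 := hW.1.aemeasurable.ennreal_ofReal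
  have hlt : ∀ᵐ θ ∂mu0, ENNReal.ofReal (W θ) < ⊤ := Eventually.of_forall fun _ => ENNReal.ofReal_lt_top
  set ν := mu0.withDensity fun θ => ENNReal.ofReal (W θ) with hν
  have : IsFiniteMeasure ν := isFiniteMeasure_withDensity_ofReal hW.2
  have e : ∀ f : ℝ → ℝ, (fun θ => (ENNReal.ofReal (W θ)).toReal • f θ) = fun θ => f θ * W θ := by
    intro f; ext θ; rw [ENNReal.toReal_ofReal (hW0 θ), smul_eq_mul, mul_comm]
  have hvν : Integrable v ν := by
    rw [hν, integrable_withDensity_iff_integrable_smul₀' hm hlt, e]; exact hv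
  obtain ⟨F, -, h1, h2, h3⟩ := hvν.exists_hasCompactSupport_integral_sub_le hε
  have h4 : Integrable (fun θ => |v θ - F θ|) ν := (hvν.sub h3).norm
  rw [hν, integrable_withDensity_iff_integrable_smul₀' hm hlt, e] at h4
  rw [hν, integral_withDensity_eq_integral_toReal_smul₀ hm hlt, e] at h1
  exact ⟨F, h2, h4, h1⟩

theorem trig_L1 {W v : ℝ → ℝ} (hW : Integrable W mu0) (hW0 : ∀ θ, 0 ≤ W θ) (hvm : AEStronglyMeasurable v mu0)
    {N : ℝ} (hN : 0 ≤ N) (hv : ∀ θ, |v θ| ≤ N) {ε : ℝ} (hε : 0 < ε) :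
    ∃ P : Polynomial ℂ, (∀ θ ∈ Ioc 0 (2 * Real.pi), |(P.eval (exp ((θ:ℝ) * I))).re| ≤ N + 1) ∧
      Integrable (fun θ : ℝ => |v θ - (P.eval (exp (θ * I))).re| * W θ) mu0 ∧
      ∫ θ : ℝ, |v θ - (P.eval (exp (θ * I))).re| * W θ ∂mu0 ≤ ε := by
  have hpi := Real.pi_pos
  have hvW : Integrable (fun θ => v θ * W θ) mu0 := hW.bdd_mul (c := N) hvm (Eventually.of_forall hv)
  obtain ⟨F, hFc, hFi, hF⟩ := cont_L1 hW hW0 hvW (ε := ε / 3) (by positivity)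
  set F1 : ℝ → ℝ := fun θ => max (-N) (min (F θ) N) with hF1
  have hF1c : Continuous F1 := by fun_prop
  have hF1b : ∀ θ, |F1 θ| ≤ N := fun θ => clamp_abs hN
  set χ : ℕ → ℝ → ℝ := fun j θ => max 0 (min 1 (j * min θ (2 * Real.pi - θ))) with hχ
  have hχc : ∀ j, Continuous (χ j) := by intro j; fun_prop
  have hχ0 : ∀ j θ, 0 ≤ χ j θ := fun j θ => le_max_left _ _
  have hχ1 : ∀ j θ, χ j θ ≤ 1 := fun j θ => max_le zero_le_one (min_le_left _ _)
  have hlim : Tendsto (fun j => ∫ θ, |F1 θ - χ j θ * F1 θ| * W θ ∂mu0) atTop (nhds (∫ θ, (0:ℝ) ∂mu0)) := by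
    refine tendsto_integral_of_dominated_convergence (fun θ => N * W θ) ?_ (hW.const_mul N) ?_ ?_
    · intro j
      exact ((hF1c.sub ((hχc j).mul hF1c)).abs.aestronglyMeasurable).mul hW.1
    · intro j
      filter_upwards with θ
      rw [Real.norm_of_nonneg (mul_nonneg (abs_nonneg _) (hW0 θ))]
      refine mul_le_mul_of_nonneg_right ?_ (hW0 θ)
      rw [show F1 θ - χ j θ * F1 θ = (1 - χ j θ) * F1 θ by ring, abs_mul]
      refine (mul_le_of_le_one_left (abs_nonneg _) ?_).trans (hF1b θ)
      rw [abs_le]; constructor <;> linarith [hχ0 j θ, hχ1 j θ]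
    · have hne : ∀ᵐ θ ∂mu0, θ ≠ 2 * Real.pi := by
        refine ae_restrict_of_ae ?_
        rw [ae_iff]; simp
      filter_upwards [hne, ae_restrict_mem measurableSet_Ioc] with θ h1 h2
      have hm : 0 < min θ (2 * Real.pi - θ) := lt_min h2.1 (sub_pos.mpr (lt_of_le_of_ne h2.2 h1))
      obtain ⟨j0, hj0⟩ := exists_nat_gt (1 / min θ (2 * Real.pi - θ))
      rw [div_lt_iff₀ hm] at hj0
      refine tendsto_const_nhds.congr' ?_
      filter_upwards [eventually_ge_atTop j0] with j hj
      have : χ j θ = 1 := by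
        have h3 : (1:ℝ) ≤ j * min θ (2 * Real.pi - θ) :=
          hj0.le.trans (mul_le_mul_of_nonneg_right (by exact_mod_cast hj) hm.le)
        simp only [hχ]; rw [min_eq_left h3]; simp
      rw [this]; simp
  rw [integral_zero] at hlim
  obtain ⟨j, hj⟩ := (hlim.eventually (eventually_le_nhds (show (0:ℝ) < ε / 3 by positivity))).exists
  set F2 : ℝ → ℝ := fun θ => χ j θ * F1 θ with hF2
  have hF2c : Continuous F2 := (hχc j).mul hF1c
  have hF2b : ∀ θ, |F2 θ| ≤ N := by
    intro θ
    rw [hF2]; beta_reduce; rw [abs_mul, abs_of_nonneg (hχ0 j θ)]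
    exact (mul_le_of_le_one_left (abs_nonneg _) (hχ1 j θ)).trans (hF1b θ)
  have hper : F2 0 = F2 (2 * Real.pi) := by
    have e1 : χ j 0 = 0 := by
      simp only [hχ]; rw [sub_zero, min_eq_left (by positivity : (0:ℝ) ≤ 2 * Real.pi)]; simp
    have e2 : χ j (2 * Real.pi) = 0 := by
      simp only [hχ]; rw [sub_self, min_eq_right (by positivity : (0:ℝ) ≤ 2 * Real.pi)]; simp
    simp only [hF2, e1, e2, zero_mul]
  set I0 := ∫ θ, W θ ∂mu0 with hI0
  have hI0' : 0 ≤ I0 := integral_nonneg hW0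
  set η := min 1 (ε / 3 / (I0 + 1)) with hη
  have hη0 : 0 < η := lt_min one_pos (by positivity)
  obtain ⟨P, hP⟩ := trig_unif hF2c hper hη0
  have hPc : Continuous fun θ : ℝ => (P.eval (exp (θ * I))).re :=
    Complex.continuous_re.comp (P.continuous.comp (by fun_prop))
  have hPb : ∀ θ ∈ Ioc 0 (2 * Real.pi), |(P.eval (exp ((θ:ℝ) * I))).re| ≤ N + 1 := by
    intro θ hθ
    have h1 := (hP θ hθ).trans (min_le_left _ _)
    have h2 := hF2b θ
    rw [abs_le] at *
    constructor <;> linarith [h1.1, h1.2, h2.1, h2.2]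
  have hint : Integrable (fun θ : ℝ => |v θ - (P.eval (exp (θ * I))).re| * W θ) mu0 := by
    refine hW.bdd_mul (c := N + (N + 1)) ((hvm.sub hPc.aestronglyMeasurable).norm) ?_
    filter_upwards [ae_restrict_mem measurableSet_Ioc] with θ hθ
    rw [Real.norm_of_nonneg (abs_nonneg _)]
    exact (abs_sub _ _).trans (add_le_add (hv θ) (hPb θ hθ))
  refine ⟨P, hPb, hint, ?_⟩
  have i2 : Integrable (fun θ => |F1 θ - F2 θ| * W θ) mu0 := by
    refine hW.bdd_mul (c := N + N) ((hF1c.sub hF2c).abs.aestronglyMeasurable) ?_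
    filter_upwards with θ
    rw [Real.norm_of_nonneg (abs_nonneg _)]
    exact (abs_sub _ _).trans (add_le_add (hF1b θ) (hF2b θ))
  have i3 : Integrable (fun θ => η * W θ) mu0 := hW.const_mul _
  calc ∫ θ : ℝ, |v θ - (P.eval (exp (θ * I))).re| * W θ ∂mu0
      ≤ ∫ θ : ℝ, (|v θ - F θ| * W θ + |F1 θ - F2 θ| * W θ) + η * W θ ∂mu0 := by
        refine integral_mono_ae hint ((hFi.add i2).add i3) ?_
        filter_upwards [ae_restrict_mem measurableSet_Ioc] with θ hθ
        rw [← add_mul, ← add_mul]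
        refine mul_le_mul_of_nonneg_right ?_ (hW0 θ)
        have a1 := clamp_close (b := F θ) (hv θ)
        have a2 := hP θ hθ
        have a3 : v θ - (P.eval (exp ((θ:ℝ) * I))).re = (v θ - F1 θ) + (F1 θ - F2 θ) + (F2 θ - (P.eval (exp ((θ:ℝ) * I))).re) := by ring
        rw [a3]
        refine (abs_add_three _ _ _).trans ?_
        gcongr
    _ = ∫ θ, |v θ - F θ| * W θ ∂mu0 + ∫ θ, |F1 θ - F2 θ| * W θ ∂mu0 + η * I0 := by
        have i12 : Integrable (fun θ => |v θ - F θ| * W θ + |F1 θ - F2 θ| * W θ) mu0 := hFi.add i2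
        rw [integral_add i12 i3, integral_add hFi i2, integral_const_mul]
    _ ≤ ε / 3 + ε / 3 + ε / 3 := by
        have : η * I0 ≤ ε / 3 := by
          have : η ≤ ε / 3 / (I0 + 1) := min_le_right _ _
          rw [le_div_iff₀ (by positivity)] at this
          nlinarith
        gcongr
    _ = ε := by ring

theorem trig_mean (P : Polynomial ℂ) : ∫ θ : ℝ, (P.eval (exp (θ * I))).re ∂mu0 = 2 * Real.pi * (P.eval 0).re := by
  have hpi := Real.pi_pos
  have h := DiffContOnCl.circleAverage (f := fun z => P.eval z) (c := 0) (R := 1) (P.differentiable.diffContOnCl)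
  rw [Real.circleAverage] at h
  have hc : Continuous fun θ : ℝ => P.eval (exp (θ * I)) := P.continuous.comp (by fun_prop)
  have h1 : ∫ θ in (0:ℝ)..(2 * Real.pi), P.eval (circleMap 0 1 θ) = ∫ θ : ℝ, P.eval (exp (θ * I)) ∂mu0 := by
    rw [intervalIntegral.integral_of_le (by positivity)]
    simp [circleMap]
  rw [h1] at h
  have hi : Integrable (fun θ : ℝ => P.eval (exp (θ * I))) mu0 :=
    (hc.integrableOn_Icc (a := 0) (b := 2 * Real.pi)).mono_set Ioc_subset_Icc_self
  have h2 : ∫ θ : ℝ, (P.eval (exp (θ * I))).re ∂mu0 = (∫ θ : ℝ, P.eval (exp (θ * I)) ∂mu0).re := integral_re hi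
  rw [h2, ← h]
  rw [Complex.real_smul, Complex.re_ofReal_mul, ← mul_assoc, mul_inv_cancel₀ (by positivity), one_mul]

theorem trig_approx {h : ℝ → ℝ} (hh : Integrable h mu0) (he : Integrable (fun θ => Real.exp (h θ)) mu0)
    {ε : ℝ} (hε : 0 < ε) : ∃ P : Polynomial ℂ,
      ∫ θ : ℝ, Real.exp ((P.eval (exp (θ * I))).re + h θ) ∂mu0 ≤ 2 * Real.pi + ε ∧
      |2 * Real.pi * (P.eval 0).re + ∫ θ, h θ ∂mu0| ≤ ε := by
  have hpi := Real.pi_pos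
  set W : ℝ → ℝ := fun θ => 1 + Real.exp (h θ) with hWd
  have hW : Integrable W mu0 := (integrable_const 1).add he
  have hW0 : ∀ θ, 0 ≤ W θ := fun θ => by positivity
  set v : ℕ → ℝ → ℝ := fun N θ => max (-(N:ℝ)) (min (-h θ) N) with hv
  have hvm : ∀ N, AEStronglyMeasurable (v N) mu0 := fun N =>
    (aemeasurable_const.max (hh.1.aemeasurable.neg.min aemeasurable_const)).aestronglyMeasurable
  have hvb : ∀ N θ, |v N θ| ≤ N := fun N θ => clamp_abs (Nat.cast_nonneg N)
  have hveq : ∀ (N : ℕ) (θ : ℝ), |h θ| ≤ N → v N θ = - h θ := by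
    intro N θ hN
    rw [abs_le] at hN
    simp only [hv]; rw [min_eq_left (by linarith), max_eq_right (by linarith)]
  have hvabs : ∀ N θ, |v N θ| ≤ |h θ| := by
    intro N θ
    have := clamp_close (N := N) (a := 0) (b := - h θ) (by simp)
    simpa [hv] using this
  have hvle : ∀ N θ, v N θ + h θ ≤ max 0 (h θ) := by
    intro N θ
    have hN : (0:ℝ) ≤ N := Nat.cast_nonneg N
    simp only [hv]
    rcases max_cases (-(N:ℝ)) (min (-h θ) N) with ⟨h1, h2⟩ | ⟨h1, h2⟩
    · rw [h1]; exact le_max_of_le_right (by linarith)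
    · rw [h1]; exact le_max_of_le_left (by linarith [min_le_left (-h θ) (N:ℝ)])
  have hevW : ∀ N θ, Real.exp (v N θ + h θ) ≤ W θ := by
    intro N θ
    refine (Real.exp_le_exp.mpr (hvle N θ)).trans ?_
    rcases max_cases 0 (h θ) with ⟨h1, -⟩ | ⟨h1, -⟩ <;> rw [h1] <;> simp only [hWd]
    · rw [Real.exp_zero]; linarith [Real.exp_pos (h θ)]
    · linarith
  have hevm : ∀ N, AEStronglyMeasurable (fun θ => Real.exp (v N θ + h θ)) mu0 := fun N =>
    Real.continuous_exp.comp_aestronglyMeasurable ((hvm N).add hh.1)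
  have hev : ∀ θ, ∀ᶠ N : ℕ in atTop, v N θ = - h θ := by
    intro θ
    obtain ⟨N0, hN0⟩ := exists_nat_ge |h θ|
    filter_upwards [eventually_ge_atTop N0] with N hN
    exact hveq N θ (hN0.trans (by exact_mod_cast hN))
  have l1 : Tendsto (fun N => ∫ θ, Real.exp (v N θ + h θ) ∂mu0) atTop (nhds (∫ θ, (1:ℝ) ∂mu0)) := by
    refine tendsto_integral_of_dominated_convergence W hevm hW ?_ ?_
    · intro N; filter_upwards with θ
      rw [Real.norm_of_nonneg (Real.exp_pos _).le]; exact hevW N θ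
    · filter_upwards with θ
      refine tendsto_const_nhds.congr' ?_
      filter_upwards [hev θ] with N hN
      rw [hN]; simp
  have l2 : Tendsto (fun N => ∫ θ, v N θ ∂mu0) atTop (nhds (∫ θ, - h θ ∂mu0)) := by
    refine tendsto_integral_of_dominated_convergence (fun θ => |h θ|) hvm hh.abs ?_ ?_
    · intro N; filter_upwards with θ; exact hvabs N θ
    · filter_upwards with θ
      refine tendsto_const_nhds.congr' ?_
      filter_upwards [hev θ] with N hN
      rw [hN]
  have hone : ∫ θ, (1:ℝ) ∂mu0 = 2 * Real.pi := by
    simp [Measure.real, hpi.le]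
  rw [hone] at l1
  rw [integral_neg] at l2
  obtain ⟨N, hN1, hN2⟩ := ((l1.eventually (eventually_le_nhds (show 2 * Real.pi < 2 * Real.pi + ε / 2 by linarith))).and
    (l2.eventually (Metric.ball_mem_nhds _ (show 0 < ε / 2 by positivity)))).exists
  rw [Real.dist_eq] at hN2
  set C := Real.exp (N + 1) with hC
  have hC0 : 0 < C := Real.exp_pos _
  obtain ⟨P, hP1, hP2, hP3⟩ := trig_L1 hW hW0 (hvm N) (Nat.cast_nonneg N) (hvb N) (ε := min (ε / 2) (ε / 2 / C))
    (lt_min (by positivity) (by positivity))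
  have hPc : Continuous fun θ : ℝ => (P.eval (exp (θ * I))).re :=
    Complex.continuous_re.comp (P.continuous.comp (by fun_prop))
  have ivN : Integrable (v N) mu0 := hh.mono (hvm N) (Eventually.of_forall (hvabs N))
  have iev : Integrable (fun θ => Real.exp (v N θ + h θ)) mu0 := hW.mono (hevm N) (by
    filter_upwards with θ
    rw [Real.norm_of_nonneg (Real.exp_pos _).le, Real.norm_of_nonneg (hW0 θ)]; exact hevW N θ)
  have iP := mu0_cont_int hPc
  refine ⟨P, ?_, ?_⟩
  · have hbd : ∀ᵐ θ : ℝ ∂mu0, Real.exp ((P.eval (exp (θ * I))).re + h θ) ≤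
        Real.exp (v N θ + h θ) + C * (|v N θ - (P.eval (exp (θ * I))).re| * W θ) := by
      filter_upwards [ae_restrict_mem measurableSet_Ioc] with θ hθ
      set x := (P.eval (exp ((θ:ℝ) * I))).re with hx
      have h1 : x ≤ N + 1 := (abs_le.mp (hP1 θ hθ)).2
      have h2 : Real.exp x ≤ Real.exp (v N θ) + C * |v N θ - x| := by
        have h3 := Real.add_one_le_exp (v N θ - x)
        have h4 : Real.exp (v N θ) = Real.exp x * Real.exp (v N θ - x) := by rw [← Real.exp_add]; ring_nf
        have h5 : Real.exp x ≤ C := Real.exp_le_exp.mpr h1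
        have h6 := neg_abs_le (v N θ - x)
        rw [h4]
        nlinarith [Real.exp_pos x, abs_nonneg (v N θ - x)]
      rw [Real.exp_add, Real.exp_add]
      have h7 : Real.exp (h θ) ≤ W θ := by simp [hWd]
      have := mul_le_mul_of_nonneg_right h2 (Real.exp_pos (h θ)).le
      nlinarith [mul_nonneg hC0.le (abs_nonneg (v N θ - x))]
    have i1 : Integrable (fun θ => Real.exp (v N θ + h θ) + C * (|v N θ - (P.eval (exp ((θ:ℝ) * I))).re| * W θ)) mu0 :=
      iev.add (hP2.const_mul C)
    have i0 : Integrable (fun θ : ℝ => Real.exp ((P.eval (exp (θ * I))).re + h θ)) mu0 := by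
      refine i1.mono (Real.continuous_exp.comp_aestronglyMeasurable (hPc.aestronglyMeasurable.add hh.1)) ?_
      filter_upwards [hbd] with θ hθ
      rw [Real.norm_of_nonneg (Real.exp_pos _).le]
      exact hθ.trans (le_abs_self _)
    have := integral_mono_ae i0 i1 hbd
    rw [integral_add iev (hP2.const_mul C), integral_const_mul] at this
    have h8 := hP3.trans (min_le_right _ _)
    rw [le_div_iff₀ hC0] at h8
    linarith
  · rw [← trig_mean]
    have h9 : |∫ θ : ℝ, (P.eval (exp (θ * I))).re ∂mu0 - ∫ θ, v N θ ∂mu0| ≤ ε / 2 := by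
      rw [← integral_sub iP ivN]
      refine (abs_integral_le_integral_abs).trans ?_
      refine le_trans (integral_mono (iP.sub ivN).abs hP2 ?_) (hP3.trans (min_le_left _ _))
      intro θ
      show |(P.eval (exp ((θ:ℝ) * I))).re - v N θ| ≤ _
      rw [abs_sub_comm]
      refine le_mul_of_one_le_right (abs_nonneg _) ?_
      simp [hWd, (Real.exp_pos _).le]
    have := abs_add_le (∫ θ : ℝ, (P.eval (exp (θ * I))).re ∂mu0 - ∫ θ, v N θ ∂mu0) (∫ θ, v N θ ∂mu0 - - ∫ θ, h θ ∂mu0)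
    rw [show ∫ θ : ℝ, (P.eval (exp (θ * I))).re ∂mu0 + ∫ θ, h θ ∂mu0 = (∫ θ : ℝ, (P.eval (exp (θ * I))).re ∂mu0 - ∫ θ, v N θ ∂mu0) + (∫ θ, v N θ ∂mu0 - - ∫ θ, h θ ∂mu0) by ring]
    linarith

section
variable {D : JordanDomain} {ψ : ℂ → ℂ} {g : ℝ → ℂ} {σ h : ℝ → ℝ}

theorem Setup.muE_int (P : Setup D ψ g σ h) (f : ℝ → ℝ) : ∫ θ, f θ ∂(muE h) = ∫ θ, f θ * Real.exp (h θ) ∂mu0 := by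
  rw [muE, integral_withDensity_eq_integral_toReal_smul₀ P.exp_int.1.1.aemeasurable.ennreal_ofReal
    (Eventually.of_forall fun _ => ENNReal.ofReal_lt_top)]
  congr 1; ext θ
  rw [ENNReal.toReal_ofReal (Real.exp_pos _).le, smul_eq_mul, mul_comm]

theorem Setup.transfer (P : Setup D ψ g σ h) {F : ℂ → ℝ} (hF : Continuous F) :
    ∫ s in (0:ℝ)..D.l, F (D.γ s) = ∫ θ : ℝ, F (ψ (exp (θ * I))) * Real.exp (h θ) ∂mu0 := by
  rw [← P.int_eq F, intervalIntegral.integral_of_le D.l_pos.le, ← P.map_eq,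
    integral_map (f := fun s => F (g s)) P.σ_cont.aemeasurable (hF.comp P.g_lip.continuous).aestronglyMeasurable, P.muE_int]
  simp only [P.bdry]

theorem Setup.exp_total (P : Setup D ψ g σ h) : ∫ θ, Real.exp (h θ) ∂mu0 = D.l := by
  have := P.transfer (F := fun _ => 1) continuous_const
  simpa using this.symm

theorem Setup.mean_h (P : Setup D ψ g σ h) : ∫ θ, h θ ∂mu0 = 2 * Real.pi * Real.log ‖deriv ψ 0‖ := by
  have hpi := Real.pi_pos
  have := P.hpois 0 (by simp)
  simp only [norm_zero, sub_zero, Complex.norm_exp_ofReal_mul_I] at this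
  simp only [ne_eq, OfNat.ofNat_ne_zero, not_false_eq_true, zero_pow, sub_zero, one_pow, div_one, one_mul] at this
  rw [this]; field_simp

theorem Setup.interior_closure (D : JordanDomain) : interior (closure D.G) ⊆ D.G := by
  intro z hz
  by_contra hn
  have hf : z ∈ frontier D.G := ⟨interior_subset hz, fun h => hn (interior_subset h)⟩
  have h1 := D.mem_closure_ext hf
  obtain ⟨x, hx1, hx2⟩ := _root_.mem_closure_iff.mp h1 _ isOpen_interior hz
  exact hx2 (interior_subset hx1)

theorem Setup.szego_upper (P : Setup D ψ g σ h) {χ : ℂ → ℂ} (hχc : ContinuousOn χ (closure D.G))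
    (hχd : ∀ z ∈ D.G, DifferentiableAt ℂ χ z) (hχ : ∀ w ∈ closedBall (0:ℂ) 1, χ (ψ w) = w) {η : ℝ} (hη : 0 < η) :
    ∃ q : Polynomial ℂ, ‖1 - q.eval (ψ 0)‖ ≤ η ∧
      ∫ s in (0:ℝ)..D.l, ‖q.eval (D.γ s)‖ ^ 2 ≤ 2 * Real.pi * ‖deriv ψ 0‖ + η := by
  have hpi := Real.pi_pos
  set d := ‖deriv ψ 0‖ with hd
  have hd0 : 0 < d := norm_pos_iff.mpr (P.ne 0 (by simp))
  -- choose ε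
  obtain ⟨ε, hε, hεη⟩ : ∃ ε : ℝ, 0 < ε ∧ d * Real.exp ε * (2 * Real.pi + ε) ≤ 2 * Real.pi * d + η / 2 := by
    have hc : Continuous fun ε : ℝ => d * Real.exp ε * (2 * Real.pi + ε) := by fun_prop
    have h1 := hc.tendsto 0
    have h2 : d * Real.exp 0 * (2 * Real.pi + 0) < 2 * Real.pi * d + η / 2 := by
      rw [Real.exp_zero]; nlinarith
    have h3 := (h1.eventually (eventually_le_nhds h2)).filter_mono (nhdsWithin_le_nhds (s := Ioi 0))
    obtain ⟨ε, h4, h5⟩ := (h3.and self_mem_nhdsWithin).exists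
    exact ⟨ε, h5, h4⟩
  obtain ⟨Q, hQ1, hQ2⟩ := trig_approx P.hint P.exp_int.1 hε
  rw [P.mean_h] at hQ2
  set u : ℂ → ℂ := fun w => exp ((Q.eval w - Q.eval 0) / 2) with hu
  have huc : Continuous u := by
    have := Q.continuous
    exact Complex.continuous_exp.comp ((this.sub continuous_const).div_const 2)
  have hud : Differentiable ℂ u := by
    have := Q.differentiable
    exact ((this.sub_const _).div_const 2).cexp
  have hun : ∀ w, ‖u w‖ ^ 2 = Real.exp ((Q.eval w).re - (Q.eval 0).re) := by
    intro w
    simp only [hu]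
    rw [Complex.norm_exp, ← Real.exp_nat_mul]
    congr 1
    simp
    ring
  have hb0 : - (Q.eval 0).re ≤ Real.log d + ε := by
    have h1 := (abs_le.mp hQ2).1
    have h2 : 2 * Real.pi * (-(Q.eval 0).re) ≤ 2 * Real.pi * Real.log d + ε := by linarith
    have h3 : (1:ℝ) ≤ 2 * Real.pi := by linarith [Real.pi_gt_three]
    by_contra hcon
    push Not at hcon
    nlinarith
  have hmain : ∫ θ : ℝ, ‖u (exp (θ * I))‖ ^ 2 * Real.exp (h θ) ∂mu0 ≤ 2 * Real.pi * d + η / 2 := by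
    refine le_trans ?_ hεη
    have e1 : ∀ θ : ℝ, ‖u (exp (θ * I))‖ ^ 2 * Real.exp (h θ) =
        Real.exp (-(Q.eval 0).re) * Real.exp ((Q.eval (exp (θ * I))).re + h θ) := by
      intro θ
      rw [hun, ← Real.exp_add, ← Real.exp_add]; ring_nf
    simp_rw [e1]
    rw [integral_const_mul]
    have e2 : Real.exp (-(Q.eval 0).re) ≤ d * Real.exp ε := by
      refine (Real.exp_le_exp.mpr hb0).trans ?_
      rw [Real.exp_add, Real.exp_log hd0]
    exact mul_le_mul e2 hQ1 (integral_nonneg fun _ => (Real.exp_pos _).le) (by positivity)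
  obtain ⟨M, hM⟩ : ∃ M : ℝ, ∀ w ∈ closedBall (0:ℂ) 1, ‖u w‖ ≤ M :=
    (isCompact_closedBall (0:ℂ) 1).exists_bound_of_continuousOn huc.continuousOn
  have hM0 : 0 ≤ M := (norm_nonneg _).trans (hM 0 (by simp))
  have hl := D.l_pos
  set δ := min (min 1 η) (η / 2 / ((2 * M + 1) * D.l)) with hδ
  have hδ0 : 0 < δ := lt_min (lt_min one_pos hη) (by positivity)
  have hδ1 : δ ≤ 1 := (min_le_left _ _).trans (min_le_left _ _)
  have hδη : δ ≤ η := (min_le_left _ _).trans (min_le_right _ _)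
  have hδ2 : δ * ((2 * M + 1) * D.l) ≤ η / 2 := by
    rw [← le_div_iff₀ (by positivity)]; exact min_le_right _ _
  obtain ⟨q, hq⟩ := mergelyan (f₀ := u ∘ χ) D.bounded.isCompact_closure (D.nonempty.mono subset_closure)
    (D.ext_preconnected P.cont P.bijc) (huc.comp_continuousOn hχc)
    (fun z hz => (hud _).comp z (hχd z (Setup.interior_closure D hz))) δ hδ0
  have hq' : ∀ w ∈ closedBall (0:ℂ) 1, ‖u w - q.eval (ψ w)‖ ≤ δ := by
    intro w hw
    have := hq _ (P.bijc.mapsTo hw)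
    rwa [Function.comp_apply, hχ w hw] at this
  refine ⟨q, ?_, ?_⟩
  · have := hq' 0 (by simp)
    simp only [hu, sub_self, zero_div, Complex.exp_zero] at this
    exact this.trans hδη
  · rw [P.transfer (F := fun z => ‖q.eval z‖ ^ 2) (q.continuous.norm.pow 2)]
    have huc' : Continuous fun θ : ℝ => u (exp (θ * I)) := huc.comp (by fun_prop)
    have hbu : ∀ θ : ℝ, exp (θ * I) ∈ closedBall (0:ℂ) 1 := fun θ => by simp [Complex.norm_exp_ofReal_mul_I]
    have i1 : Integrable (fun θ : ℝ => ‖u (exp (θ * I))‖ ^ 2 * Real.exp (h θ)) mu0 :=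
      P.exp_int.1.bdd_mul (c := M ^ 2) (huc'.norm.pow 2).aestronglyMeasurable (Eventually.of_forall fun θ => by
        rw [Real.norm_of_nonneg (by positivity)]
        exact pow_le_pow_left₀ (norm_nonneg _) (hM _ (hbu θ)) 2)
    have i2 : Integrable (fun θ : ℝ => δ * (2 * M + 1) * Real.exp (h θ)) mu0 := P.exp_int.1.const_mul _
    have key := integral_mono_of_nonneg (μ := mu0) (f := fun θ : ℝ => ‖q.eval (ψ (exp (θ * I)))‖ ^ 2 * Real.exp (h θ))
      (Eventually.of_forall fun θ => by positivity) (i1.add i2) (Eventually.of_forall fun θ => by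
        show _ ≤ ‖u (exp (θ * I))‖ ^ 2 * Real.exp (h θ) + δ * (2 * M + 1) * Real.exp (h θ)
        rw [← add_mul]
        refine mul_le_mul_of_nonneg_right ?_ (Real.exp_pos _).le
        have a1 := hq' _ (hbu θ)
        have a2 := hM _ (hbu θ)
        have a3 := norm_sub_norm_le (q.eval (ψ (exp (θ * I)))) (u (exp (θ * I)))
        rw [norm_sub_rev] at a3
        have a4 : ‖q.eval (ψ (exp (θ * I)))‖ ≤ ‖u (exp (θ * I))‖ + δ := by linarith
        nlinarith [norm_nonneg (q.eval (ψ (exp (θ * I)))), norm_nonneg (u (exp (θ * I)))])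
    refine key.trans ?_
    have : ∫ θ : ℝ, ((fun θ : ℝ => ‖u (exp (θ * I))‖ ^ 2 * Real.exp (h θ)) + fun θ : ℝ => δ * (2 * M + 1) * Real.exp (h θ)) θ ∂mu0
      = ∫ θ : ℝ, ‖u (exp (θ * I))‖ ^ 2 * Real.exp (h θ) ∂mu0 + δ * (2 * M + 1) * D.l := by
      rw [integral_add' i1 i2, integral_const_mul, P.exp_total]
    rw [this]
    nlinarith

end

noncomputable def bN (D : JordanDomain) (q : Polynomial ℂ) : ℝ := (1 / D.l) * ∫ s in (0:ℝ)..D.l, ‖q.eval (D.γ s)‖ ^ 2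
noncomputable def Spoly (p : ℕ → Polynomial ℂ) (ζ : ℂ) (n : ℕ) : Polynomial ℂ :=
  ∑ k ∈ Finset.range (n + 1), Polynomial.C ((starRingEnd ℂ) ((p k).eval ζ)) * p k
noncomputable def Kn (p : ℕ → Polynomial ℂ) (ζ : ℂ) (n : ℕ) : ℝ := ∑ k ∈ Finset.range (n + 1), ‖(p k).eval ζ‖ ^ 2

section
variable {D : JordanDomain} {p : ℕ → Polynomial ℂ} {ζ : ℂ}

theorem on_sum (hp : D.IsONPolys p) (a : ℕ → ℂ) (m : ℕ) :
    bN D (∑ k ∈ Finset.range m, Polynomial.C (a k) * p k) = ∑ k ∈ Finset.range m, ‖a k‖ ^ 2 := by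
  have hl : (D.l : ℂ) ≠ 0 := by exact_mod_cast D.l_pos.ne'
  have hc : ∀ k, Continuous fun s => (p k).eval (D.γ s) := fun k => (p k).continuous.comp D.γ_cont
  have hcc : ∀ j k, Continuous fun s => (p j).eval (D.γ s) * (starRingEnd ℂ) ((p k).eval (D.γ s)) :=
    fun j k => (hc j).mul (Complex.continuous_conj.comp (hc k))
  apply Complex.ofReal_injective
  rw [bN]
  push_cast
  rw [← intervalIntegral.integral_ofReal]
  have e : ∀ s, ((‖(∑ k ∈ Finset.range m, Polynomial.C (a k) * p k).eval (D.γ s)‖ ^ 2 : ℝ) : ℂ) =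
      ∑ j ∈ Finset.range m, ∑ k ∈ Finset.range m, (a j * (starRingEnd ℂ) (a k)) *
        ((p j).eval (D.γ s) * (starRingEnd ℂ) ((p k).eval (D.γ s))) := by
    intro s
    push_cast
    rw [← Complex.mul_conj', Polynomial.eval_finsetSum, map_sum, Finset.sum_mul_sum]
    refine Finset.sum_congr rfl fun j _ => Finset.sum_congr rfl fun k _ => ?_
    simp only [Polynomial.eval_mul, Polynomial.eval_C, map_mul]; ring
  simp_rw [e]
  have hc3 : ∀ j k, Continuous fun s => a j * (starRingEnd ℂ) (a k) *
      ((p j).eval (D.γ s) * (starRingEnd ℂ) ((p k).eval (D.γ s))) := fun j k => continuous_const.mul (hcc j k)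
  rw [intervalIntegral.integral_finsetSum (fun j _ => (continuous_finsetSum _ fun k _ => hc3 j k).intervalIntegrable _ _), Finset.mul_sum]
  refine Finset.sum_congr rfl fun j hj => ?_
  rw [intervalIntegral.integral_finsetSum (fun k _ => (hc3 j k).intervalIntegrable _ _), Finset.mul_sum]
  simp_rw [intervalIntegral.integral_const_mul]
  have e2 : ∀ k, 1 / (D.l : ℂ) * (a j * (starRingEnd ℂ) (a k) * ∫ s in (0:ℝ)..D.l,
      ((p j).eval (D.γ s) * (starRingEnd ℂ) ((p k).eval (D.γ s)))) = if j = k then a j * (starRingEnd ℂ) (a k) else 0 := by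
    intro k
    rw [mul_left_comm, hp.2.2 j k]; split_ifs <;> simp
  simp_rw [e2]
  rw [Finset.sum_ite_eq, if_pos hj, Complex.mul_conj']

theorem on_span (hp : D.IsONPolys p) (m : ℕ) : ∀ q : Polynomial ℂ, q.degree < m →
    ∃ a : ℕ → ℂ, q = ∑ k ∈ Finset.range m, Polynomial.C (a k) * p k := by
  induction m with
  | zero =>
    intro q hq
    refine ⟨0, ?_⟩
    simpa using (Polynomial.degree_eq_bot.mp (by
      rw [Polynomial.degree_eq_bot]
      by_contra h
      exact absurd hq (not_lt.mpr (Polynomial.zero_le_degree_iff.mpr h))))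
  | succ m ih =>
    intro q hq
    have hlc : (p m).coeff m ≠ 0 := by
      obtain ⟨c, hc, hcc⟩ := hp.2.1 m
      rw [Polynomial.leadingCoeff, hp.1 m] at hcc
      rw [hcc]; exact_mod_cast hc.ne'
    set b := q.coeff m / (p m).coeff m with hb
    obtain ⟨a, ha⟩ := ih (q - Polynomial.C b * p m) (by
      rw [Polynomial.degree_lt_iff_coeff_zero] at hq ⊢
      intro j hj
      rw [Polynomial.coeff_sub, Polynomial.coeff_C_mul]
      rcases hj.eq_or_lt with h | h
      · rw [← h, hb]; field_simp; simp
      · rw [hq j h, Polynomial.coeff_eq_zero_of_natDegree_lt (by rw [hp.1 m]; exact h)]; simp)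
    refine ⟨fun k => if k = m then b else a k, ?_⟩
    rw [Finset.sum_range_succ]
    beta_reduce
    rw [if_pos rfl, ← sub_eq_iff_eq_add, ha]
    refine Finset.sum_congr rfl fun k hk => ?_
    rw [if_neg (Finset.mem_range.mp hk).ne]

theorem on_eval_le (hp : D.IsONPolys p) (q : Polynomial ℂ) : ∃ n, ‖q.eval ζ‖ ^ 2 ≤ Kn p ζ n * bN D q := by
  obtain ⟨a, ha⟩ := on_span hp (q.natDegree + 1) q (by
    exact_mod_cast lt_of_le_of_lt Polynomial.degree_le_natDegree (by exact_mod_cast Nat.lt_succ_self _))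
  refine ⟨q.natDegree, ?_⟩
  have h1 := on_sum hp a (q.natDegree + 1)
  rw [← ha] at h1
  rw [h1, mul_comm]
  have h2 : ‖q.eval ζ‖ ≤ ∑ k ∈ Finset.range (q.natDegree + 1), ‖a k‖ * ‖(p k).eval ζ‖ := by
    conv_lhs => rw [ha, Polynomial.eval_finsetSum]
    refine (norm_sum_le _ _).trans (le_of_eq ?_)
    simp
  refine (pow_le_pow_left₀ (norm_nonneg _) h2 2).trans ?_
  exact Finset.sum_mul_sq_le_sq_mul_sq _ _ _

theorem Spoly_eval (n : ℕ) (z : ℂ) : (Spoly p ζ n).eval z = partialSum p ζ n z := by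
  simp [Spoly, partialSum, Polynomial.eval_finsetSum]

theorem Spoly_self (n : ℕ) : (Spoly p ζ n).eval ζ = Kn p ζ n := by
  rw [Spoly_eval, partialSum, Kn]
  push_cast
  exact Finset.sum_congr rfl fun k _ => Complex.conj_mul' _

theorem Spoly_bN (hp : D.IsONPolys p) (n : ℕ) : bN D (Spoly p ζ n) = Kn p ζ n := by
  rw [Spoly, on_sum hp, Kn]
  simp

theorem Kn_mono {n m : ℕ} (h : n ≤ m) : Kn p ζ n ≤ Kn p ζ m :=
  Finset.sum_le_sum_of_subset_of_nonneg (Finset.range_subset_range.mpr (by omega)) fun _ _ _ => by positivity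

theorem Spoly_sub_bN (hp : D.IsONPolys p) {n m : ℕ} (h : n ≤ m) :
    bN D (Spoly p ζ m - Spoly p ζ n) = Kn p ζ m - Kn p ζ n := by
  set a : ℕ → ℂ := fun k => if k < n + 1 then 0 else (starRingEnd ℂ) ((p k).eval ζ) with ha
  have hsub : Finset.range (n + 1) ⊆ Finset.range (m + 1) := Finset.range_subset_range.mpr (by omega)
  have e : Spoly p ζ m - Spoly p ζ n = ∑ k ∈ Finset.range (m + 1), Polynomial.C (a k) * p k := by
    rw [Spoly, Spoly, ← Finset.sum_sdiff hsub, add_sub_cancel_right, ← Finset.sum_sdiff hsub (f := fun k => Polynomial.C (a k) * p k)]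
    rw [Finset.sum_eq_zero (s := Finset.range (n + 1)), add_zero]
    · refine Finset.sum_congr rfl fun k hk => ?_
      rw [Finset.mem_sdiff, Finset.mem_range, Finset.mem_range] at hk
      simp only [ha]; rw [if_neg hk.2]
    · intro k hk
      simp only [ha]; rw [if_pos (Finset.mem_range.mp hk)]; simp
  rw [e, on_sum hp, Kn, Kn, ← Finset.sum_sdiff hsub, ← Finset.sum_sdiff hsub (f := fun k => ‖(p k).eval ζ‖ ^ 2), add_sub_cancel_right]
  rw [Finset.sum_eq_zero (s := Finset.range (n + 1)), add_zero]
  · refine Finset.sum_congr rfl fun k hk => ?_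
    rw [Finset.mem_sdiff, Finset.mem_range, Finset.mem_range] at hk
    simp only [ha]; rw [if_neg hk.2]; simp
  · intro k hk
    simp only [ha]; rw [if_pos (Finset.mem_range.mp hk)]; simp

theorem Kn_zero (hp : D.IsONPolys p) : Kn p ζ 0 = 1 := by
  have h1 := on_sum hp (fun _ => 1) 1
  simp only [Finset.sum_range_one, map_one, one_mul, norm_one, one_pow] at h1
  have h0 := Polynomial.eq_C_of_natDegree_eq_zero (hp.1 0)
  rw [Kn, zero_add, Finset.sum_range_one]
  have hl := D.l_pos
  rw [h0] at h1 ⊢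
  simp only [bN, Polynomial.eval_C, intervalIntegral.integral_const, sub_zero, smul_eq_mul] at h1 ⊢
  rw [← h1]; field_simp

theorem Kn_one_le (hp : D.IsONPolys p) (n : ℕ) : 1 ≤ Kn p ζ n := (Kn_zero hp (ζ := ζ)).symm.le.trans (Kn_mono (Nat.zero_le n))

theorem bN_nonneg (q : Polynomial ℂ) : 0 ≤ bN D q :=
  mul_nonneg (by have := D.l_pos; positivity) (intervalIntegral.integral_nonneg D.l_pos.le fun _ _ => by positivity)
end

theorem exists_hlog {f : ℂ → ℂ} (hf : DifferentiableOn ℂ f (ball 0 1)) (hn : ∀ w ∈ ball (0:ℂ) 1, f w ≠ 0) :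
    ∃ (L : ℂ → ℂ) (c : ℂ), ∀ w ∈ ball (0:ℂ) 1, HasDerivAt L (deriv f w / f w) w ∧ f w = c * exp (L w) := by
  have hd : DifferentiableOn ℂ (deriv f) (ball 0 1) := hf.deriv isOpen_ball
  obtain ⟨L, hL⟩ := (hd.div hf hn).isExactOn_ball
  have hdf : ∀ w ∈ ball (0:ℂ) 1, HasDerivAt f (deriv f w) w := fun w hw =>
    (hf.differentiableAt (isOpen_ball.mem_nhds hw)).hasDerivAt
  have hC : ∀ w ∈ ball (0:ℂ) 1, HasDerivAt (fun z => f z * exp (-L z)) 0 w := by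
    intro w hw
    have h1 : HasDerivAt (fun z => f z * exp (-L z)) _ w := (hdf w hw).mul ((hL w hw).neg.cexp)
    refine h1.congr_deriv ?_
    have := hn w hw
    simp only [Pi.neg_apply, Pi.div_apply]
    field_simp
    ring
  have hconst : ∀ w ∈ ball (0:ℂ) 1, f w * exp (-L w) = f 0 * exp (-L 0) := by
    intro w hw
    refine (convex_ball (0:ℂ) 1).is_const_of_fderivWithin_eq_zero (𝕜 := ℂ) (f := fun z => f z * exp (-L z)) ?_ ?_ hw (by simp)
    · exact fun z hz => (hC z hz).differentiableAt.differentiableWithinAt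
    · intro z hz
      rw [fderivWithin_of_isOpen isOpen_ball hz]
      have := (hC z hz).hasFDerivAt.fderiv
      rw [this]; ext; simp
  refine ⟨L, f 0 * exp (-L 0), fun w hw => ⟨hL w hw, ?_⟩⟩
  rw [← hconst w hw, mul_assoc, ← Complex.exp_add]; simp

theorem exists_sqrt {f : ℂ → ℂ} (hf : DifferentiableOn ℂ f (ball 0 1)) (hn : ∀ w ∈ ball (0:ℂ) 1, f w ≠ 0) :
    ∃ k : ℂ → ℂ, DifferentiableOn ℂ k (ball 0 1) ∧ ∀ w ∈ ball (0:ℂ) 1, k w ^ 2 = f w := by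
  obtain ⟨L, c, hL⟩ := exists_hlog hf hn
  obtain ⟨s, hs⟩ := IsAlgClosed.exists_pow_nat_eq c (n := 2) (by norm_num)
  refine ⟨fun w => s * exp (L w / 2), fun w hw => ?_, fun w hw => ?_⟩
  · exact (((hL w hw).1.differentiableAt.div_const 2).cexp.const_mul s).differentiableWithinAt
  · rw [mul_pow, hs, (hL w hw).2, ← Complex.exp_nat_mul]
    congr 2; push_cast; ring

theorem circ_diffcl {F : ℂ → ℂ} (hF : DifferentiableOn ℂ F (ball 0 1)) {r : ℝ} (hr0 : 0 ≤ r) (hr : r < 1) :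
    DiffContOnCl ℂ F (ball 0 r) := by
  refine DifferentiableOn.diffContOnCl (hF.mono ?_)
  exact closure_ball_subset_closedBall.trans (closedBall_subset_ball hr)

theorem circ_mean0 {F : ℂ → ℂ} (hF : DifferentiableOn ℂ F (ball 0 1)) {r : ℝ} (hr0 : 0 ≤ r) (hr : r < 1) :
    ∫ θ in (0:ℝ)..(2 * Real.pi), F (r * exp (θ * I)) = 2 * Real.pi * F 0 := by
  have hpi := Real.pi_pos
  have h := DiffContOnCl.circleAverage (f := F) (c := 0) (R := r) (by rw [abs_of_nonneg hr0]; exact circ_diffcl hF hr0 hr)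
  rw [Real.circleAverage] at h
  simp only [circleMap, zero_add] at h
  rw [← h, Complex.real_smul]
  push_cast
  rw [← mul_assoc, mul_inv_cancel₀ (by
    simp), one_mul]

theorem circ_re0 {F : ℂ → ℂ} (hF : DifferentiableOn ℂ F (ball 0 1)) {r : ℝ} (hr0 : 0 ≤ r) (hr : r < 1) :
    ∫ θ in (0:ℝ)..(2 * Real.pi), (F (r * exp (θ * I))).re = 2 * Real.pi * (F 0).re := by
  have hc := circ_comp_cont hF.continuousOn hr0 hr
  have h1 := circ_mean0 hF hr0 hr
  have h2 := Complex.reCLM.intervalIntegral_comp_comm (hc.intervalIntegrable (μ := volume) 0 (2 * Real.pi))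
  rw [h1] at h2
  have h3 : (2 * (Real.pi:ℂ) * F 0).re = 2 * Real.pi * (F 0).re := by
    rw [show (2 * (Real.pi:ℂ)) = ((2 * Real.pi : ℝ) : ℂ) by push_cast; ring, Complex.re_ofReal_mul]
  rw [← h3]; exact h2

theorem circ_norm0 {F : ℂ → ℂ} (hF : DifferentiableOn ℂ F (ball 0 1)) {r : ℝ} (hr0 : 0 ≤ r) (hr : r < 1) :
    2 * Real.pi * ‖F 0‖ ≤ ∫ θ in (0:ℝ)..(2 * Real.pi), ‖F (r * exp (θ * I))‖ := by
  have hpi := Real.pi_pos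
  have h1 := congrArg norm (circ_mean0 hF hr0 hr)
  rw [norm_mul, show (2 * (Real.pi:ℂ)) = ((2 * Real.pi : ℝ) : ℂ) by push_cast; ring, Complex.norm_real,
    Real.norm_of_nonneg (by positivity)] at h1
  rw [← h1]
  exact intervalIntegral.norm_integral_le_integral_norm (by positivity)

theorem cauchy_bound {F : ℂ → ℂ} (hF : DifferentiableOn ℂ F (ball 0 1)) {r : ℝ} (hr : r < 1) {w : ℂ} (hw : ‖w‖ < r) :
    2 * Real.pi * ‖F w‖ ≤ r / (r - ‖w‖) * ∫ θ in (0:ℝ)..(2 * Real.pi), ‖F (r * exp (θ * I))‖ := by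
  have hpi := Real.pi_pos
  have hr0 : 0 < r := (norm_nonneg w).trans_lt hw
  have h1 := (circ_diffcl hF hr0.le hr).circleIntegral_sub_inv_smul (w := w) (by simpa using hw)
  have h2 := congrArg norm h1
  rw [norm_smul] at h2
  have h3 : ‖2 * (Real.pi:ℂ) * I‖ = 2 * Real.pi := by simp [hpi.le]
  rw [h3] at h2
  rw [← h2, circleIntegral, ← intervalIntegral.integral_const_mul]
  have hcF := circ_comp_cont hF.continuousOn hr0.le hr
  refine intervalIntegral.norm_integral_le_of_norm_le (by positivity) ?_ ((continuous_const.mul hcF.norm).intervalIntegrable _ _)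
  refine Eventually.of_forall fun θ _ => ?_
  rw [deriv_circleMap, norm_smul, norm_smul]
  have e1 : ‖circleMap 0 r θ * I‖ = r := by simp [abs_of_pos hr0]
  have e2 : r - ‖w‖ ≤ ‖circleMap 0 r θ - w‖ := by
    have := norm_sub_norm_le (circleMap 0 r θ) w
    simpa [abs_of_pos hr0] using this
  have e3 : circleMap 0 r θ = r * exp (θ * I) := by simp [circleMap]
  rw [e1, norm_inv, ← e3, ← mul_assoc, div_eq_mul_inv]
  gcongr

section
variable {D : JordanDomain} {ψ : ℂ → ℂ} {g : ℝ → ℂ} {σ h : ℝ → ℝ} {p : ℕ → Polynomial ℂ} {ζ : ℂ}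

theorem Setup.poly_mean (P : Setup D ψ g σ h) (q : Polynomial ℂ) {r : ℝ} (hr0 : 0 ≤ r) (hr : r < 1) :
    (∫ θ in (0:ℝ)..(2 * Real.pi), ‖q.eval (ψ (r * exp (θ * I)))‖ ^ 2 * ‖deriv ψ (r * exp (θ * I))‖) * r ≤ D.l * bN D q := by
  have hl := D.l_pos
  have := circ_bound P.toDiskParam (Q := polyInt (q ^ 2) 0) (q := fun z => (q ^ 2).eval z)
    (fun z => polyInt_hasDerivAt (q ^ 2) 0 z) (q ^ 2).continuous hr0 hr
  simp only [Polynomial.eval_pow, norm_pow] at this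
  rw [← intervalIntegral.integral_mul_const, bN, ← mul_assoc, mul_one_div_cancel hl.ne', one_mul]
  exact this

theorem Setup.fq_diff (P : Setup D ψ g σ h) (q : Polynomial ℂ) :
    DifferentiableOn ℂ (fun w => q.eval (ψ w)) (ball 0 1) :=
  q.differentiable.comp_differentiableOn P.diff

theorem Setup.eval_bound (P : Setup D ψ g σ h) {w : ℂ} (hw : ‖w‖ < 1) :
    ∃ C : ℝ, 0 ≤ C ∧ ∀ q : Polynomial ℂ, ‖q.eval (ψ w)‖ ^ 2 ≤ C * bN D q := by
  have hpi := Real.pi_pos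
  have hl := D.l_pos
  obtain ⟨r, hr1, hr2⟩ := exists_between hw
  have hr0 : 0 < r := (norm_nonneg w).trans_lt hr1
  have hd : 0 < ‖deriv ψ w‖ := norm_pos_iff.mpr (P.ne w (by simpa using hw))
  have hs : 0 < r - ‖w‖ := by linarith
  refine ⟨1 / (r - ‖w‖) * D.l / (2 * Real.pi * ‖deriv ψ w‖), by positivity, fun q => ?_⟩
  have h1 := cauchy_bound (F := fun w => q.eval (ψ w) ^ 2 * deriv ψ w)
    (((P.fq_diff q).pow 2).mul (P.diff.deriv isOpen_ball)) hr2 hr1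
  have h2 := P.poly_mean q hr0.le hr2
  simp only [norm_mul, norm_pow] at h1
  rw [div_mul_eq_mul_div, le_div_iff₀ (by positivity)]
  have h3 := mul_le_mul_of_nonneg_left h2 (show 0 ≤ 1 / (r - ‖w‖) by positivity)
  calc _ = 2 * Real.pi * (‖q.eval (ψ w)‖ ^ 2 * ‖deriv ψ w‖) := by ring
    _ ≤ _ := h1
    _ = 1 / (r - ‖w‖) * ((∫ θ in (0:ℝ)..(2 * Real.pi), ‖q.eval (ψ (r * exp (θ * I)))‖ ^ 2 * ‖deriv ψ (r * exp (θ * I))‖) * r) := by ring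
    _ ≤ _ := h3
    _ = _ := by ring

noncomputable def kap (D : JordanDomain) (ψ : ℂ → ℂ) : ℝ := D.l / (2 * Real.pi * ‖deriv ψ 0‖)

theorem Setup.d_pos (P : Setup D ψ g σ h) : 0 < ‖deriv ψ 0‖ := norm_pos_iff.mpr (P.ne 0 (by simp))

theorem Setup.kap_mul (P : Setup D ψ g σ h) : kap D ψ * ‖deriv ψ 0‖ = D.l / (2 * Real.pi) := by
  have := P.d_pos
  have := Real.pi_pos
  rw [kap]; field_simp

theorem Setup.eval0 (P : Setup D ψ g σ h) (q : Polynomial ℂ) : ‖q.eval (ψ 0)‖ ^ 2 ≤ kap D ψ * bN D q := by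
  have hpi := Real.pi_pos
  have hd := P.d_pos
  rw [kap, div_mul_eq_mul_div, le_div_iff₀ (by positivity)]
  have key : ∀ n, ‖q.eval (ψ 0)‖ ^ 2 * (2 * Real.pi * ‖deriv ψ 0‖) * rr n ≤ D.l * bN D q := by
    intro n
    have h1 := circ_norm0 (F := fun w => q.eval (ψ w) ^ 2 * deriv ψ w)
      (((P.fq_diff q).pow 2).mul (P.diff.deriv isOpen_ball)) (rr_nonneg n) (rr_lt n)
    have h2 := P.poly_mean q (rr_nonneg n) (rr_lt n)
    simp only [norm_mul, norm_pow] at h1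
    refine le_trans ?_ h2
    refine mul_le_mul_of_nonneg_right (le_trans (le_of_eq ?_) h1) (rr_nonneg n)
    ring
  have := le_of_tendsto' (rr_tendsto'.const_mul (‖q.eval (ψ 0)‖ ^ 2 * (2 * Real.pi * ‖deriv ψ 0‖))) key
  rwa [mul_one] at this

theorem Setup.Kn_le (P : Setup D ψ g σ h) (hp : D.IsONPolys p) (n : ℕ) : Kn p (ψ 0) n ≤ kap D ψ := by
  have h1 := P.eval0 (Spoly p (ψ 0) n)
  have h2 := Kn_one_le hp (ζ := ψ 0) n
  rw [Spoly_bN hp, Spoly_self, Complex.norm_real, Real.norm_of_nonneg (by linarith)] at h1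
  nlinarith

theorem Setup.Kn_tendsto (P : Setup D ψ g σ h) (hp : D.IsONPolys p) {χ : ℂ → ℂ} (hχc : ContinuousOn χ (closure D.G))
    (hχd : ∀ z ∈ D.G, DifferentiableAt ℂ χ z) (hχ : ∀ w ∈ closedBall (0:ℂ) 1, χ (ψ w) = w) :
    Tendsto (Kn p (ψ 0)) atTop (nhds (kap D ψ)) := by
  have hpi := Real.pi_pos
  have hl := D.l_pos
  have hd := P.d_pos
  refine tendsto_order.mpr ⟨fun a ha => ?_, fun a ha => Eventually.of_forall fun n => (P.Kn_le hp n).trans_lt ha⟩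
  suffices ∃ n, a < Kn p (ψ 0) n by
    obtain ⟨n, hn⟩ := this
    filter_upwards [eventually_ge_atTop n] with m hm using hn.trans_le (Kn_mono hm)
  by_contra hcon
  push Not at hcon
  have ha0 : 0 ≤ a := le_trans (by linarith [Kn_one_le hp (ζ := ψ 0) 0]) (hcon 0)
  have key : ∀ η : ℝ, 0 < η → η < 1 → (1 - η) ^ 2 * D.l ≤ a * (2 * Real.pi * ‖deriv ψ 0‖ + η) := by
    intro η h0 h1
    obtain ⟨q, hq1, hq2⟩ := P.szego_upper hχc hχd hχ h0
    obtain ⟨n, hn⟩ := on_eval_le hp (ζ := ψ 0) q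
    have a1 : 1 - η ≤ ‖q.eval (ψ 0)‖ := by
      have := norm_sub_norm_le (1:ℂ) (q.eval (ψ 0))
      rw [norm_one] at this; linarith
    have a2 : (1 - η) ^ 2 ≤ a * bN D q := by
      refine (pow_le_pow_left₀ (by linarith) a1 2).trans (hn.trans ?_)
      exact mul_le_mul_of_nonneg_right (hcon n) (bN_nonneg q)
    have a3 : bN D q * D.l ≤ 2 * Real.pi * ‖deriv ψ 0‖ + η := by
      rw [bN, mul_comm, ← mul_assoc, mul_one_div_cancel hl.ne', one_mul]; exact hq2
    nlinarith
  have c1 : Continuous fun η : ℝ => (1 - η) ^ 2 * D.l := by fun_prop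
  have c2 : Continuous fun η : ℝ => a * (2 * Real.pi * ‖deriv ψ 0‖ + η) := by fun_prop
  have : (1 - (0:ℝ)) ^ 2 * D.l ≤ a * (2 * Real.pi * ‖deriv ψ 0‖ + 0) := by
    refine le_of_tendsto_of_tendsto ((c1.tendsto 0).mono_left nhdsWithin_le_nhds) ((c2.tendsto 0).mono_left nhdsWithin_le_nhds) (b := nhdsWithin 0 (Ioi 0)) ?_
    filter_upwards [Ioo_mem_nhdsGT (zero_lt_one (α := ℝ))] with η hη
    exact key η hη.1 hη.2
  rw [kap, lt_div_iff₀ (by positivity)] at ha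
  linarith

theorem Setup.szego_lim (P : Setup D ψ g σ h) (hp : D.IsONPolys p) {w : ℂ} (hw : ‖w‖ < 1) :
    Tendsto (fun n => (Spoly p (ψ 0) n).eval (ψ w)) atTop (nhds (szegoKernel p (ψ 0) (ψ w))) := by
  obtain ⟨C, hC0, hC⟩ := P.eval_bound hw
  have hb : ∀ n, Kn p (ψ w) n ≤ C := by
    intro n
    have h1 := hC (Spoly p (ψ w) n)
    have h2 := Kn_one_le hp (ζ := ψ w) n
    rw [Spoly_bN hp, Spoly_self, Complex.norm_real, Real.norm_of_nonneg (by linarith)] at h1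
    nlinarith
  have hsum : ∀ z : ℂ, (∃ C, ∀ n, Kn p z n ≤ C) → Summable fun k => ‖(p k).eval z‖ ^ 2 := by
    rintro z ⟨C, hC⟩
    refine summable_of_sum_range_le (c := C) (fun _ => by positivity) fun n => ?_
    exact (Finset.sum_le_sum_of_subset_of_nonneg (Finset.range_subset_range.mpr (Nat.le_succ n)) fun _ _ _ => by positivity).trans (hC n)
  have s1 := hsum (ψ w) ⟨C, hb⟩
  have s2 := hsum (ψ 0) ⟨_, P.Kn_le hp⟩
  have s3 : Summable fun k : ℕ => (starRingEnd ℂ) ((p k).eval (ψ 0)) * (p k).eval (ψ w) := by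
    refine Summable.of_norm_bounded (s1.add s2) fun k => ?_
    rw [norm_mul, RCLike.norm_conj]
    nlinarith [sq_nonneg (‖(p k).eval (ψ 0)‖ - ‖(p k).eval (ψ w)‖), sq_nonneg ‖(p k).eval (ψ 0)‖, sq_nonneg ‖(p k).eval (ψ w)‖]
  have := (s3.hasSum.tendsto_sum_nat).comp (tendsto_add_atTop_nat 1)
  simp_rw [Spoly_eval]
  exact this

end

theorem cs_cont {x y : ℝ → ℝ} (hx : Continuous x) (hy : Continuous y) {a b : ℝ} (hab : a ≤ b) :
    (∫ t in a..b, x t * y t) ^ 2 ≤ (∫ t in a..b, x t ^ 2) * ∫ t in a..b, y t ^ 2 := by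
  have hi : ∀ {f : ℝ → ℝ}, Continuous f → IntervalIntegrable f volume a b := fun hf => hf.intervalIntegrable _ _
  have key : ∀ s : ℝ, 0 ≤ (∫ t in a..b, y t ^ 2) * (s * s) + (2 * ∫ t in a..b, x t * y t) * s + ∫ t in a..b, x t ^ 2 := by
    intro s
    have h1 : 0 ≤ ∫ t in a..b, (x t + s * y t) ^ 2 := intervalIntegral.integral_nonneg hab fun _ _ => by positivity
    have h2 : ∫ t in a..b, (x t + s * y t) ^ 2 = (∫ t in a..b, x t ^ 2) + ((2 * s) * (∫ t in a..b, x t * y t) + s ^ 2 * ∫ t in a..b, y t ^ 2) := by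
      rw [← intervalIntegral.integral_const_mul, ← intervalIntegral.integral_const_mul,
        ← intervalIntegral.integral_add (hi (by fun_prop)) (hi (by fun_prop)),
        ← intervalIntegral.integral_add (hi (by fun_prop)) (hi (by fun_prop))]
      congr 1; ext t; ring
    rw [h2] at h1
    linarith
  have := discrim_le_zero key
  rw [discrim] at this
  nlinarith

theorem quad_mean {F : ℂ → ℂ} (hF : DifferentiableOn ℂ F (ball 0 1)) (A : ℂ) {r : ℝ} (hr0 : 0 ≤ r) (hr : r < 1) :
    ∫ θ in (0:ℝ)..(2 * Real.pi), ‖F (r * exp (θ * I)) - A‖ ^ 2 =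
      (∫ θ in (0:ℝ)..(2 * Real.pi), ‖F (r * exp (θ * I))‖ ^ 2) - 4 * Real.pi * (F 0 * (starRingEnd ℂ) A).re + 2 * Real.pi * ‖A‖ ^ 2 := by
  have hc := circ_comp_cont hF.continuousOn hr0 hr
  have h1 := circ_re0 (F := fun w => F w * (starRingEnd ℂ) A) (hF.mul_const _) hr0 hr
  have e : ∀ z : ℂ, ‖z - A‖ ^ 2 = ‖z‖ ^ 2 - 2 * (z * (starRingEnd ℂ) A).re + ‖A‖ ^ 2 := by
    intro z
    simp only [Complex.sq_norm, Complex.normSq_sub]; ring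
  simp_rw [e]
  have c1 : Continuous fun θ : ℝ => ‖F (r * exp (θ * I))‖ ^ 2 := hc.norm.pow 2
  have c2 : Continuous fun θ : ℝ => 2 * (F (r * exp (θ * I)) * (starRingEnd ℂ) A).re :=
    continuous_const.mul (Complex.continuous_re.comp (hc.mul continuous_const))
  have c12 : Continuous fun θ : ℝ => ‖F (r * exp (θ * I))‖ ^ 2 - 2 * (F (r * exp (θ * I)) * (starRingEnd ℂ) A).re := c1.sub c2
  rw [intervalIntegral.integral_add (c12.intervalIntegrable _ _) (by simp), intervalIntegral.integral_sub (c1.intervalIntegrable _ _) (c2.intervalIntegrable _ _),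
    intervalIntegral.integral_const_mul, h1]
  simp
  ring

theorem arc_sup {H : ℂ → ℂ} (hH : DifferentiableOn ℂ H (ball 0 1)) (h0 : H 0 = 0) {r : ℝ} (hr0 : 0 ≤ r) (hr : r < 1)
    {α : ℝ} (hα : α ∈ Icc 0 (2 * Real.pi)) :
    ‖H (r * exp (α * I))‖ ≤ r * ∫ θ in (0:ℝ)..(2 * Real.pi), ‖deriv H (r * exp (θ * I))‖ := by
  have hpi := Real.pi_pos
  have hd := circ_hasDerivAt (F := H) (F' := deriv H)
    (fun z hz => (hH.differentiableAt (isOpen_ball.mem_nhds hz)).hasDerivAt) hr0 hr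
  have hc1 := circ_comp_cont (hH.deriv isOpen_ball).continuousOn hr0 hr
  have hc0 := circ_comp_cont hH.continuousOn hr0 hr
  have hc : Continuous fun θ : ℝ => deriv H (r * exp (θ * I)) * (r * (exp (θ * I) * I)) := hc1.mul (by fun_prop)
  set M := r * ∫ θ in (0:ℝ)..(2 * Real.pi), ‖deriv H (r * exp (θ * I))‖ with hM
  have hn : ∀ θ : ℝ, ‖deriv H (r * exp (θ * I)) * (r * (exp (θ * I) * I))‖ = r * ‖deriv H (r * exp (θ * I))‖ := by
    intro θ
    rw [norm_mul, norm_mul, norm_mul, Complex.norm_exp_ofReal_mul_I]; simp [abs_of_nonneg hr0]; ring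
  have hM0 : 0 ≤ M := mul_nonneg hr0 (intervalIntegral.integral_nonneg (by positivity) fun _ _ => norm_nonneg _)
  have hlt : ∀ x y : ℝ, 0 ≤ x → x ≤ y → y ≤ 2 * Real.pi → ‖H (r * exp (y * I)) - H (r * exp (x * I))‖ ≤ M := by
    intro x y hx hxy hy
    rw [← intervalIntegral.integral_eq_sub_of_hasDerivAt (fun θ _ => hd θ) (hc.intervalIntegrable _ _)]
    refine (intervalIntegral.norm_integral_le_integral_norm hxy).trans ?_
    simp_rw [hn]
    rw [hM, ← intervalIntegral.integral_const_mul]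
    refine intervalIntegral.integral_mono_interval hx hxy hy (Eventually.of_forall fun θ => ?_) ((continuous_const.mul hc1.norm).intervalIntegrable _ _)
    exact mul_nonneg hr0 (norm_nonneg _)
  have hdiff : ∀ β ∈ Icc 0 (2 * Real.pi), ‖H (r * exp (α * I)) - H (r * exp ((β:ℝ) * I))‖ ≤ M := by
    intro β hβ
    rcases le_total α β with h | h
    · rw [norm_sub_rev]; exact hlt α β hα.1 h hβ.2
    · exact hlt β α hβ.1 h hα.2
  have hmean := circ_mean0 hH hr0 hr
  rw [h0, mul_zero] at hmean
  have e : ∫ β in (0:ℝ)..(2 * Real.pi), (H (r * exp (α * I)) - H (r * exp (β * I))) = (2 * Real.pi : ℝ) • H (r * exp (α * I)) := by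
    rw [intervalIntegral.integral_sub (by simp) (hc0.intervalIntegrable _ _), hmean, sub_zero, intervalIntegral.integral_const, sub_zero]
  have h2 := intervalIntegral.norm_integral_le_of_norm_le_const (a := 0) (b := 2 * Real.pi) (C := M)
    (f := fun β : ℝ => H (r * exp (α * I)) - H (r * exp (β * I))) (fun β hβ => hdiff β (by
      rw [uIoc_of_le (by positivity)] at hβ; exact ⟨hβ.1.le, hβ.2⟩))
  rw [e, norm_smul, Real.norm_of_nonneg (by positivity), sub_zero, abs_of_pos (by positivity), mul_comm] at h2
  exact le_of_mul_le_mul_right h2 (by positivity)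

section
variable {D : JordanDomain} {ψ k : ℂ → ℂ} {g : ℝ → ℂ} {σ h : ℝ → ℝ} {p : ℕ → Polynomial ℂ} {ζ : ℂ}

theorem Setup.fk_diff (P : Setup D ψ g σ h) (hk : DifferentiableOn ℂ k (ball 0 1)) (q : Polynomial ℂ) :
    DifferentiableOn ℂ (fun w => q.eval (ψ w) * k w) (ball 0 1) := (P.fq_diff q).mul hk

theorem Setup.fk_mean (P : Setup D ψ g σ h) (hp : D.IsONPolys p)
    (hk2 : ∀ w ∈ ball (0:ℂ) 1, k w ^ 2 = deriv ψ w) (n : ℕ) {r : ℝ} (hr0 : 0 ≤ r) (hr : r < 1) :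
    r * (∫ θ in (0:ℝ)..(2 * Real.pi), ‖(Spoly p (ψ 0) n).eval (ψ (r * exp (θ * I))) * k (r * exp (θ * I))‖ ^ 2) ≤
      D.l * Kn p (ψ 0) n := by
  have := P.poly_mean (Spoly p (ψ 0) n) hr0 hr
  rw [Spoly_bN hp] at this
  rw [mul_comm]
  refine le_trans (le_of_eq ?_) this
  congr 2
  ext θ
  rw [norm_mul, mul_pow, ← hk2 _ (circ_mem hr0 hr θ), norm_pow (k _)]

theorem Setup.fk_dist (P : Setup D ψ g σ h) (hp : D.IsONPolys p) (hk : DifferentiableOn ℂ k (ball 0 1))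
    (hk2 : ∀ w ∈ ball (0:ℂ) 1, k w ^ 2 = deriv ψ w) (n : ℕ) {r : ℝ} (hr0 : 0 ≤ r) (hr : r < 1) :
    r * (∫ θ in (0:ℝ)..(2 * Real.pi), ‖(Spoly p (ψ 0) n).eval (ψ (r * exp (θ * I))) * k (r * exp (θ * I)) - kap D ψ * k 0‖ ^ 2) ≤
      D.l * (Kn p (ψ 0) n - 2 * r * Kn p (ψ 0) n + r * kap D ψ) := by
  have hpi := Real.pi_pos
  have h1 := quad_mean (P.fk_diff hk (Spoly p (ψ 0) n)) (kap D ψ * k 0) hr0 hr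
  beta_reduce at h1
  rw [h1]
  have h2 := P.fk_mean hp hk2 n hr0 hr
  have hk0 : ‖k 0‖ ^ 2 = ‖deriv ψ 0‖ := by rw [← hk2 0 (by simp), norm_pow]
  have e1 : ((Spoly p (ψ 0) n).eval (ψ 0) * k 0 * (starRingEnd ℂ) (kap D ψ * k 0)).re = Kn p (ψ 0) n * (kap D ψ * ‖deriv ψ 0‖) := by
    rw [Spoly_self, map_mul, Complex.conj_ofReal, ← hk0]
    have : (Kn p (ψ 0) n : ℂ) * k 0 * (kap D ψ * (starRingEnd ℂ) (k 0)) = ((Kn p (ψ 0) n * (kap D ψ * ‖k 0‖ ^ 2) : ℝ) : ℂ) := by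
      push_cast
      rw [← Complex.mul_conj']; ring
    rw [this, Complex.ofReal_re]
  have e2 : ‖(kap D ψ : ℂ) * k 0‖ ^ 2 = kap D ψ * (kap D ψ * ‖deriv ψ 0‖) := by
    rw [norm_mul, mul_pow, hk0, Complex.norm_real, Real.norm_eq_abs, sq_abs]; ring
  rw [e1, e2, P.kap_mul]
  have e3 : 4 * Real.pi * (Kn p (ψ 0) n * (D.l / (2 * Real.pi))) = 2 * Kn p (ψ 0) n * D.l := by field_simp; ring
  have e4 : 2 * Real.pi * (kap D ψ * (D.l / (2 * Real.pi))) = kap D ψ * D.l := by field_simp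
  rw [e3, e4]
  nlinarith

theorem Setup.szego_id (P : Setup D ψ g σ h) (hp : D.IsONPolys p) (hk : DifferentiableOn ℂ k (ball 0 1))
    (hk2 : ∀ w ∈ ball (0:ℂ) 1, k w ^ 2 = deriv ψ w) (hK : Tendsto (Kn p (ψ 0)) atTop (nhds (kap D ψ))) {w : ℂ} (hw : ‖w‖ < 1) :
    szegoKernel p (ψ 0) (ψ w) * k w = kap D ψ * k 0 := by
  have hpi := Real.pi_pos
  have key : ∀ n, 2 * Real.pi * ‖(Spoly p (ψ 0) n).eval (ψ w) * k w - kap D ψ * k 0‖ ^ 2 ≤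
      1 / (1 - ‖w‖) * (D.l * (kap D ψ - Kn p (ψ 0) n)) := by
    intro n
    have hc : Tendsto (fun r : ℝ => 1 / (r - ‖w‖) * (D.l * (Kn p (ψ 0) n - 2 * r * Kn p (ψ 0) n + r * kap D ψ))) (nhdsWithin 1 (Iio 1))
        (nhds (1 / (1 - ‖w‖) * (D.l * (Kn p (ψ 0) n - 2 * 1 * Kn p (ψ 0) n + 1 * kap D ψ)))) := by
      refine Tendsto.mono_left ?_ nhdsWithin_le_nhds
      refine ContinuousAt.tendsto (f := fun r : ℝ => 1 / (r - ‖w‖) * (D.l * (Kn p (ψ 0) n - 2 * r * Kn p (ψ 0) n + r * kap D ψ))) ?_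
      refine ContinuousAt.mul (ContinuousAt.div (by fun_prop) (by fun_prop) ?_) (by fun_prop)
      linarith
    rw [show kap D ψ - Kn p (ψ 0) n = Kn p (ψ 0) n - 2 * 1 * Kn p (ψ 0) n + 1 * kap D ψ by ring]
    refine ge_of_tendsto hc ?_
    filter_upwards [Ioo_mem_nhdsLT hw] with r hr
    have hr0 : 0 < r := (norm_nonneg w).trans_lt hr.1
    have h1 := cauchy_bound (F := fun w => ((Spoly p (ψ 0) n).eval (ψ w) * k w - kap D ψ * k 0) ^ 2)
      (((P.fk_diff hk _).sub_const _).pow 2) hr.2 hr.1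
    simp only [norm_pow] at h1
    refine h1.trans ?_
    rw [div_mul_eq_mul_div, div_mul_eq_mul_div, one_mul]
    refine div_le_div_of_nonneg_right (P.fk_dist hp hk hk2 n hr0.le hr.2) ?_
    linarith [hr.1]
  have l1 : Tendsto (fun n => 1 / (1 - ‖w‖) * (D.l * (kap D ψ - Kn p (ψ 0) n))) atTop (nhds 0) := by
    have := ((hK.const_sub (kap D ψ)).const_mul D.l).const_mul (1 / (1 - ‖w‖))
    simpa using this
  have l2 := ((((P.szego_lim hp hw).mul_const (k w)).sub_const (kap D ψ * k 0)).norm.pow 2).const_mul (2 * Real.pi)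
  have h3 := le_of_tendsto_of_tendsto' l2 l1 key
  have h4 : ‖szegoKernel p (ψ 0) (ψ w) * k w - kap D ψ * k 0‖ ^ 2 ≤ 0 := by
    by_contra hc; push Not at hc
    have : 0 < 2 * Real.pi * ‖szegoKernel p (ψ 0) (ψ w) * k w - kap D ψ * k 0‖ ^ 2 := by positivity
    linarith
  have h5 := pow_eq_zero_iff (two_ne_zero) |>.mp (le_antisymm h4 (by positivity))
  exact sub_eq_zero.mp (norm_eq_zero.mp h5)

theorem Jfun_eq (n : ℕ) (z : ℂ) : Jfun D p ζ n z = (((2 * Real.pi / D.l : ℝ) : ℂ) / (Kn p ζ n : ℝ)) * polyInt ((Spoly p ζ n) ^ 2) ζ z := by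
  simp only [Jfun, Kn, Spoly, polyInt]
  push_cast
  rfl

theorem Setup.sup_bound (P : Setup D ψ g σ h) (hp : D.IsONPolys p) (hk : DifferentiableOn ℂ k (ball 0 1))
    (hk2 : ∀ w ∈ ball (0:ℂ) 1, k w ^ 2 = deriv ψ w) {u : ℂ} (hu1 : ‖u‖ = 1) (hu : u * ‖deriv ψ 0‖ = deriv ψ 0) (n : ℕ)
    {w : ℂ} (hw : w ∈ closedBall (0:ℂ) 1) :
    ‖u * w - Jfun D p (ψ 0) n (ψ w)‖ ≤ 8 * Real.pi * Real.sqrt (kap D ψ - Kn p (ψ 0) n) := by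
  have hpi := Real.pi_pos
  have hl := D.l_pos
  have hd := P.d_pos
  set S := Spoly p (ψ 0) n with hS
  set K := Kn p (ψ 0) n with hKd
  set κ := kap D ψ with hκ
  have hK1 : 1 ≤ K := Kn_one_le hp n
  have hKκ : K ≤ κ := P.Kn_le hp n
  have hκ0 : 0 < κ := by linarith
  have hκd : κ * ‖deriv ψ 0‖ = D.l / (2 * Real.pi) := P.kap_mul
  have hk0 : ‖k 0‖ ^ 2 = ‖deriv ψ 0‖ := by rw [← hk2 0 (by simp), norm_pow]
  have hk00 : k 0 ≠ 0 := by
    intro h; rw [h] at hk0; simp at hk0; exact (P.ne 0 (by simp)) (norm_eq_zero.mp hk0.symm)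
  set q := Real.sqrt (κ * K) with hq
  have hq0 : 0 < q := Real.sqrt_pos.mpr (by positivity)
  have hq2 : q ^ 2 = κ * K := Real.sq_sqrt (by positivity)
  have hqc : (q : ℂ) ≠ 0 := by exact_mod_cast hq0.ne'
  set G : ℂ → ℂ := fun w => S.eval (ψ w) * k w / (k 0 * q) with hG
  have hGd : DifferentiableOn ℂ G (ball 0 1) := (P.fk_diff hk S).div_const _
  set t := K / q with ht
  have ht2 : t ^ 2 = K / κ := by
    rw [ht, div_pow, hq2]; field_simp
  have hG0 : G 0 = t := by
    simp only [hG, hS, Spoly_self, ht]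
    push_cast
    field_simp
    rfl
  have hGm : ∀ r : ℝ, 0 ≤ r → r < 1 → r * (∫ θ in (0:ℝ)..(2 * Real.pi), ‖G (r * exp (θ * I))‖ ^ 2) ≤ 2 * Real.pi := by
    intro r hr0 hr
    have h1 := P.fk_mean hp hk2 n hr0 hr
    have e1 : ∀ w, ‖G w‖ ^ 2 = ‖S.eval (ψ w) * k w‖ ^ 2 * (1 / (‖deriv ψ 0‖ * (κ * K))) := by
      intro w
      simp only [hG]
      rw [norm_div, div_pow, norm_mul (k 0), mul_pow, hk0, Complex.norm_real, Real.norm_eq_abs, sq_abs, hq2, div_eq_mul_one_div]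
    simp_rw [e1]
    rw [intervalIntegral.integral_mul_const, ← mul_assoc]
    refine (mul_le_mul_of_nonneg_right h1 (by positivity)).trans (le_of_eq ?_)
    have : ‖deriv ψ 0‖ * (κ * K) = D.l / (2 * Real.pi) * K := by rw [← hκd]; ring
    rw [this]; field_simp; rfl
  set H : ℂ → ℂ := fun w => u * w - Jfun D p (ψ 0) n (ψ w) with hH
  have hHder : ∀ w ∈ ball (0:ℂ) 1, HasDerivAt H (u * (1 - G w ^ 2)) w := by
    intro w hw
    have hψ := (P.diff.differentiableAt (isOpen_ball.mem_nhds hw)).hasDerivAt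
    have h1 : HasDerivAt (fun w => polyInt (S ^ 2) (ψ 0) (ψ w)) ((S ^ 2).eval (ψ w) * deriv ψ w) w :=
      (polyInt_hasDerivAt (S ^ 2) (ψ 0) (ψ w)).comp w hψ
    have h2 := ((hasDerivAt_id w).const_mul u).sub (h1.const_mul (((2 * Real.pi / D.l : ℝ) : ℂ) / (K : ℝ)))
    have h3 : H = fun w => u * id w - ((2 * Real.pi / D.l : ℝ) : ℂ) / (K : ℝ) * polyInt (S ^ 2) (ψ 0) (ψ w) := by
      ext w; simp only [hH, Jfun_eq]; rfl
    rw [h3]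
    refine HasDerivAt.congr_deriv h2 ?_
    have e1 : (2 * Real.pi / D.l : ℝ) = 1 / (κ * ‖deriv ψ 0‖) := by rw [hκd]; field_simp
    have hdc : ((‖deriv ψ 0‖ : ℝ) : ℂ) ≠ 0 := by exact_mod_cast hd.ne'
    have hκc : (κ : ℂ) ≠ 0 := by exact_mod_cast hκ0.ne'
    have hKc : (K : ℂ) ≠ 0 := by exact_mod_cast (by linarith : K ≠ 0)
    have hqc2 : (q : ℂ) ^ 2 = κ * K := by exact_mod_cast hq2
    have hu0 : u ≠ 0 := by intro h; rw [h] at hu1; simp at hu1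
    have e2 : G w ^ 2 = S.eval (ψ w) ^ 2 * deriv ψ w / (u * ‖deriv ψ 0‖ * (κ * K)) := by
      simp only [hG]
      rw [div_pow, mul_pow, mul_pow, hk2 w hw, hqc2, hk2 0 (by simp), hu]
    rw [e1, e2, Polynomial.eval_pow]
    push_cast
    field_simp
  have hHd : DifferentiableOn ℂ H (ball 0 1) := fun w hw => (hHder w hw).differentiableAt.differentiableWithinAt
  have hH0 : H 0 = 0 := by
    simp only [hH, Jfun_eq, polyInt]; simp
  have hHc : ContinuousOn H (closedBall 0 1) := by
    have h1 : Continuous fun z => Jfun D p (ψ 0) n z := by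
      have : Continuous (polyInt (S ^ 2) (ψ 0)) := continuous_iff_continuousAt.mpr fun z => (polyInt_hasDerivAt (S ^ 2) (ψ 0) z).continuousAt
      simp_rw [Jfun_eq]
      exact continuous_const.mul this
    exact (by fun_prop : ContinuousOn (fun w => u * w) (closedBall 0 1)).sub (h1.comp_continuousOn P.cont)
  have hcirc : ∀ r : ℝ, 0 ≤ r → r < 1 → ∀ α ∈ Icc 0 (2 * Real.pi), ‖H (r * exp ((α:ℝ) * I))‖ ^ 2 ≤ (2 * Real.pi) ^ 2 * ((1 + r) ^ 2 - 4 * r ^ 2 * t ^ 2) := by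
    intro r hr0 hr α hα
    have h1 := arc_sup hHd hH0 hr0 hr hα
    have hcG := circ_comp_cont hGd.continuousOn hr0 hr
    have e1 : ∀ θ : ℝ, ‖deriv H (r * exp (θ * I))‖ = ‖G (r * exp (θ * I)) - 1‖ * ‖G (r * exp (θ * I)) - (-1)‖ := by
      intro θ
      rw [(hHder _ (circ_mem hr0 hr θ)).deriv, norm_mul, hu1, one_mul, ← norm_mul, ← norm_neg]
      congr 1; ring
    simp_rw [e1] at h1
    have h2 := cs_cont (hcG.sub continuous_const).norm (hcG.sub continuous_const).norm (a := 0) (b := 2 * Real.pi) (by positivity)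
      (x := fun θ : ℝ => ‖G (r * exp (θ * I)) - 1‖) (y := fun θ : ℝ => ‖G (r * exp (θ * I)) - (-1)‖)
    rw [quad_mean hGd 1 hr0 hr, quad_mean hGd (-1) hr0 hr, hG0] at h2
    have h3 := hGm r hr0 hr
    set B := ∫ θ in (0:ℝ)..(2 * Real.pi), ‖G (r * exp (θ * I))‖ ^ 2 with hB
    have hB0 : 0 ≤ B := intervalIntegral.integral_nonneg (by positivity) fun _ _ => by positivity
    simp only [map_one, map_neg, mul_one, mul_neg, Complex.ofReal_re, Complex.neg_re, norm_one, norm_neg, one_pow] at h2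
    set X := ∫ θ in (0:ℝ)..(2 * Real.pi), ‖G (r * exp (θ * I)) - 1‖ * ‖G (r * exp (θ * I)) - (-1)‖ with hX
    have h4 : ‖H (r * exp ((α:ℝ) * I))‖ ^ 2 ≤ (r * X) ^ 2 := pow_le_pow_left₀ (norm_nonneg _) h1 2
    refine h4.trans ?_
    have h5 : (r * X) ^ 2 ≤ (r * B + 2 * Real.pi * r) ^ 2 - (4 * Real.pi * r * t) ^ 2 := by
      have := mul_le_mul_of_nonneg_left h2 (sq_nonneg r)
      nlinarith
    have h6 : (r * B + 2 * Real.pi * r) ^ 2 ≤ (2 * Real.pi + 2 * Real.pi * r) ^ 2 :=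
      pow_le_pow_left₀ (by positivity) (by linarith) 2
    nlinarith
  have hbd : ∀ w ∈ sphere (0:ℂ) 1, ‖H w‖ ≤ 8 * Real.pi * Real.sqrt (κ - K) := by
    intro w hw
    obtain ⟨α, hα, rfl⟩ : ∃ α ∈ Icc 0 (2 * Real.pi), exp ((α:ℝ) * I) = w := by
      have h1 : w ∈ circleMap 0 1 '' Ioc 0 (2 * Real.pi) := by
        rw [image_circleMap_Ioc]; simpa using hw
      obtain ⟨α, hα, hαw⟩ := h1
      exact ⟨α, ⟨hα.1.le, hα.2⟩, by simpa [circleMap] using hαw⟩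
    have l1 : Tendsto (fun n => H (rr n * exp ((α:ℝ) * I))) atTop (nhds (H (exp (α * I)))) := by
      refine (hHc _ (sphere_subset_closedBall hw)).tendsto.comp (tendsto_nhdsWithin_of_tendsto_nhds_of_eventually_within _ ?_ ?_)
      · have : Tendsto (fun n => ((rr n : ℝ) : ℂ)) atTop (nhds ((1:ℝ) : ℂ)) :=
          (Complex.continuous_ofReal.tendsto 1).comp rr_tendsto'
        simpa using this.mul_const (exp (α * I))
      · exact Eventually.of_forall fun n => ball_subset_closedBall (circ_mem (rr_nonneg n) (rr_lt n) α)
    have c2 : Continuous fun r : ℝ => (2 * Real.pi) ^ 2 * ((1 + r) ^ 2 - 4 * r ^ 2 * t ^ 2) := by fun_prop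
    have l2 := (c2.tendsto 1).comp rr_tendsto'
    have h1 := le_of_tendsto_of_tendsto' (l1.norm.pow 2) l2 fun n => hcirc _ (rr_nonneg n) (rr_lt n) α hα
    have h2 : (2 * Real.pi) ^ 2 * ((1 + 1) ^ 2 - 4 * 1 ^ 2 * t ^ 2) ≤ (8 * Real.pi * Real.sqrt (κ - K)) ^ 2 := by
      rw [mul_pow (8 * Real.pi), Real.sq_sqrt (by linarith), ht2]
      have : 1 - K / κ ≤ κ - K := by
        rw [one_sub_div hκ0.ne', div_le_iff₀ hκ0]
        nlinarith
      have h3 : 0 ≤ κ - K := by linarith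
      nlinarith [sq_nonneg Real.pi]
    exact (pow_le_pow_iff_left₀ (norm_nonneg _) (by positivity) two_ne_zero).mp (h1.trans h2)
  refine Complex.norm_le_of_forall_mem_frontier_norm_le (f := H) (U := ball 0 1) isBounded_ball ⟨hHd, ?_⟩ ?_ ?_
  · rw [closure_ball _ one_ne_zero]; exact hHc
  · rw [frontier_ball _ one_ne_zero]; exact hbd
  · rw [closure_ball _ one_ne_zero]; exact hw

end

theorem bloch_weak {L L' : ℂ → ℂ} (hL : ∀ w ∈ ball (0:ℂ) 1, HasDerivAt L (L' w) w)
    (h2 : ∀ w ∈ ball (0:ℂ) 1, ∀ v ∈ ball (0:ℂ) 1, L v ≠ L w + 2 * Real.pi * I)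
    {ρ : ℝ} (hρ0 : 0 ≤ ρ) (hρ : ρ < 1) {w : ℂ} (hw : w ∈ closedBall (0:ℂ) ρ) :
    (ρ - ‖w‖) * ‖L' w‖ ≤ 96 * Real.pi := by
  have hpi := Real.pi_pos
  have hLd : DifferentiableOn ℂ L (ball 0 1) := fun w hw => (hL w hw).differentiableAt.differentiableWithinAt
  have hL'd : DifferentiableOn ℂ L' (ball 0 1) :=
    (hLd.deriv isOpen_ball).congr fun w hw => (hL w hw).deriv.symm
  have hsub : closedBall (0:ℂ) ρ ⊆ ball 0 1 := closedBall_subset_ball hρ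
  obtain ⟨v, hv, hmax⟩ := (isCompact_closedBall (0:ℂ) ρ).exists_isMaxOn ⟨w, hw⟩
    (f := fun w => (ρ - ‖w‖) * ‖L' w‖) ((by fun_prop : Continuous fun w : ℂ => ρ - ‖w‖).continuousOn.mul (hL'd.continuousOn.mono hsub).norm)
  refine (hmax hw).trans ?_
  beta_reduce
  by_contra! hM
  have hvρ : ‖v‖ ≤ ρ := by simpa using hv
  have hpos : 0 < (ρ - ‖v‖) * ‖L' v‖ := by linarith
  have hvρ' : 0 < ρ - ‖v‖ := by
    rcases (sub_nonneg.mpr hvρ).eq_or_lt with h | h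
    · rw [← h] at hpos; simp at hpos
    · exact h
  set A := ‖L' v‖ with hA
  have hA0 : 0 < A := pos_of_mul_pos_right hpos hvρ'.le
  set t := (ρ - ‖v‖) / 2 with ht
  have ht0 : 0 < t := by positivity
  have hball : ∀ z ∈ ball v t, ‖z‖ ≤ ρ - t := by
    intro z hz
    have h1 : ‖z - v‖ < t := by simpa [dist_eq_norm] using hz
    have h2 : ‖z‖ ≤ ‖z - v‖ + ‖v‖ := by simpa using norm_add_le (z - v) v
    linarith
  have hbs : ball v t ⊆ ball 0 1 := fun z hz => by
    have := hball z hz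
    simp; linarith
  have hb : ∀ z ∈ ball v t, ‖L' z‖ ≤ 2 * A := by
    intro z hz
    have h1 := hball z hz
    have h3 : (ρ - ‖z‖) * ‖L' z‖ ≤ (ρ - ‖v‖) * A := hmax (show z ∈ closedBall (0:ℂ) ρ by simp; linarith)
    have h4 : t * ‖L' z‖ ≤ (ρ - ‖z‖) * ‖L' z‖ := by gcongr; linarith
    have h5 : t * ‖L' z‖ ≤ t * (2 * A) := by
      have : (ρ - ‖v‖) * A = t * (2 * A) := by rw [ht]; ring
      linarith
    exact le_of_mul_le_mul_left h5 ht0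
  have hsch : ∀ z ∈ ball v t, ‖L' z - L' v‖ ≤ 3 * A / t * ‖z - v‖ := by
    intro z hz
    have := Complex.dist_le_div_mul_dist_of_mapsTo_ball (R₂ := 3 * A) (hL'd.mono hbs) (fun y hy => by
      rw [mem_closedBall, dist_eq_norm]
      have := norm_sub_le (L' y) (L' v)
      linarith [hb y hy]) hz
    simpa [dist_eq_norm] using this
  set s := t / 6 with hs
  have hs0 : 0 < s := by positivity
  have hss : closedBall v s ⊆ ball v t := closedBall_subset_ball (by rw [hs]; linarith)
  have hmv : ∀ z ∈ closedBall v s, ‖(L z - L' v * z) - (L v - L' v * v)‖ ≤ A / 2 * ‖z - v‖ := by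
    intro z hz
    refine (convex_closedBall v s).norm_image_sub_le_of_norm_hasDerivWithin_le (𝕜 := ℂ) (f := fun z => L z - L' v * z)
      (f' := fun z => L' z - L' v) (fun y hy => ?_) (fun y hy => ?_) (mem_closedBall_self hs0.le) hz
    · have := (hL y (hbs (hss hy))).sub ((hasDerivAt_id y).const_mul (L' v))
      simp only [mul_one] at this
      exact this.hasDerivWithinAt
    · refine (hsch y (hss hy)).trans ?_
      have h1 : ‖y - v‖ ≤ s := by simpa [dist_eq_norm] using hy
      calc 3 * A / t * ‖y - v‖ ≤ 3 * A / t * s := by gcongr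
        _ = A / 2 := by rw [hs]; field_simp; ring
  have hlow : ∀ z ∈ closedBall v s, A / 2 * ‖z - v‖ ≤ ‖L z - L v‖ := by
    intro z hz
    have h1 := hmv z hz
    have h3 : L' v * (z - v) = (L z - L v) - ((L z - L' v * z) - (L v - L' v * v)) := by ring
    have h4 := norm_sub_le (L z - L v) ((L z - L' v * z) - (L v - L' v * v))
    rw [← h3, norm_mul] at h4
    linarith
  have himg := DiffContOnCl.ball_subset_image_closedBall (f := L) (z₀ := v) (r := s) (ε := A / 2 * s)
    ((hLd.mono (hss.trans hbs)).diffContOnCl_ball subset_rfl)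
    hs0 (fun z hz => by
      have h1 := hlow z (sphere_subset_closedBall hz)
      have h3 : ‖z - v‖ = s := by simpa [dist_eq_norm] using hz
      rwa [h3] at h1) (by
      have h1 : ∀ᶠ z in nhdsWithin v {v}ᶜ, L z ≠ L v := by
        filter_upwards [self_mem_nhdsWithin, mem_nhdsWithin_of_mem_nhds (closedBall_mem_nhds v hs0)] with z hz hz2
        have h1 := hlow z hz2
        intro he
        rw [he, sub_self, norm_zero] at h1
        have h3 : 0 < ‖z - v‖ := norm_pos_iff.mpr (sub_ne_zero.mpr hz)
        have : 0 < A / 2 * ‖z - v‖ := by positivity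
        linarith
      exact h1.frequently.filter_mono nhdsWithin_le_nhds)
  have hin : L v + 2 * Real.pi * I ∈ ball (L v) (A / 2 * s / 2) := by
    rw [mem_ball, dist_eq_norm]
    have : ‖L v + 2 * Real.pi * I - L v‖ = 2 * Real.pi := by
      rw [add_sub_cancel_left]; simp [abs_of_pos hpi]
    rw [this]
    have : A / 2 * s / 2 = (ρ - ‖v‖) * A / 48 := by rw [hs, ht]; ring
    rw [this]; linarith
  obtain ⟨z, hz, hze⟩ := himg hin
  exact h2 v (hsub hv) z (hbs (hss hz)) hze

theorem koebe_weak {f : ℂ → ℂ} (hf : DifferentiableOn ℂ f (ball 0 1)) (hi : InjOn f (ball 0 1)) {a : ℂ}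
    (ha : ∀ w ∈ ball (0:ℂ) 1, f w ≠ a) {w : ℂ} (hw : ‖w‖ < 1) :
    (1 - ‖w‖) * ‖deriv f w‖ ≤ 96 * Real.pi * ‖f w - a‖ := by
  obtain ⟨L, c, hL⟩ := exists_hlog (f := fun w => f w - a) (hf.sub_const a) (fun w hw => sub_ne_zero.mpr (ha w hw))
  have hwb : w ∈ ball (0:ℂ) 1 := by simpa using hw
  have key : ∀ ρ ∈ Ioo ‖w‖ 1, (ρ - ‖w‖) * ‖deriv (fun w => f w - a) w / (f w - a)‖ ≤ 96 * Real.pi := by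
    intro ρ hρ
    refine bloch_weak (L' := fun w => deriv (fun w => f w - a) w / (f w - a)) (fun w hw => (hL w hw).1) (fun w hw v hv he => ?_) ((norm_nonneg w).trans hρ.1.le) hρ.2 (by simpa using hρ.1.le)
    have h1 : f v - a = f w - a := by
      rw [(hL v hv).2, (hL w hw).2, he, Complex.exp_add, Complex.exp_two_pi_mul_I, mul_one]
    have h3 : v = w := hi hv hw (by simpa using h1)
    rw [h3] at he
    simp [Real.pi_ne_zero] at he
  have hlim : Tendsto (fun ρ : ℝ => (ρ - ‖w‖) * ‖deriv (fun w => f w - a) w / (f w - a)‖) (nhdsWithin 1 (Iio 1))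
      (nhds ((1 - ‖w‖) * ‖deriv (fun w => f w - a) w / (f w - a)‖)) :=
    tendsto_nhdsWithin_of_tendsto_nhds ((by fun_prop : Continuous fun ρ : ℝ => (ρ - ‖w‖) * ‖deriv (fun w => f w - a) w / (f w - a)‖).tendsto 1)
  have h1 := le_of_tendsto hlim (by filter_upwards [Ioo_mem_nhdsLT hw] with ρ hρ using key ρ hρ)
  have h0 : 0 < ‖f w - a‖ := norm_pos_iff.mpr (sub_ne_zero.mpr (ha w hwb))
  rwa [norm_div, deriv_sub_const, ← mul_div_assoc, div_le_iff₀ h0] at h1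

section
variable {D : JordanDomain} {ψ : ℂ → ℂ} {g : ℝ → ℂ} {σ h : ℝ → ℝ} {p : ℕ → Polynomial ℂ} {k : ℂ → ℂ}

theorem DiskParam.koebe (P : DiskParam D ψ g σ) {w : ℂ} (hw : ‖w‖ < 1) :
    (1 - ‖w‖) * ‖deriv ψ w‖ ≤ 96 * Real.pi * infDist (ψ w) (frontier D.G) := by
  have hc : IsCompact (frontier D.G) := Metric.isCompact_of_isClosed_isBounded isClosed_frontier
    (D.bounded.closure.subset frontier_subset_closure)
  obtain ⟨a, ha, he⟩ := hc.exists_infDist_eq_dist ⟨_, D.γ_mem 0⟩ (ψ w)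
  rw [he, dist_eq_norm]
  refine koebe_weak P.diff P.bij.injOn (fun v hv h => ?_) hw
  have h1 := P.bij.mapsTo hv
  rw [h, ← D.isOpen.interior_eq] at h1
  exact ha.2 h1

theorem Setup.radial_cone (P : Setup D ψ g σ h) {θ : ℝ}
    (hθ : Tendsto (fun r : ℝ => ‖deriv ψ ((r : ℂ) * exp ((θ : ℂ) * I))‖) (nhdsWithin 1 (Iio 1)) (nhds (Real.exp (h θ)))) :
    ∀ᶠ r : ℝ in nhdsWithin 1 (Iio 1), ‖ψ (r * exp (θ * I)) - ψ (exp (θ * I))‖ ≤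
      (384 * Real.pi) * infDist (ψ (r * exp (θ * I))) (frontier D.G) := by
  have hE := Real.exp_pos (h θ)
  set E := Real.exp (h θ) with hEd
  have h1 : ∀ᶠ r : ℝ in nhdsWithin 1 (Iio 1), ‖deriv ψ ((r : ℂ) * exp ((θ : ℂ) * I))‖ ∈ Ioo (E / 2) (2 * E) :=
    hθ.eventually (Ioo_mem_nhds (by linarith) (by linarith))
  obtain ⟨a, ha1, ha⟩ := mem_nhdsLT_iff_exists_Ioo_subset.mp (inter_mem h1 (Ioo_mem_nhdsLT (zero_lt_one (α := ℝ))))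
  filter_upwards [Ioo_mem_nhdsLT ha1] with r hr
  have hr1 := ha hr
  have hn : ∀ x : ℝ, 0 < x → ‖(x:ℂ) * exp (θ * I)‖ = x := fun x hx => by
    simp [Complex.norm_exp_ofReal_mul_I, abs_of_pos hx]
  have hder : ∀ x ∈ Ioo a 1, HasDerivAt (fun t : ℝ => ψ (t * exp (θ * I))) (deriv ψ (x * exp (θ * I)) * exp (θ * I)) x := by
    intro x hx
    have h1 := (P.diff.differentiableAt (isOpen_ball.mem_nhds (circ_mem (ha hx).2.1.le hx.2 θ))).hasDerivAt
    have h2 : HasDerivAt (fun t : ℝ => (t : ℂ) * exp (θ * I)) (exp (θ * I)) x := by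
      simpa using (Complex.ofRealCLM.hasDerivAt (x := x)).mul_const (exp (θ * I))
    exact h1.comp x h2
  have hseg : ∀ x ∈ Ioo r 1, ‖ψ (x * exp (θ * I)) - ψ (r * exp (θ * I))‖ ≤ 2 * E * (x - r) := by
    intro x hx
    refine norm_image_sub_le_of_norm_deriv_le_segment' (f := fun t : ℝ => ψ (t * exp (θ * I))) (a := r) (b := x)
      (f' := fun x : ℝ => deriv ψ (x * exp (θ * I)) * exp (θ * I))
      (fun y hy => (hder y ⟨hr.1.trans_le hy.1, hy.2.trans_lt hx.2⟩).hasDerivWithinAt) (fun y hy => ?_) x ⟨hx.1.le, le_rfl⟩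
    rw [norm_mul, Complex.norm_exp_ofReal_mul_I, mul_one]
    exact (ha ⟨hr.1.trans_le hy.1, hy.2.trans hx.2⟩).1.2.le
  have hend : ‖ψ (exp (θ * I)) - ψ (r * exp (θ * I))‖ ≤ 2 * E * (1 - r) := by
    refine le_of_tendsto_of_tendsto ((bdry_tendsto P.toDiskParam θ).sub_const _).norm
      ((rr_tendsto'.sub_const r).const_mul (2 * E)) ?_
    filter_upwards [rr_tendsto.eventually (Ioo_mem_nhdsLT hr.2)] with n hn using hseg _ hn
  have hk := P.koebe (w := r * exp (θ * I)) (by rw [hn r hr1.2.1]; exact hr.2)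
  rw [hn r hr1.2.1] at hk
  rw [norm_sub_rev]
  have h5 : (1 - r) * (E / 2) ≤ (1 - r) * ‖deriv ψ (r * exp (θ * I))‖ := by
    have := hr.2; have := hr1.1.1; gcongr
  linarith

theorem Setup.ntlim_radial (P : Setup D ψ g σ h) {K : ℂ → ℂ} {Kg : ℝ → ℂ}
    (hK : ∀ᵐ s ∂(volume.restrict (Ioc (0 : ℝ) D.l)), NTLim D.G K (g s) (Kg s)) :
    ∀ᵐ θ : ℝ ∂mu0, Tendsto (fun n => K (ψ (rr n * exp (θ * I)))) atTop (nhds (Kg (σ θ))) := by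
  rw [← P.map_eq] at hK
  have h1 := ae_of_ae_map P.σ_cont.aemeasurable hK
  have h2 : mu0.AbsolutelyContinuous (muE h) := withDensity_absolutelyContinuous' P.exp_int.1.1.aemeasurable.ennreal_ofReal
    (Eventually.of_forall fun θ => by simp [Real.exp_pos])
  filter_upwards [h2.ae_le h1, P.lim_norm] with θ hθ hn
  refine (hθ (384 * Real.pi) (by linarith [Real.pi_gt_three])).comp (tendsto_nhdsWithin_of_tendsto_nhds_of_eventually_within _ ?_ ?_)
  · rw [← P.bdry]; exact bdry_tendsto P.toDiskParam θ
  · filter_upwards [rr_tendsto.eventually (P.radial_cone hn)] with n hn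
    rw [← P.bdry]
    exact ⟨P.bij.mapsTo (circ_mem (rr_nonneg n) (rr_lt n) θ), hn⟩

theorem Setup.σ_inj (P : Setup D ψ g σ h) : Function.Injective σ := by
  intro x y hxy
  have h1 : exp ((x:ℝ) * I) = exp ((y:ℝ) * I) := P.bijs.injOn (by simp [Complex.norm_exp_ofReal_mul_I])
    (by simp [Complex.norm_exp_ofReal_mul_I]) (by rw [P.bdry, P.bdry, hxy])
  obtain ⟨n, hn⟩ := Complex.exp_eq_exp_iff_exists_int.mp h1
  have h2 : x = y + n * (2 * Real.pi) := by
    have := congrArg Complex.im hn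
    simpa using this
  have h3 := P.σ_add_int y n
  rw [← h2, hxy] at h3
  have h4 : (n : ℝ) * D.l = 0 := by linarith
  have h5 : (n : ℝ) = 0 := by simpa [D.l_pos.ne'] using h4
  rw [h2, h5]; ring

theorem Setup.L2_upper (P : Setup D ψ g σ h) (hp : D.IsONPolys p) (hk : DifferentiableOn ℂ k (ball 0 1))
    (hk2 : ∀ w ∈ ball (0:ℂ) 1, k w ^ 2 = deriv ψ w) (hK : Tendsto (Kn p (ψ 0)) atTop (nhds (kap D ψ)))
    {Kg : ℝ → ℂ}
    (hKg : ∀ᵐ s ∂(volume.restrict (Ioc (0 : ℝ) D.l)), NTLim D.G (szegoKernel p (ψ 0)) (g s) (Kg s)) (n : ℕ) :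
    Integrable (fun s => ‖Kg s - (Spoly p (ψ 0) n).eval (g s)‖ ^ 2) (volume.restrict (Ioc (0:ℝ) D.l)) ∧
    ∫ s, ‖Kg s - (Spoly p (ψ 0) n).eval (g s)‖ ^ 2 ∂(volume.restrict (Ioc (0:ℝ) D.l)) ≤ D.l * (kap D ψ - Kn p (ψ 0) n) := by
  set S := Spoly p (ψ 0) n with hS
  have hfc : ∀ m, Continuous fun θ : ℝ => ‖S.eval (ψ (rr m * exp (θ * I))) * k (rr m * exp (θ * I)) - kap D ψ * k 0‖ ^ 2 := by
    intro m
    have := circ_comp_cont (P.fk_diff hk S).continuousOn (rr_nonneg m) (rr_lt m)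
    exact ((this.sub continuous_const).norm.pow 2)
  have hF := fatou_real (μ := mu0) (f := fun m (θ : ℝ) => rr m * ‖S.eval (ψ (rr m * exp (θ * I))) * k (rr m * exp (θ * I)) - kap D ψ * k 0‖ ^ 2)
    (F := fun θ => ‖Kg (σ θ) - S.eval (g (σ θ))‖ ^ 2 * Real.exp (h θ))
    (C := fun m => D.l * (Kn p (ψ 0) n - 2 * rr m * Kn p (ψ 0) n + rr m * kap D ψ)) (c := D.l * (kap D ψ - Kn p (ψ 0) n))
    (fun m => mu0_cont_int (continuous_const.mul (hfc m))) (fun m θ => mul_nonneg (rr_nonneg m) (by positivity))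
    (fun θ => by positivity) (fun m => by
      rw [integral_const_mul, ← mu0_int]
      exact P.fk_dist hp hk hk2 n (rr_nonneg m) (rr_lt m)) (by
      have h1 := rr_tendsto'
      have : Tendsto (fun m => D.l * (Kn p (ψ 0) n - 2 * rr m * Kn p (ψ 0) n + rr m * kap D ψ)) atTop
          (nhds (D.l * (Kn p (ψ 0) n - 2 * 1 * Kn p (ψ 0) n + 1 * kap D ψ))) :=
        ((by fun_prop : Continuous fun x : ℝ => D.l * (Kn p (ψ 0) n - 2 * x * Kn p (ψ 0) n + x * kap D ψ)).tendsto 1).comp h1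
      convert this using 2; ring) (by
      filter_upwards [P.ntlim_radial hKg, P.lim_norm] with θ h1 h2
      have h3 : Tendsto (fun m => S.eval (ψ (rr m * exp (θ * I)))) atTop (nhds (S.eval (g (σ θ)))) := by
        rw [← P.bdry]
        exact (S.continuous.tendsto _).comp (bdry_tendsto P.toDiskParam θ)
      have h4 := (rr_tendsto'.mul (((h1.sub h3).norm.pow 2).mul (h2.comp rr_tendsto)))
      rw [one_mul] at h4
      refine h4.congr fun m => ?_
      have hm := circ_mem (rr_nonneg m) (rr_lt m) θ
      have e := P.szego_id hp hk hk2 hK (w := rr m * exp (θ * I)) (by simpa using hm)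
      rw [← e, ← sub_mul, norm_mul, mul_pow, ← norm_pow (k _), hk2 _ hm, norm_sub_rev]
      rfl)
  have hme := P.σ_cont.measurableEmbedding P.σ_inj
  rw [← P.map_eq, hme.integrable_map_iff, hme.integral_map, P.muE_int]
  refine ⟨?_, hF.2⟩
  rw [muE, integrable_withDensity_iff_integrable_smul₀' P.exp_int.1.1.aemeasurable.ennreal_ofReal
    (Eventually.of_forall fun _ => ENNReal.ofReal_lt_top)]
  refine hF.1.congr (Eventually.of_forall fun θ => ?_)
  simp only [Function.comp, ENNReal.toReal_ofReal (Real.exp_pos _).le, smul_eq_mul]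
  ring

theorem Setup.L2_eq (P : Setup D ψ g σ h) (hp : D.IsONPolys p) (hk : DifferentiableOn ℂ k (ball 0 1))
    (hk2 : ∀ w ∈ ball (0:ℂ) 1, k w ^ 2 = deriv ψ w) (hK : Tendsto (Kn p (ψ 0)) atTop (nhds (kap D ψ)))
    {Kg : ℝ → ℂ}
    (hKg : ∀ᵐ s ∂(volume.restrict (Ioc (0 : ℝ) D.l)), NTLim D.G (szegoKernel p (ψ 0)) (g s) (Kg s)) (n : ℕ) :
    (1 / D.l) * ∫ s in (0:ℝ)..D.l, ‖Kg s - partialSum p (ψ 0) n (g s)‖ ^ 2 = kap D ψ - Kn p (ψ 0) n := by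
  have hl := D.l_pos
  simp_rw [← Spoly_eval]
  rw [intervalIntegral.integral_of_le hl.le]
  set X : ℕ → ℝ := fun n => ∫ s, ‖Kg s - (Spoly p (ψ 0) n).eval (g s)‖ ^ 2 ∂(volume.restrict (Ioc (0:ℝ) D.l)) with hX
  have hU := P.L2_upper hp hk hk2 hK hKg
  have hXn : X n ≤ D.l * (kap D ψ - Kn p (ψ 0) n) := (hU n).2
  have hX0 : 0 ≤ X n := integral_nonneg fun s => by positivity
  have key : ∀ t : ℝ, 0 < t → ∀ m ≥ n, D.l * (Kn p (ψ 0) m - Kn p (ψ 0) n) ≤ (1 + t) * X n + (1 + 1 / t) * (D.l * (kap D ψ - Kn p (ψ 0) m)) := by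
    intro t ht m hm
    have h1 := Spoly_sub_bN (ζ := ψ 0) hp hm
    rw [bN, ← P.int_eq (fun z => ‖(Spoly p (ψ 0) m - Spoly p (ψ 0) n).eval z‖ ^ 2), intervalIntegral.integral_of_le hl.le] at h1
    rw [← h1, ← mul_assoc, mul_one_div_cancel hl.ne', one_mul]
    have h3 := ((hU n).1.const_mul (1 + t)).add ((hU m).1.const_mul (1 + 1 / t))
    calc _ ≤ ∫ s, ((1 + t) * ‖Kg s - (Spoly p (ψ 0) n).eval (g s)‖ ^ 2 + (1 + 1 / t) * ‖Kg s - (Spoly p (ψ 0) m).eval (g s)‖ ^ 2) ∂(volume.restrict (Ioc (0:ℝ) D.l)) := by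
          refine integral_mono_of_nonneg (Eventually.of_forall fun s => by positivity) h3 (Eventually.of_forall fun s => ?_)
          beta_reduce
          rw [Polynomial.eval_sub]
          set a := ‖Kg s - (Spoly p (ψ 0) n).eval (g s)‖
          set b := ‖Kg s - (Spoly p (ψ 0) m).eval (g s)‖
          have h5 : ‖(Spoly p (ψ 0) m).eval (g s) - (Spoly p (ψ 0) n).eval (g s)‖ ≤ a + b := by
            have := norm_sub_le (Kg s - (Spoly p (ψ 0) n).eval (g s)) (Kg s - (Spoly p (ψ 0) m).eval (g s))
            rwa [sub_sub_sub_cancel_left] at this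
          have h6 : (a + b) ^ 2 ≤ (1 + t) * a ^ 2 + (1 + 1 / t) * b ^ 2 := by
            have : (1 + t) * a ^ 2 + (1 + 1 / t) * b ^ 2 - (a + b) ^ 2 = (t * a - b) ^ 2 / t := by field_simp; ring
            have h7 : 0 ≤ (t * a - b) ^ 2 / t := by positivity
            linarith
          exact (pow_le_pow_left₀ (norm_nonneg _) h5 2).trans h6
      _ = (1 + t) * X n + (1 + 1 / t) * X m := by
          rw [integral_add ((hU n).1.const_mul (1 + t)) ((hU m).1.const_mul (1 + 1 / t)), integral_const_mul, integral_const_mul]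
      _ ≤ _ := by
          have := (hU m).2
          gcongr
  have key2 : ∀ t : ℝ, 0 < t → D.l * (kap D ψ - Kn p (ψ 0) n) ≤ (1 + t) * X n := by
    intro t ht
    have h1 : Tendsto (fun m => (1 + t) * X n + (1 + 1 / t) * (D.l * (kap D ψ - Kn p (ψ 0) m))) atTop
        (nhds ((1 + t) * X n + (1 + 1 / t) * (D.l * (kap D ψ - kap D ψ)))) :=
      (((hK.const_sub _).const_mul _).const_mul _).const_add _
    rw [sub_self, mul_zero, mul_zero, add_zero] at h1
    exact le_of_tendsto_of_tendsto ((hK.sub_const _).const_mul _) h1 (by filter_upwards [eventually_ge_atTop n] with m hm using key t ht m hm)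
  have h8 : D.l * (kap D ψ - Kn p (ψ 0) n) ≤ X n := by
    have h1 : Tendsto (fun t : ℝ => (1 + t) * X n) (nhdsWithin 0 (Ioi 0)) (nhds ((1 + 0) * X n)) :=
      tendsto_nhdsWithin_of_tendsto_nhds ((by fun_prop : Continuous fun t : ℝ => (1 + t) * X n).tendsto 0)
    rw [add_zero, one_mul] at h1
    exact ge_of_tendsto h1 (by filter_upwards [self_mem_nhdsWithin] with t ht using key2 t ht)
  have h9 : X n = D.l * (kap D ψ - Kn p (ψ 0) n) := le_antisymm hXn h8
  change 1 / D.l * X n = _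
  rw [h9, ← mul_assoc, one_div_mul_cancel hl.ne', one_mul]

theorem Setup.bnorm_eq (P : Setup D ψ g σ h) (hp : D.IsONPolys p) (hk : DifferentiableOn ℂ k (ball 0 1))
    (hk2 : ∀ w ∈ ball (0:ℂ) 1, k w ^ 2 = deriv ψ w) (hK : Tendsto (Kn p (ψ 0)) atTop (nhds (kap D ψ)))
    {Kb : ℝ → ℂ}
    (hKb : ∀ᵐ s ∂(volume.restrict (Ioc (0 : ℝ) D.l)), NTLim D.G (szegoKernel p (ψ 0)) (D.γ s) (Kb s)) (n : ℕ) :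
    D.bnorm (fun s => Kb s - partialSum p (ψ 0) n (D.γ s)) = Real.sqrt (kap D ψ - Kn p (ψ 0) n) := by
  rw [JordanDomain.bnorm]
  congr 1
  rcases P.g_eq with hg | hg
  · have hg' : D.γ = g := funext fun s => (hg s).symm
    rw [hg'] at hKb ⊢
    exact P.L2_eq hp hk hk2 hK hKb n
  · have hg' : ∀ s, g s = D.γ (D.l - s) := fun s => by
      rw [hg, ← D.γ_periodic (-s)]; congr 1; ring
    have hmp : MeasurePreserving (fun s : ℝ => D.l - s) volume volume := Measure.measurePreserving_sub_left volume D.l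
    have h1 : ∀ᵐ s ∂(volume.restrict (Ico (0 : ℝ) D.l)), NTLim D.G (szegoKernel p (ψ 0)) (g s) (Kb (D.l - s)) := by
      have h2 : MeasurePreserving (fun s : ℝ => D.l - s) (volume.restrict (Ico (0:ℝ) D.l)) (volume.restrict (Ioc (0:ℝ) D.l)) := by
        have := hmp.restrict_preimage (s := Ioc (0:ℝ) D.l) measurableSet_Ioc
        simpa using this
      have := h2.quasiMeasurePreserving.ae hKb
      simpa only [hg'] using this
    rw [restrict_Ico_eq_restrict_Ioc] at h1
    have h3 := P.L2_eq hp hk hk2 hK h1 n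
    rw [← h3]
    have h4 := intervalIntegral.integral_comp_sub_left (a := 0) (b := D.l) (fun s => ‖Kb s - partialSum p (ψ 0) n (D.γ s)‖ ^ 2) D.l
    rw [sub_self, sub_zero] at h4
    rw [← h4]
    simp only [hg']

theorem Setup.final (P : Setup D ψ g σ h) (hp : D.IsONPolys p) {φ : ℂ → ℂ} {u : ℂ} (hφ : ConformalOnto D.G φ (ψ 0))
    (hφc : ContinuousOn φ (closure D.G)) (hu : ‖u‖ = 1) (hφψ : ∀ w ∈ closedBall (0:ℂ) 1, φ (ψ w) = u * w) {Kb : ℝ → ℂ}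
    (hKb : ∀ᵐ s ∂(volume.restrict (Ioc (0 : ℝ) D.l)), NTLim D.G (szegoKernel p (ψ 0)) (D.γ s) (Kb s)) :
    (∀ n : ℕ,
      supNormOn (closure D.G) (fun z => φ z - Jfun D p (ψ 0) n z) ≤
        8 * Real.pi * D.bnorm (fun s => Kb s - partialSum p (ψ 0) n (D.γ s))) ∧
    Tendsto (fun n : ℕ => D.bnorm (fun s => Kb s - partialSum p (ψ 0) n (D.γ s)))
      atTop (nhds 0) := by
  have hu0 : u ≠ 0 := by intro h; simp [h] at hu
  obtain ⟨k, hk, hk2⟩ := exists_sqrt (P.diff.deriv isOpen_ball) P.ne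
  have hK := P.Kn_tendsto hp (χ := fun z => u⁻¹ * φ z) (hφc.const_mul _) (fun z hz => (hφ.differentiable z hz).const_mul _)
    (fun w hw => by rw [hφψ w hw]; field_simp)
  have hbn := P.bnorm_eq hp hk hk2 hK hKb
  simp_rw [hbn]
  have hu2 : u * ‖deriv ψ 0‖ = deriv ψ 0 := by
    obtain ⟨c, hc, hcd⟩ := hφ.deriv_center_pos
    have h0 : (0:ℂ) ∈ ball (0:ℂ) 1 := by simp
    have h1 := (hφ.differentiable _ (P.bij.mapsTo h0)).hasDerivAt.comp 0 (P.diff.differentiableAt (isOpen_ball.mem_nhds h0)).hasDerivAt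
    have h2 : HasDerivAt (fun w => u * w) u (0:ℂ) := by simpa using (hasDerivAt_id (0:ℂ)).const_mul u
    have h3 : HasDerivAt (φ ∘ ψ) u 0 := h2.congr_of_eventuallyEq (by
      filter_upwards [isOpen_ball.mem_nhds h0] with w hw using hφψ w (ball_subset_closedBall hw))
    have h4 := h1.unique h3
    rw [hcd] at h4
    have h5 : c * ‖deriv ψ 0‖ = 1 := by
      have := congrArg norm h4
      rwa [norm_mul, hu, Complex.norm_real, Real.norm_of_nonneg hc.le] at this
    rw [← h4, mul_right_comm, ← Complex.ofReal_mul, h5]; simp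
  constructor
  · intro n
    have : Nonempty (closure D.G) := (D.nonempty.closure).to_subtype
    refine ciSup_le fun z => ?_
    obtain ⟨w, hw, hz⟩ := P.bijc.surjOn z.2
    rw [← hz]; beta_reduce; rw [hφψ w hw]
    exact P.sup_bound hp hk hk2 hu hu2 n hw
  · have h1 := (Real.continuous_sqrt.tendsto _).comp (hK.const_sub (kap D ψ))
    rw [sub_self, Real.sqrt_zero] at h1
    exact h1
end


/-- Theorem 1.1. Let `G` be a Smirnov domain and `ζ ∈ G`. Then for
every `n`, `‖φ - J_{2n+1}‖_∞ ≤ 8π·‖K(·,ζ) - Σ_{k=0}^n conj(p_k(ζ))p_k(·)‖₂`, and the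
right-hand side tends to `0` as `n → ∞`; in particular `J_{2n+1} → φ` uniformly on the
closure of `G`.  Here `Kb` is the nontangential boundary trace of the Szegő kernel
`K(·,ζ)` on the boundary curve. -/
theorem szegoKernelMethod_uniform_convergence
    (D : JordanDomain) (hSmirnov : IsSmirnovDomain D.G)
    (p : ℕ → Polynomial ℂ) (hp : D.IsONPolys p)
    (ζ : ℂ) (hζ : ζ ∈ D.G)
    (φ : ℂ → ℂ) (hφ : ConformalOnto D.G φ ζ) (hφc : ContinuousOn φ (closure D.G))
    (Kb : ℝ → ℂ)
    (hKb : ∀ᵐ s ∂(volume.restrict (Ioc (0 : ℝ) D.l)),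
      NTLim D.G (szegoKernel p ζ) (D.γ s) (Kb s)) :
    (∀ n : ℕ,
      supNormOn (closure D.G) (fun z => φ z - Jfun D p ζ n z) ≤
        8 * Real.pi * D.bnorm (fun s => Kb s - partialSum p ζ n (D.γ s))) ∧
    Tendsto (fun n : ℕ => D.bnorm (fun s => Kb s - partialSum p ζ n (D.γ s)))
      atTop (nhds 0) := by
  obtain ⟨ψ, g, σ, u, h, P, hu, hφψ, rfl⟩ := setup_exists D hSmirnov hφ hφc hζ
  exact P.final hp hφ hφc hu hφψ hKb
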